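/- arXiv:0801.4162 — 2 statements merged into one kernel-verified Lean document; each statement's English description precedes it below -/
import Mathlib

section
/- Fix nonzero integers a_1, …, a_r with a_i ≠ ±a_j for i ≠ j, positive integers m_1, …, m_r, and an integer k > 1. For q = p^k let S_q = {χ : t_χ ≢ ±2a_j (mod p) for all j}, where χ ranges over multiplicative characters of (ℤ/qℤ)^*. Then, as p → ∞ through the primes, (1/q) Σ_{χ ∈ S_q} ∏_{j=1}^r 𝒦_q(a_j,χ)^{m_j} converges to ∏_{j=1}^r c(m_j), where c(m) = (1/2)·binom(m, m/2) if m is even and c(m) = 0 if m is odd; equivalently the limit equals ∏_j ∫_{−2}^{2} x^{m_j} dμ(x). -/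
open Complex Finset

/-- The standard additive character `e_q(x) = exp(2πix/q)` of `ℤ/qℤ`. -/
noncomputable def eZMod (q : ℕ) (x : ZMod q) : ℂ :=
  Complex.exp (2 * Real.pi * Complex.I * x.val / q)

/-- The twisted Kloosterman sum `K_q(a,b,χ) = ∑_{x ∈ (ℤ/qℤ)^*} e_q(ax + bx⁻¹)χ(x)`,
written as a sum over the natural representatives of the units of `ℤ/qℤ`. -/
noncomputable def Kloos (q : ℕ) (a b : ZMod q) (χ : MulChar (ZMod q) ℂ) : ℂ :=
  ∑ n ∈ (Finset.range q).filter (fun n => Nat.Coprime n q),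
    eZMod q (a * (n : ZMod q) + b * ((n : ZMod q)⁻¹)) * χ (n : ZMod q)

/-- The normalized twisted Kloosterman sum `𝒦_q(a,χ) = q^{-1/2} K_q(a,-a,χ)`,
a real number. -/
noncomputable def nKloos (q : ℕ) (a : ℤ) (χ : MulChar (ZMod q) ℂ) : ℝ :=
  (((q : ℝ) ^ (-(1/2 : ℝ))) • Kloos q (a : ZMod q) (-(a : ℤ) : ZMod q) χ).re

/-- The `m`-th moment `∫ x^m dμ = ½·C(m, m/2)` for `m` even, `0` for `m` odd. -/
noncomputable def momentMu (m : ℕ) : ℝ :=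
  if Even m then (1 / 2) * (m.choose (m / 2)) else 0

section Stepanov
open Polynomial

/-- The operator `s ↦ f s' + e f' s` on polynomials. -/
noncomputable def twistedDerivation {F : Type*} [Field F] (f : F[X]) (e : F) : F[X] →ₗ[F] F[X] :=
  LinearMap.mulLeft F f ∘ₗ derivative + e • LinearMap.mulLeft F (derivative f)

theorem twistedDerivation_apply {F : Type*} [Field F] (f : F[X]) (e : F) (s : F[X]) :
    twistedDerivation f e s = f * derivative s + C e * (derivative f * s) := by
  simp [twistedDerivation, smul_eq_C_mul]

theorem twistedDerivation_mem_degreeLT {F : Type*} [Field F] {f : F[X]} {m d : ℕ}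
    (hf : f.natDegree ≤ m) (e : F) {s : F[X]} (hs : s ∈ degreeLT F d) :
    twistedDerivation f e s ∈ degreeLT F (d + m) := by
  by_cases hs0 : s = 0
  · simp [hs0]
  rw [mem_degreeLT] at hs
  have hs' : s.natDegree < d := (natDegree_lt_iff_degree_lt hs0).2 hs
  have h1 : (twistedDerivation f e s).natDegree < d + m := by
    rw [twistedDerivation_apply]
    refine lt_of_le_of_lt (natDegree_add_le _ _) (max_lt ?_ ?_)
    · refine lt_of_le_of_lt natDegree_mul_le ?_
      have := natDegree_derivative_le s
      omega
    · refine lt_of_le_of_lt (natDegree_C_mul_le _ _) (lt_of_le_of_lt natDegree_mul_le ?_)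
      have := natDegree_derivative_le f
      omega
  rw [mem_degreeLT]
  exact lt_of_le_of_lt degree_le_natDegree (by exact_mod_cast h1)

theorem twistedDerivation_pow_mem_degreeLT {F : Type*} [Field F] {f : F[X]} {m d : ℕ}
    (hf : f.natDegree ≤ m) (e : F) {s : F[X]} (hs : s ∈ degreeLT F d) (i : ℕ) :
    (twistedDerivation f e ^ i) s ∈ degreeLT F (d + i * m) := by
  induction i with
  | zero => simpa using hs
  | succ i ih =>
    rw [pow_succ', Module.End.mul_apply, add_mul, one_mul, ← add_assoc]
    exact twistedDerivation_mem_degreeLT hf e ih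

theorem eval_twistedDerivation_pow_ne_zero {p : ℕ} [Fact p.Prime] {f : (ZMod p)[X]} {x : ZMod p}
    (hf : f.eval x ≠ 0) (n : ℕ) (hn : n < p) (G : (ZMod p)[X]) (hG : G.eval x ≠ 0) :
    ((twistedDerivation f 0 ^ n) ((X - C x) ^ n * G)).eval x ≠ 0 := by
  induction n generalizing G with
  | zero => simpa using hG
  | succ n ih =>
    have h : twistedDerivation f 0 ((X - C x) ^ (n + 1) * G) =
        (X - C x) ^ n * (f * (C ((n + 1 : ℕ) : ZMod p) * G + (X - C x) * derivative G)) := by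
      rw [twistedDerivation_apply]
      simp only [derivative_mul, derivative_X_sub_C_pow, map_zero]
      simp
      ring
    rw [pow_succ, Module.End.mul_apply, h]
    refine ih (by omega) _ ?_
    have h0 : ((n + 1 : ℕ) : ZMod p) ≠ 0 := by
      rw [Ne, ZMod.natCast_eq_zero_iff]
      exact Nat.not_dvd_of_pos_of_lt (by omega) hn
    simp only [eval_mul, eval_add, eval_C, eval_sub, eval_X, sub_self, zero_mul, add_zero]
    exact mul_ne_zero hf (mul_ne_zero h0 hG)

theorem le_rootMultiplicity_of_twistedDerivation_pow {p : ℕ} [Fact p.Prime] {f E : (ZMod p)[X]}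
    {x : ZMod p} {M : ℕ} (hf : f.eval x ≠ 0) (hE : E ≠ 0) (hM : M ≤ p)
    (h : ∀ i < M, ((twistedDerivation f 0 ^ i) E).eval x = 0) : M ≤ E.rootMultiplicity x := by
  by_contra! hlt
  obtain ⟨G, hG, hG'⟩ := exists_eq_pow_rootMultiplicity_mul_and_not_dvd E hE x
  rw [dvd_iff_isRoot] at hG'
  refine eval_twistedDerivation_pow_ne_zero hf (E.rootMultiplicity x) (by omega) G hG' ?_
  rw [← hG]
  exact h _ hlt

theorem exists_stepanov_coefficients {F : Type*} [Field F] {f : F[X]} {m : ℕ}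
    (hf : f.natDegree ≤ m) (c σ : F) {d J M : ℕ} (h : M * (d + M * m + J) < 2 * (J * d)) :
    ∃ r s : Fin J → F[X], (∀ j, r j ∈ degreeLT F d ∧ s j ∈ degreeLT F d) ∧
      (∃ j, r j ≠ 0 ∨ s j ≠ 0) ∧
      ∀ i < M, ∑ j, ((twistedDerivation f 0 ^ i) (r j) +
        C σ * (twistedDerivation f c ^ i) (s j)) * X ^ (j : ℕ) = 0 := by
  let V := Fin 2 × Fin J × Fin d → F
  let B : Fin 2 → Fin J → V →ₗ[F] F[X] := fun b j =>
    (degreeLT F d).subtype ∘ₗ ((degreeLTEquiv F d).symm : (Fin d → F) →ₗ[F] degreeLT F d) ∘ₗ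
      LinearMap.funLeft F F (fun i => (b, j, i))
  have hB : ∀ b j v, B b j v ∈ degreeLT F d := fun b j v => Subtype.property _
  let Q : ℕ → V →ₗ[F] F[X] := fun i =>
    ∑ j : Fin J, LinearMap.mulRight F (X ^ (j : ℕ)) ∘ₗ
      ((twistedDerivation f 0 ^ i) ∘ₗ B 0 j + σ • (twistedDerivation f c ^ i) ∘ₗ B 1 j)
  have hQ : ∀ i v, Q i v = ∑ j, ((twistedDerivation f 0 ^ i) (B 0 j v) +
        C σ * (twistedDerivation f c ^ i) (B 1 j v)) * X ^ (j : ℕ) := by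
    intro i v
    simp [Q, LinearMap.sum_apply, smul_eq_C_mul]
  have hQdeg : ∀ i < M, ∀ v, Q i v ∈ degreeLT F (d + M * m + J) := by
    intro i hi v
    rw [hQ]
    refine Submodule.sum_mem _ fun j _ => ?_
    have h1 : (twistedDerivation f 0 ^ i) (B 0 j v) +
        C σ * (twistedDerivation f c ^ i) (B 1 j v) ∈ degreeLT F (d + i * m) := by
      rw [← smul_eq_C_mul]
      exact Submodule.add_mem _ (twistedDerivation_pow_mem_degreeLT hf _ (hB _ _ _) _)
        (Submodule.smul_mem _ _ (twistedDerivation_pow_mem_degreeLT hf _ (hB _ _ _) _))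
    generalize (twistedDerivation f 0 ^ i) (B 0 j v) +
        C σ * (twistedDerivation f c ^ i) (B 1 j v) = u at h1
    by_cases hu : u = 0
    · simp [hu]
    rw [mem_degreeLT] at h1 ⊢
    have h2 := (natDegree_lt_iff_degree_lt hu).2 h1
    have h3 : (u * X ^ (j : ℕ)).natDegree < d + M * m + J := by
      rw [natDegree_mul_X_pow _ hu]
      have := Nat.mul_le_mul_right m hi.le
      omega
    exact lt_of_le_of_lt degree_le_natDegree (by exact_mod_cast h3)
  let L : V →ₗ[F] (Fin M × Fin (d + M * m + J) → F) :=
    LinearMap.pi fun z => lcoeff F (z.2 : ℕ) ∘ₗ Q z.1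
  have hker : L.ker ≠ ⊥ := by
    apply LinearMap.ker_ne_bot_of_finrank_lt
    simp only [V, Module.finrank_fintype_fun_eq_card, Fintype.card_prod, Fintype.card_fin]
    exact h
  obtain ⟨v, hv, hv0⟩ := (Submodule.ne_bot_iff _).1 hker
  refine ⟨fun j => B 0 j v, fun j => B 1 j v, fun j => ⟨hB _ _ _, hB _ _ _⟩, ?_, ?_⟩
  · by_contra! hcon
    apply hv0
    have hz : ∀ b j, B b j v = 0 := by
      intro b j
      fin_cases b
      · exact (hcon j).1
      · exact (hcon j).2
    funext z
    obtain ⟨b, j, i⟩ := z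
    have h1 := hz b j
    simp only [B, LinearMap.comp_apply, Submodule.subtype_apply, LinearEquiv.coe_coe,
      ZeroMemClass.coe_eq_zero, LinearEquiv.map_eq_zero_iff] at h1
    exact congrFun h1 i
  · intro i hi
    rw [← hQ]
    ext n
    rw [coeff_zero]
    by_cases hn : n < d + M * m + J
    · exact congrFun hv (⟨i, hi⟩, ⟨n, hn⟩)
    · refine coeff_eq_zero_of_degree_lt (lt_of_lt_of_le (mem_degreeLT.1 (hQdeg i hi v)) ?_)
      exact_mod_cast not_lt.1 hn

theorem sum_mul_X_pow_eq_of_min {F : Type*} [Field F] {J p : ℕ} (r : Fin J → F[X]) (i : Fin J)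
    (h : ∀ j < i, r j = 0) :
    ∃ R : F[X], ∑ j, r j * X ^ ((j : ℕ) * p) = X ^ ((i : ℕ) * p) * (r i + X ^ p * R) := by
  refine ⟨∑ j ∈ univ.filter (i < ·), r j * X ^ (((j : ℕ) - i - 1) * p), ?_⟩
  have h1 : ∀ j : Fin J, r j * X ^ ((j : ℕ) * p) = (if j = i then r j * X ^ ((j : ℕ) * p) else 0) +
      (if i < j then r j * X ^ ((j : ℕ) * p) else 0) := by
    intro j
    rcases lt_trichotomy j i with hj | hj | hj
    · simp [h j hj]
    · simp [hj]
    · simp [hj, hj.ne']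
  rw [sum_congr rfl fun j _ => h1 j, sum_add_distrib, sum_ite_eq', if_pos (mem_univ _),
    ← sum_filter, mul_add, mul_comm (r i), mul_sum, mul_sum]
  congr 1
  refine sum_congr rfl fun j hj => ?_
  have hj' : (i : ℕ) < j := (mem_filter.1 hj).2
  obtain ⟨e, he⟩ := Nat.exists_eq_add_of_lt hj'
  rw [he, show (i : ℕ) + e + 1 - i - 1 = e by omega]
  ring

theorem stepanov_ne_zero {p : ℕ} [Fact p.Prime] (hp2 : p ≠ 2) {f : (ZMod p)[X]} {m d J : ℕ}
    (hf : f.natDegree ≤ m) (hf0 : f.eval 0 ≠ 0) {c : ZMod p} (hc : Odd (f.rootMultiplicity c))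
    (hd : m + 2 * d ≤ p) {r s : Fin J → (ZMod p)[X]}
    (hrs : ∀ j, r j ∈ degreeLT (ZMod p) d ∧ s j ∈ degreeLT (ZMod p) d)
    (hne : ∃ j, r j ≠ 0 ∨ s j ≠ 0) :
    ∑ j, (r j + s j * f ^ (p / 2)) * X ^ ((j : ℕ) * p) ≠ 0 := by
  classical
  intro hE
  have hp : p.Prime := Fact.out
  have hodd : 2 * (p / 2) + 1 = p := Nat.two_mul_div_two_add_one_of_odd (hp.odd_of_ne_two hp2)
  obtain ⟨i, hi, hmin⟩ := WellFounded.has_min (wellFounded_lt : WellFounded (α := Fin J) (· < ·))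
    {j | r j ≠ 0 ∨ s j ≠ 0} hne
  have hmin' : ∀ j < i, r j = 0 ∧ s j = 0 := by
    intro j hj
    by_contra hcon
    exact hmin j (by simp only [Set.mem_ofPred_eq]; tauto) hj
  obtain ⟨R, hR⟩ := sum_mul_X_pow_eq_of_min (p := p) r i fun j hj => (hmin' j hj).1
  obtain ⟨S, hS⟩ := sum_mul_X_pow_eq_of_min (p := p) s i fun j hj => (hmin' j hj).2
  have hE' : (r i + X ^ p * R) + (s i + X ^ p * S) * f ^ (p / 2) = 0 := by
    have h1 : X ^ ((i : ℕ) * p) * ((r i + X ^ p * R) + (s i + X ^ p * S) * f ^ (p / 2)) = 0 := by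
      rw [mul_add, ← mul_assoc, ← hR, ← hS, ← hE, sum_mul, ← sum_add_distrib]
      exact sum_congr rfl fun j _ => by ring
    exact (mul_eq_zero.1 h1).resolve_left (pow_ne_zero _ X_ne_zero)
  obtain ⟨h, hh⟩ : ∃ h, f ^ p = C (f.eval 0) + X ^ p * h := by
    refine ⟨expand (ZMod p) p f.divX, ?_⟩
    rw [← ZMod.expand_card]
    conv_lhs => rw [← divX_mul_X_add f]
    simp [coeff_zero_eq_eval_zero]
    ring
  have hsq : f * (r i + X ^ p * R) ^ 2 = (s i + X ^ p * S) ^ 2 * f ^ p := by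
    rw [eq_neg_of_add_eq_zero_left hE']
    have hfp : f ^ p = f * (f ^ (p / 2)) ^ 2 := by
      rw [← pow_mul, ← pow_succ', mul_comm, hodd]
    rw [hfp]
    ring
  rw [hh] at hsq
  have hdvd : X ^ p ∣ f * r i ^ 2 - C (f.eval 0) * s i ^ 2 := by
    refine ⟨(2 * s i * S + X ^ p * S ^ 2) * (C (f.eval 0) + X ^ p * h) + s i ^ 2 * h -
      f * (2 * r i * R + X ^ p * R ^ 2), ?_⟩
    linear_combination hsq
  have hz : f * r i ^ 2 - C (f.eval 0) * s i ^ 2 = 0 := by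
    by_contra hnz
    have h1 := natDegree_le_of_dvd hdvd hnz
    rw [natDegree_X_pow] at h1
    have hdeg : ∀ u ∈ degreeLT (ZMod p) d, u = 0 ∨ u.natDegree < d := by
      intro u hu
      by_cases hu0 : u = 0
      · exact Or.inl hu0
      · exact Or.inr ((natDegree_lt_iff_degree_lt hu0).2 (mem_degreeLT.1 hu))
    have h2 : (f * r i ^ 2).natDegree < p := by
      rcases hdeg _ (hrs i).1 with h0 | h0
      · simp [h0, hp.pos]
      · have := natDegree_mul_le (p := f) (q := r i ^ 2)
        have := natDegree_pow_le (p := r i) (n := 2)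
        omega
    have h3 : (C (f.eval 0) * s i ^ 2).natDegree < p := by
      rcases hdeg _ (hrs i).2 with h0 | h0
      · simp [h0, hp.pos]
      · have := natDegree_C_mul_le (f.eval 0) (s i ^ 2)
        have := natDegree_pow_le (p := s i) (n := 2)
        omega
    have h4 := natDegree_sub_le (f * r i ^ 2) (C (f.eval 0) * s i ^ 2)
    have := max_lt h2 h3
    omega
  have heq := sub_eq_zero.1 hz
  have hfne : f ≠ 0 := by rintro rfl; simp at hf0
  have hr0 : r i ≠ 0 := by
    intro hr
    simp [hr, hf0] at heq hi
    exact hi heq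
  have hs0 : s i ≠ 0 := by
    intro hs
    simp [hs, hfne, hr0] at heq
  have hmul := congrArg (rootMultiplicity c) heq
  rw [rootMultiplicity_mul (mul_ne_zero hfne (pow_ne_zero _ hr0)),
    rootMultiplicity_mul (mul_ne_zero (C_ne_zero.2 hf0) (pow_ne_zero _ hs0)), pow_two, pow_two,
    rootMultiplicity_mul (mul_ne_zero hr0 hr0), rootMultiplicity_mul (mul_ne_zero hs0 hs0),
    rootMultiplicity_C] at hmul
  obtain ⟨w, hw⟩ := hc
  omega

theorem twistedDerivation_pow_stepanov {p : ℕ} [Fact p.Prime] (f : (ZMod p)[X])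
    {J : ℕ} (r s : Fin J → (ZMod p)[X]) (i : ℕ) :
    (twistedDerivation f 0 ^ i) (∑ j, (r j + s j * f ^ (p / 2)) * X ^ ((j : ℕ) * p)) =
      ∑ j, ((twistedDerivation f 0 ^ i) (r j) +
        (twistedDerivation f ((p / 2 : ℕ) : ZMod p) ^ i) (s j) * f ^ (p / 2)) *
          X ^ ((j : ℕ) * p) := by
  have hp : p.Prime := Fact.out
  have hpos : 0 < p / 2 := Nat.div_pos hp.two_le two_pos
  induction i with
  | zero => simp
  | succ i ih =>
    rw [pow_succ', Module.End.mul_apply, ih, map_sum]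
    refine sum_congr rfl fun j _ => ?_
    rw [pow_succ', Module.End.mul_apply, Module.End.mul_apply]
    generalize (twistedDerivation f 0 ^ i) (r j) = u
    generalize (twistedDerivation f ((p / 2 : ℕ) : ZMod p) ^ i) (s j) = v
    simp only [twistedDerivation_apply, derivative_mul, derivative_add, derivative_pow]
    obtain ⟨n, hn⟩ : ∃ n, p / 2 = n + 1 := ⟨p / 2 - 1, by omega⟩
    rw [hn]
    simp
    ring

/-- Stepanov's bound for the number of `x` with `f(x)^((p-1)/2) = σ`. -/
theorem stepanov_card_mul_le {p : ℕ} [Fact p.Prime] (hp2 : p ≠ 2) {f : (ZMod p)[X]}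
    {m d J M : ℕ} (hf : f.natDegree ≤ m) (hf0 : f.eval 0 ≠ 0) {c : ZMod p}
    (hc : Odd (f.rootMultiplicity c)) (hd : m + 2 * d ≤ p) (hM : M ≤ p)
    (h : M * (d + M * m + J) < 2 * (J * d)) {σ : ZMod p} (hσ : σ ≠ 0) :
    #{x : ZMod p | f.eval x ^ (p / 2) = σ} * M ≤ d + m * (p / 2) + (J - 1) * p := by
  classical
  have hp : p.Prime := Fact.out
  have hpos : 0 < p / 2 := Nat.div_pos hp.two_le two_pos
  obtain ⟨r, s, hrs, hne, hvan⟩ :=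
    exists_stepanov_coefficients hf ((p / 2 : ℕ) : ZMod p) σ h
  set E := ∑ j, (r j + s j * f ^ (p / 2)) * X ^ ((j : ℕ) * p) with hEdef
  have hE : E ≠ 0 := stepanov_ne_zero hp2 hf hf0 hc hd hrs hne
  have hmult : ∀ x ∈ univ.filter (fun x : ZMod p => f.eval x ^ (p / 2) = σ),
      M ≤ E.rootMultiplicity x := by
    intro x hx
    have hx' : f.eval x ^ (p / 2) = σ := (mem_filter.1 hx).2
    have hfx : f.eval x ≠ 0 := by
      intro h0
      rw [h0, zero_pow hpos.ne'] at hx'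
      exact hσ hx'.symm
    refine le_rootMultiplicity_of_twistedDerivation_pow hfx hE hM fun i hi => ?_
    rw [hEdef, twistedDerivation_pow_stepanov, eval_finsetSum]
    have h1 := congrArg (eval x) (hvan i hi)
    rw [eval_finsetSum, eval_zero] at h1
    refine Eq.trans ?_ h1
    refine sum_congr rfl fun j _ => ?_
    simp only [eval_mul, eval_add, eval_pow, eval_X, eval_C, hx', mul_comm (j : ℕ) p, pow_mul,
      ZMod.pow_card]
    ring
  have hdeg : E.natDegree ≤ d + m * (p / 2) + (J - 1) * p := by
    refine natDegree_sum_le_of_forall_le _ _ fun j _ => ?_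
    have hlt : ∀ u ∈ degreeLT (ZMod p) d, u.natDegree ≤ d := by
      intro u hu
      exact natDegree_le_of_degree_le (mem_degreeLT.1 hu).le
    refine natDegree_mul_le.trans (add_le_add ?_ ?_)
    · refine (natDegree_add_le _ _).trans (max_le ((hlt _ (hrs j).1).trans (by omega)) ?_)
      refine natDegree_mul_le.trans (add_le_add (hlt _ (hrs j).2) ?_)
      refine natDegree_pow_le.trans ?_
      rw [mul_comm]
      exact Nat.mul_le_mul_right _ hf
    · rw [natDegree_X_pow]
      exact Nat.mul_le_mul_right _ (by omega)
  calc #{x : ZMod p | f.eval x ^ (p / 2) = σ} * M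
      ≤ ∑ x ∈ univ.filter (fun x : ZMod p => f.eval x ^ (p / 2) = σ), E.rootMultiplicity x := by
        rw [← smul_eq_mul]
        exact card_nsmul_le_sum _ _ _ hmult
    _ ≤ ∑ x ∈ univ, E.roots.count x := by
        simp only [count_roots]
        exact sum_le_sum_of_subset (filter_subset _ _)
    _ = E.roots.card := Multiset.sum_count_eq_card fun _ _ => mem_univ _
    _ ≤ E.natDegree := card_roots' E
    _ ≤ _ := hdeg


theorem quadraticChar_eq_indicator_sub {p : ℕ} [Fact p.Prime] (hp2 : p ≠ 2) (y : ZMod p) :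
    (quadraticChar (ZMod p) y : ℤ) =
      (if y ^ (p / 2) = 1 then 1 else 0) - (if y ^ (p / 2) = -1 then 1 else 0) := by
  have hp : p.Prime := Fact.out
  have hchar : ringChar (ZMod p) ≠ 2 := by rwa [ZMod.ringChar_zmod_n]
  have hneg : (1 : ZMod p) ≠ -1 := (Ring.neg_one_ne_one_of_char_ne_two hchar).symm
  by_cases hy : y = 0
  · have hpos : p / 2 ≠ 0 := (Nat.div_pos hp.two_le two_pos).ne'
    simp [hy, hpos]
  · rw [quadraticChar_eq_pow_of_char_ne_two hchar hy, ZMod.card]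
    rcases ZMod.pow_div_two_eq_neg_one_or_one p hy with h | h
    · simp [h, hneg]
    · simp [h, hneg.symm]

/-- Quadratic character sums of polynomials of bounded degree with a root of odd multiplicity
are `o(p)`. -/
theorem exists_abs_sum_quadraticChar_le (m : ℕ) {ε : ℝ} (hε : 0 < ε) :
    ∃ P : ℕ, ∀ (p : ℕ) [Fact p.Prime], P ≤ p → ∀ f : (ZMod p)[X], f.natDegree ≤ m →
      f.eval 0 ≠ 0 → (∃ c, Odd (f.rootMultiplicity c)) →
      |∑ x : ZMod p, ((quadraticChar (ZMod p) (f.eval x) : ℤ) : ℝ)| ≤ ε * p := by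
  obtain ⟨J, hJ⟩ := exists_nat_gt (2 * m / ε + 1)
  obtain ⟨P, hP⟩ := exists_nat_gt (2 * m / ε)
  have hJ1 : 1 < J := by
    have : (1 : ℝ) < J := lt_of_le_of_lt (by simp; positivity) hJ
    exact_mod_cast this
  set M := 2 * J - 1 with hM
  refine ⟨P + 3 + m + 2 * (M * (M * m + J) + 2) + M, fun p _ hp f hf hf0 ⟨c, hc⟩ => ?_⟩
  have hp2 : p ≠ 2 := by omega
  have hmulP : (p : ℝ) * ε ≥ 2 * m := by
    have h1 : (P : ℝ) ≤ p := by exact_mod_cast (by omega : P ≤ p)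
    have := (div_lt_iff₀ hε).1 (lt_of_lt_of_le hP h1)
    linarith
  have hmM : 2 * (m : ℝ) ≤ ε * M := by
    have h1 : (J : ℝ) ≤ M := by exact_mod_cast (by omega : J ≤ M)
    have h2 : 2 * m / ε < M := by linarith
    have := (div_lt_iff₀ hε).1 h2
    linarith
  have hMpos : (0 : ℝ) < M := by exact_mod_cast (by omega : 0 < M)
  obtain ⟨e, he⟩ : ∃ e, e = M * (M * m + J) := ⟨_, rfl⟩
  rw [← he] at hp
  have hcount : ∀ σ : ZMod p, σ ≠ 0 →
      (#{x : ZMod p | f.eval x ^ (p / 2) = σ} : ℝ) * M ≤ p * (M + m) / 2 := by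
    intro σ hσ
    have hcond : M * ((p - m) / 2 + M * m + J) < 2 * (J * ((p - m) / 2)) := by
      obtain ⟨d, hd⟩ : ∃ d, d = (p - m) / 2 := ⟨_, rfl⟩
      have h1 : M * (d + M * m + J) = M * d + e := by rw [he]; ring
      have h2 : 2 * (J * d) = M * d + d := by
        rw [show 2 * (J * d) = (2 * J) * d by ring, show 2 * J = M + 1 by omega]
        ring
      rw [← hd, h1, h2]
      omega
    have h1 := stepanov_card_mul_le hp2 hf hf0 hc (d := (p - m) / 2) (J := J) (M := M)
      (by omega) (by omega) hcond hσ
    have h2 : ((p - m) / 2 + m * (p / 2) + (J - 1) * p) * 2 ≤ p * (M + m) := by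
      obtain ⟨i, rfl⟩ : ∃ i, J = i + 1 := ⟨J - 1, by omega⟩
      have h3 : M = 2 * i + 1 := by omega
      have h4 : m * (p / 2) * 2 ≤ m * p := by
        rw [mul_assoc]
        exact Nat.mul_le_mul_left _ (Nat.div_mul_le_self p 2)
      have h5 : (p - m) / 2 * 2 ≤ p := (Nat.div_mul_le_self _ 2).trans (Nat.sub_le _ _)
      rw [h3, Nat.add_sub_cancel]
      nlinarith
    have h3 : #{x : ZMod p | f.eval x ^ (p / 2) = σ} * M * 2 ≤ p * (M + m) :=
      (Nat.mul_le_mul_right 2 h1).trans h2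
    rw [le_div_iff₀ two_pos]
    exact_mod_cast h3
  have hneg : (1 : ZMod p) ≠ -1 := by
    refine (Ring.neg_one_ne_one_of_char_ne_two ?_).symm
    rwa [ZMod.ringChar_zmod_n]
  have hsum : ∑ x : ZMod p, ((quadraticChar (ZMod p) (f.eval x) : ℤ) : ℝ) =
      #{x : ZMod p | f.eval x ^ (p / 2) = 1} - #{x : ZMod p | f.eval x ^ (p / 2) = -1} := by
    rw [← Int.cast_sum, sum_congr rfl fun x _ => quadraticChar_eq_indicator_sub hp2 _,
      sum_sub_distrib, sum_boole, sum_boole]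
    push_cast
    rfl
  have hfne : f ≠ 0 := by rintro rfl; simp at hf0
  have htot : (p : ℝ) ≤ #{x : ZMod p | f.eval x ^ (p / 2) = 1} +
      #{x : ZMod p | f.eval x ^ (p / 2) = -1} + m := by
    have h1 : #{x : ZMod p | f.eval x = 0} ≤ m := by
      refine le_trans ?_ ((card_roots' f).trans hf)
      refine le_trans (card_le_card ?_) (Multiset.toFinset_card_le _)
      intro x hx
      simpa [hfne] using hx
    have h2 : (univ : Finset (ZMod p)) ⊆
        (univ.filter (fun x : ZMod p => f.eval x ^ (p / 2) = 1) ∪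
        univ.filter (fun x : ZMod p => f.eval x ^ (p / 2) = -1)) ∪
        univ.filter (fun x : ZMod p => f.eval x = 0) := by
      intro x _
      simp only [mem_union, mem_filter, mem_univ, true_and]
      by_cases hx : f.eval x = 0
      · exact Or.inr hx
      · exact Or.inl (ZMod.pow_div_two_eq_neg_one_or_one p hx)
    have h3 := (card_le_card h2).trans ((card_union_le _ _).trans
      (Nat.add_le_add_right (card_union_le _ _) _))
    rw [card_univ, ZMod.card] at h3
    have h4 := h3.trans (Nat.add_le_add_left h1 _)
    exact_mod_cast h4
  have hp1 := hcount 1 one_ne_zero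
  have hm1 := hcount (-1) (neg_ne_zero.2 one_ne_zero)
  rw [hsum]
  set a : ℝ := ((#{x : ZMod p | f.eval x ^ (p / 2) = 1} : ℕ) : ℝ)
  set b : ℝ := ((#{x : ZMod p | f.eval x ^ (p / 2) = -1} : ℕ) : ℝ)
  have hp0 : (0 : ℝ) ≤ p := Nat.cast_nonneg p
  have hb : ∀ u : ℝ, u * M ≤ p * (M + m) / 2 → u ≤ p / 2 + ε * p / 4 := by
    intro u hu
    refine le_of_mul_le_mul_right (hu.trans ?_) hMpos
    nlinarith [mul_le_mul_of_nonneg_left hmM hp0]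
  have ha' := hb a hp1
  have hb' := hb b hm1
  rw [abs_le]
  constructor <;> linarith

end Stepanov

section SquareCount
open Polynomial Filter

theorem eventually_intCast_zmod_ne_zero {z : ℤ} (hz : z ≠ 0) :
    ∀ᶠ p : ℕ in atTop, (z : ZMod p) ≠ 0 := by
  filter_upwards [eventually_gt_atTop z.natAbs] with p hp
  rw [Ne, ZMod.intCast_zmod_eq_zero_iff_dvd, Int.natCast_dvd]
  exact Nat.not_dvd_of_pos_of_lt (Int.natAbs_pos.2 hz) hp

theorem eventually_two_mul_sq_ne {ι : Type*} [Finite ι] {a : ι → ℤ} (ha : ∀ i, a i ≠ 0)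
    (hdist : ∀ i j, i ≠ j → a i ≠ a j ∧ a i ≠ -a j) :
    ∀ᶠ p : ℕ in atTop, (2 : ZMod p) ≠ 0 ∧ (∀ i, (a i : ZMod p) ≠ 0) ∧
      ∀ i j, i ≠ j → (a i : ZMod p) ^ 2 ≠ (a j : ZMod p) ^ 2 := by
  refine Eventually.and ?_ (Eventually.and ?_ ?_)
  · simpa using eventually_intCast_zmod_ne_zero (z := 2) two_ne_zero
  · exact eventually_all.2 fun i => eventually_intCast_zmod_ne_zero (ha i)
  · refine eventually_all.2 fun i => eventually_all.2 fun j => ?_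
    by_cases hij : i = j
    · simp [hij]
    have h : a i ^ 2 - a j ^ 2 ≠ 0 := by
      rw [sub_ne_zero, Ne, sq_eq_sq_iff_eq_or_eq_neg]
      exact not_or.2 (hdist i j hij)
    filter_upwards [eventually_intCast_zmod_ne_zero h] with p hp _
    rw [← sub_ne_zero]
    exact_mod_cast hp

theorem eventually_abs_sum_quadraticChar_prod_le {ι : Type*} [Finite ι] {a : ι → ℤ}
    (ha : ∀ i, a i ≠ 0) (hdist : ∀ i j, i ≠ j → a i ≠ a j ∧ a i ≠ -a j)
    {s : Finset ι} (hs : s.Nonempty) {ε : ℝ} (hε : 0 < ε) :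
    ∀ᶠ p : ℕ in atTop, ∀ [Fact p.Prime],
      |∑ x : ZMod p, ((∏ j ∈ s, quadraticChar (ZMod p) (x ^ 2 - 4 * (a j : ZMod p) ^ 2) : ℤ) : ℝ)|
        ≤ ε * p := by
  classical
  obtain ⟨P, hP⟩ := exists_abs_sum_quadraticChar_le (2 * #s) hε
  filter_upwards [eventually_ge_atTop P, eventually_two_mul_sq_ne ha hdist]
    with p hp ⟨h2, ha', hd'⟩ _
  set f : (ZMod p)[X] := ∏ j ∈ s, (X ^ 2 - C (4 * (a j : ZMod p) ^ 2)) with hf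
  have h4 : (4 : ZMod p) ≠ 0 := by
    rw [show (4 : ZMod p) = 2 * 2 by norm_num]
    exact mul_ne_zero h2 h2
  have heval : ∀ x, f.eval x = ∏ j ∈ s, (x ^ 2 - 4 * (a j : ZMod p) ^ 2) := by
    intro x
    simp [hf, eval_prod]
  have hmain := hP p hp f ?_ ?_ ?_
  · simpa only [heval, map_prod] using hmain
  · refine (natDegree_prod_le _ _).trans ?_
    rw [mul_comm, ← smul_eq_mul]
    exact sum_le_card_nsmul _ _ _ fun j _ => by rw [natDegree_X_pow_sub_C]
  · rw [heval, prod_ne_zero_iff]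
    intro j _
    simpa using ⟨h4, ha' j⟩
  · obtain ⟨i, hi⟩ := hs
    refine ⟨2 * (a i : ZMod p), ?_⟩
    set g : (ZMod p)[X] := (X + C (2 * (a i : ZMod p))) *
      ∏ j ∈ s.erase i, (X ^ 2 - C (4 * (a j : ZMod p) ^ 2)) with hg
    have hfg : f = (X - C (2 * (a i : ZMod p))) * g := by
      rw [hf, hg, ← mul_prod_erase s _ hi, ← mul_assoc]
      congr 1
      rw [show (4 : ZMod p) * (a i : ZMod p) ^ 2 = (2 * (a i : ZMod p)) ^ 2 by ring, C_pow]
      ring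
    have hgr : g.eval (2 * (a i : ZMod p)) ≠ 0 := by
      rw [hg, eval_mul, eval_prod]
      refine mul_ne_zero ?_ (prod_ne_zero_iff.2 fun j hj => ?_)
      · simp only [eval_add, eval_X, eval_C]
        rw [← two_mul]
        exact mul_ne_zero h2 (mul_ne_zero h2 (ha' i))
      · simp only [eval_sub, eval_pow, eval_X, eval_C]
        rw [show (2 * (a i : ZMod p)) ^ 2 - 4 * (a j : ZMod p) ^ 2 =
          4 * ((a i : ZMod p) ^ 2 - (a j : ZMod p) ^ 2) by ring]
        exact mul_ne_zero h4 (sub_ne_zero.2 (hd' i j (ne_of_mem_erase hj).symm))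
    have hgne : g ≠ 0 := by rintro h0; simp [h0] at hgr
    rw [hfg, rootMultiplicity_mul (mul_ne_zero (X_sub_C_ne_zero _) hgne),
      rootMultiplicity_X_sub_C_self, rootMultiplicity_eq_zero hgr]
    exact odd_one

/-- The proportion of `x` mod `p` for which all `x² - 4aⱼ²` are nonzero squares tends to `2⁻ʳ`. -/
theorem eventually_abs_card_isSquare_sub_le {r : ℕ} {a : Fin r → ℤ}
    (ha : ∀ i, a i ≠ 0) (hdist : ∀ i j, i ≠ j → a i ≠ a j ∧ a i ≠ -a j)
    {ε : ℝ} (hε : 0 < ε) :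
    ∀ᶠ p : ℕ in atTop, ∀ [Fact p.Prime],
      |(Nat.card {x : ZMod p // ∀ j, x ^ 2 - 4 * (a j : ZMod p) ^ 2 ≠ 0 ∧
        IsSquare (x ^ 2 - 4 * (a j : ZMod p) ^ 2)} : ℝ) - p / 2 ^ r| ≤ ε * p := by
  classical
  have hsub : ∀ᶠ p : ℕ in atTop, ∀ s : Finset (Fin r), s.Nonempty → ∀ [Fact p.Prime],
      |∑ x : ZMod p, ((∏ j ∈ s, quadraticChar (ZMod p) (x ^ 2 - 4 * (a j : ZMod p) ^ 2) : ℤ) : ℝ)|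
        ≤ ε / 2 * p := by
    refine eventually_all.2 fun s => ?_
    by_cases hs : s.Nonempty
    · filter_upwards [eventually_abs_sum_quadraticChar_prod_le ha hdist hs (half_pos hε)]
        with p hp _
      exact hp
    · simp [hs]
  obtain ⟨P, hP⟩ := exists_nat_gt (2 * (2 * r) / ε)
  filter_upwards [hsub, eventually_ge_atTop P, eventually_two_mul_sq_ne ha hdist]
    with p hs hpP ⟨h2, ha', hd'⟩ hprime
  have hpε : 2 * (2 * (r : ℝ)) ≤ ε * p := by
    have h1 : (P : ℝ) ≤ p := by exact_mod_cast hpP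
    have := (div_lt_iff₀ hε).1 (lt_of_lt_of_le hP h1)
    linarith
  set D : Fin r → ZMod p → ZMod p := fun j x => x ^ 2 - 4 * (a j : ZMod p) ^ 2 with hD
  set χ : ZMod p → ℤ := fun x => quadraticChar (ZMod p) x with hχ
  have hexp : ∑ x : ZMod p, ∏ j, (1 + (χ (D j x) : ℝ)) =
      p + ∑ s ∈ (univ : Finset (Fin r)).powerset.erase ∅,
        ∑ x : ZMod p, ((∏ j ∈ s, χ (D j x) : ℤ) : ℝ) := by
    simp_rw [prod_one_add]
    rw [sum_comm, ← add_sum_erase _ _ (empty_mem_powerset _)]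
    simp [ZMod.card]
  have hbound : |∑ s ∈ (univ : Finset (Fin r)).powerset.erase ∅,
        ∑ x : ZMod p, ((∏ j ∈ s, χ (D j x) : ℤ) : ℝ)| ≤ 2 ^ r * (ε / 2 * p) := by
    refine (abs_sum_le_sum_abs _ _).trans ?_
    refine (sum_le_card_nsmul _ _ (ε / 2 * p) fun s hs' =>
      hs s (nonempty_iff_ne_empty.2 (ne_of_mem_erase hs'))).trans ?_
    rw [nsmul_eq_mul]
    refine mul_le_mul_of_nonneg_right ?_ (by positivity)
    have h1 : #((univ : Finset (Fin r)).powerset.erase ∅) ≤ 2 ^ r := by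
      refine (card_erase_le).trans ?_
      simp
    exact_mod_cast h1
  have hval : ∀ y, χ y = -1 ∨ χ y = 0 ∨ χ y = 1 := by
    intro y
    by_cases hy : y = 0
    · simp [hχ, hy]
    · rcases quadraticChar_dichotomy hy with h | h
      · exact Or.inr (Or.inr h)
      · exact Or.inl h
  have hpt : ∀ x : ZMod p, |(if ∀ j, D j x ≠ 0 ∧ IsSquare (D j x) then 1 else 0 : ℝ) -
      (∏ j, (1 + (χ (D j x) : ℝ))) / 2 ^ r| ≤ ∑ j, if D j x = 0 then 1 else 0 := by
    intro x
    by_cases h0 : ∃ j, D j x = 0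
    · obtain ⟨j, hj⟩ := h0
      have h1 : (1 : ℝ) ≤ ∑ j, if D j x = 0 then 1 else 0 := by
        have := single_le_sum (f := fun j => if D j x = 0 then (1 : ℝ) else 0)
          (fun i _ => by positivity) (mem_univ j)
        simpa [hj] using this
      refine le_trans ?_ h1
      have hlo : 0 ≤ ∏ j, (1 + (χ (D j x) : ℝ)) := prod_nonneg fun i _ => by
        rcases hval (D i x) with h | h | h <;> simp [h]
      have hhi : ∏ j, (1 + (χ (D j x) : ℝ)) ≤ 2 ^ r := by
        calc _ ≤ ∏ j : Fin r, (2 : ℝ) := prod_le_prod (fun i _ => by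
                rcases hval (D i x) with h | h | h <;> simp [h]) (fun i _ => by
                rcases hval (D i x) with h | h | h <;> norm_num [h])
          _ = 2 ^ r := by simp
      have hhi' := (div_le_one (by positivity : (0 : ℝ) < 2 ^ r)).2 hhi
      have hlo' : 0 ≤ (∏ j, (1 + (χ (D j x) : ℝ))) / 2 ^ r := by positivity
      have hno : ¬ ∀ j, D j x ≠ 0 ∧ IsSquare (D j x) := fun h => (h j).1 hj
      rw [if_neg hno, abs_le]
      constructor <;> linarith
    · push Not at h0
      have hz : (∑ j, if D j x = 0 then (1 : ℝ) else 0) = 0 := by simp [h0]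
      rw [hz]
      refine le_of_eq (abs_eq_zero.2 (sub_eq_zero.2 ?_))
      split_ifs with h
      · have : ∀ j, χ (D j x) = 1 := fun j =>
          (quadraticChar_one_iff_isSquare (h0 j)).2 (h j).2
        simp [this, one_add_one_eq_two]
      · push Not at h
        obtain ⟨j, hj⟩ := h
        have hj' := hj (h0 j)
        have : χ (D j x) = -1 := quadraticChar_neg_one_iff_not_isSquare.2 hj'
        rw [prod_eq_zero (mem_univ j) (by simp [this]), zero_div]
  have hzero : ∀ j, #{x : ZMod p | D j x = 0} ≤ 2 := by
    intro j
    refine (card_le_card ?_).trans (card_le_two (a := 2 * (a j : ZMod p)) (b := -(2 * (a j : ZMod p))))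
    intro x hx
    have hx' : x ^ 2 - 4 * (a j : ZMod p) ^ 2 = 0 := (mem_filter.1 hx).2
    have : x ^ 2 = (2 * (a j : ZMod p)) ^ 2 := by linear_combination hx'
    simpa using sq_eq_sq_iff_eq_or_eq_neg.1 this
  have hcard : (Nat.card {x : ZMod p // ∀ j, D j x ≠ 0 ∧ IsSquare (D j x)} : ℝ) =
      ∑ x : ZMod p, (if ∀ j, D j x ≠ 0 ∧ IsSquare (D j x) then 1 else 0 : ℝ) := by
    rw [sum_boole, Nat.card_eq_fintype_card, Fintype.card_subtype]
  have hA : |∑ x : ZMod p, (if ∀ j, D j x ≠ 0 ∧ IsSquare (D j x) then 1 else 0 : ℝ) -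
      (∑ x : ZMod p, ∏ j, (1 + (χ (D j x) : ℝ))) / 2 ^ r| ≤ 2 * r := by
    rw [sum_div, ← sum_sub_distrib]
    refine (abs_sum_le_sum_abs _ _).trans ((sum_le_sum fun x _ => hpt x).trans ?_)
    rw [sum_comm]
    simp only [sum_boole]
    calc _ ≤ ∑ j : Fin r, (2 : ℝ) := sum_le_sum fun j _ => by exact_mod_cast hzero j
      _ = 2 * r := by simp [mul_comm]
  rw [hcard]
  rw [hexp, add_div] at hA
  set B := ∑ s ∈ (univ : Finset (Fin r)).powerset.erase ∅,
        ∑ x : ZMod p, ((∏ j ∈ s, χ (D j x) : ℤ) : ℝ)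
  have hB : |B / 2 ^ r| ≤ ε / 2 * p := by
    rw [abs_div, abs_of_pos (by positivity : (0 : ℝ) < 2 ^ r), div_le_iff₀ (by positivity)]
    linarith
  rw [abs_le] at hA hB ⊢
  constructor <;> linarith [hA.1, hA.2, hB.1, hB.2]

end SquareCount

section Elimination
open Polynomial Filter Topology

theorem exists_eval₂_eq_add_mul_of_sq {R : Type*} [CommRing R] (D : R) (Q : R[X]) :
    ∃ A B : R, ∀ {F : Type} [CommRing F] (φ : R →+* F) (s : F), s ^ 2 = φ D →
      Q.eval₂ φ s = φ A + φ B * s := by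
  induction Q using Polynomial.induction_on with
  | C a => exact ⟨a, 0, fun φ s _ => by simp⟩
  | add P Q hP hQ =>
    obtain ⟨A, B, h⟩ := hP
    obtain ⟨A', B', h'⟩ := hQ
    refine ⟨A + A', B + B', fun φ s hs => ?_⟩
    rw [eval₂_add, h φ s hs, h' φ s hs, map_add, map_add]
    ring
  | monomial n a h =>
    obtain ⟨A, B, h⟩ := h
    refine ⟨B * D, A, fun φ s hs => ?_⟩
    rw [pow_succ, ← mul_assoc, eval₂_mul_X, h φ s hs, map_mul, ← hs]
    ring

theorem exists_norm_of_sq {R : Type*} [CommRing R] (D : R) (Q : R[X]) :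
    ∃ N : R, ∀ {F : Type} [CommRing F] (φ : R →+* F) (s : F), s ^ 2 = φ D →
      φ N = Q.eval₂ φ s * Q.eval₂ φ (-s) := by
  obtain ⟨A, B, h⟩ := exists_eval₂_eq_add_mul_of_sq D Q
  refine ⟨A ^ 2 - B ^ 2 * D, fun φ s hs => ?_⟩
  rw [h φ s hs, h φ (-s) (by rw [neg_sq, hs]), map_sub, map_mul, map_pow, map_pow, ← hs]
  ring

theorem eval₂_finSuccEquiv_eq {R F : Type*} [CommRing R] [CommRing F] {n : ℕ}
    (φ : R →+* F) (s : Fin (n + 1) → F) (Q : MvPolynomial (Fin (n + 1)) R) :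
    (MvPolynomial.finSuccEquiv R n Q).eval₂ (MvPolynomial.eval₂Hom φ (Fin.tail s)) (s 0) =
      MvPolynomial.eval₂ φ s Q := by
  induction Q using MvPolynomial.induction_on with
  | C a => simp [MvPolynomial.finSuccEquiv_apply]
  | add P Q hP hQ => rw [map_add, eval₂_add, hP, hQ, MvPolynomial.eval₂_add]
  | mul_X P i hP =>
    rw [map_mul, eval₂_mul, hP, MvPolynomial.eval₂_mul, MvPolynomial.eval₂_X]
    cases i using Fin.cases with
    | zero => rw [MvPolynomial.finSuccEquiv_X_zero, eval₂_X]
    | succ i =>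
      rw [MvPolynomial.finSuccEquiv_X_succ, eval₂_C]
      simp [Fin.tail]

/-- Elimination of square roots: a polynomial `P` vanishing exactly where one of the conjugates of
`Q` does. -/
theorem exists_eliminant (r : ℕ) (D : Fin r → ℤ[X]) (Q : MvPolynomial (Fin r) ℤ[X]) :
    ∃ P : ℤ[X], ∀ {F : Type} [Field F] (t : F) (s : Fin r → F), (∀ j, s j ^ 2 = aeval t (D j)) →
      ((MvPolynomial.eval₂ (aeval t : ℤ[X] →ₐ[ℤ] F).toRingHom s Q = 0 → aeval t P = 0) ∧
      (aeval t P = 0 → ∃ s' : Fin r → F, (∀ j, s' j = s j ∨ s' j = -s j) ∧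
        MvPolynomial.eval₂ (aeval t : ℤ[X] →ₐ[ℤ] F).toRingHom s' Q = 0)) := by
  induction r with
  | zero =>
    obtain ⟨P, rfl⟩ := MvPolynomial.C_surjective (Fin 0) Q
    refine ⟨P, fun t s _ => ⟨fun h => by simpa using h, fun h => ⟨s, fun j => j.elim0, ?_⟩⟩⟩
    simpa using h
  | succ n ih =>
    obtain ⟨N, hN⟩ := exists_norm_of_sq (MvPolynomial.C (D 0)) (MvPolynomial.finSuccEquiv _ n Q)
    obtain ⟨P, hP⟩ := ih (Fin.tail D) N
    refine ⟨P, fun {F} _ t s hs => ?_⟩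
    set φ := (aeval t : ℤ[X] →ₐ[ℤ] F).toRingHom with hφ
    have hkey : ∀ u : Fin n → F, MvPolynomial.eval₂ φ u N =
        MvPolynomial.eval₂ φ (Fin.cons (s 0) u : Fin (n + 1) → F) Q *
          MvPolynomial.eval₂ φ (Fin.cons (-s 0) u : Fin (n + 1) → F) Q := by
      intro u
      have h := hN (MvPolynomial.eval₂Hom φ u) (s 0) (by simpa [hφ] using hs 0)
      rw [← eval₂_finSuccEquiv_eq, ← eval₂_finSuccEquiv_eq]
      simpa using h
    obtain ⟨h1, h2⟩ := hP t (Fin.tail s) fun j => hs j.succ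
    constructor
    · intro h
      apply h1
      rw [hkey, Fin.cons_self_tail, h, zero_mul]
    · intro h
      obtain ⟨u, hu, hu0⟩ := h2 h
      rw [hkey] at hu0
      rcases mul_eq_zero.1 hu0 with h0 | h0
      · exact ⟨_, fun j => Fin.cases (Or.inl rfl) (fun i => hu i) j, h0⟩
      · exact ⟨_, fun j => Fin.cases (Or.inr rfl) (fun i => hu i) j, h0⟩

theorem hasDerivAt_log_add_sqrt {b t : ℝ} (hb : 0 ≤ b) (ht : b < t) :
    HasDerivAt (fun t => Real.log (t + √(t ^ 2 - b ^ 2))) (1 / √(t ^ 2 - b ^ 2)) t := by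
  have hpos : 0 < t ^ 2 - b ^ 2 := by nlinarith
  have hs : 0 < √(t ^ 2 - b ^ 2) := Real.sqrt_pos.2 hpos
  have h1 : HasDerivAt (fun t : ℝ => t ^ 2 - b ^ 2) (2 * t) t := by
    simpa using (hasDerivAt_pow 2 t).sub_const (b ^ 2)
  have h2 : HasDerivAt (fun t => t + √(t ^ 2 - b ^ 2)) (1 + 2 * t / (2 * √(t ^ 2 - b ^ 2))) t :=
    (hasDerivAt_id t).add (h1.sqrt hpos.ne')
  have h3 : t + √(t ^ 2 - b ^ 2) ≠ 0 := by linarith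
  convert h2.log h3 using 1
  field_simp
  ring

/-- Logarithms of conjugate surds with distinct branch points satisfy no linear relation. -/
theorem eventually_sum_log_add_sqrt_ne {ι : Type*} [DecidableEq ι] {s : Finset ι} {b c : ι → ℝ}
    (hb : ∀ j ∈ s, 0 < b j) {i : ι} (hi : i ∈ s) (hmax : ∀ j ∈ s, j ≠ i → b j < b i)
    (hc : c i ≠ 0) (K : ℝ) :
    ∀ᶠ t in 𝓝[>] b i, ∑ j ∈ s, c j * Real.log (t + √(t ^ 2 - b j ^ 2)) ≠ K := by
  have hle : ∀ j ∈ s, b j ≤ b i := fun j hj => by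
    by_cases h : j = i
    · rw [h]
    · exact (hmax j hj h).le
  have hderiv : ∀ t, b i < t → HasDerivAt
      (fun t => ∑ j ∈ s, c j * Real.log (t + √(t ^ 2 - b j ^ 2)))
      (∑ j ∈ s, c j * (1 / √(t ^ 2 - b j ^ 2))) t := fun t ht =>
    HasDerivAt.fun_sum fun j hj =>
      (hasDerivAt_log_add_sqrt (hb j hj).le (lt_of_le_of_lt (hle j hj) ht)).const_mul _
  have hlim : Tendsto (fun t => ∑ j ∈ s, c j * (√(t ^ 2 - b i ^ 2) / √(t ^ 2 - b j ^ 2)))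
      (𝓝[>] b i) (𝓝 (∑ j ∈ s, if j = i then c i else 0)) := by
    refine tendsto_finsetSum _ fun j hj => ?_
    split_ifs with h
    · subst h
      refine tendsto_const_nhds.congr' ?_
      filter_upwards [self_mem_nhdsWithin] with t ht
      have h1 : 0 < √(t ^ 2 - b j ^ 2) := Real.sqrt_pos.2 (by
        have := hb j hj
        have : b j < t := ht
        nlinarith)
      rw [div_self h1.ne', mul_one]
    · have h0 : 0 < b i ^ 2 - b j ^ 2 := by
        have := hb j hj
        have := hmax j hj h
        nlinarith
      have hcont : ContinuousAt (fun t => c j * (√(t ^ 2 - b i ^ 2) / √(t ^ 2 - b j ^ 2))) (b i) := by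
        refine ContinuousAt.mul continuousAt_const (ContinuousAt.div ?_ ?_ ?_)
        · fun_prop
        · fun_prop
        · exact (Real.sqrt_pos.2 h0).ne'
      have := hcont.tendsto.mono_left (nhdsWithin_le_nhds (s := Set.Ioi (b i)))
      simpa using this
  rw [sum_ite_eq' s i, if_pos hi] at hlim
  have hne := hlim.eventually_ne hc
  have hne' : ∀ᶠ t in 𝓝[>] b i, ∑ j ∈ s, c j * (1 / √(t ^ 2 - b j ^ 2)) ≠ 0 := by
    filter_upwards [hne] with t ht h0
    apply ht
    calc _ = √(t ^ 2 - b i ^ 2) * ∑ j ∈ s, c j * (1 / √(t ^ 2 - b j ^ 2)) := by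
          rw [mul_sum]
          exact sum_congr rfl fun j _ => by ring
      _ = 0 := by rw [h0, mul_zero]
  obtain ⟨u, hu, hsub⟩ := (mem_nhdsGT_iff_exists_Ioo_subset).1 hne'
  have hu' : b i < u := hu
  by_cases hex : ∃ t₁ ∈ Set.Ioo (b i) u, ∑ j ∈ s, c j * Real.log (t₁ + √(t₁ ^ 2 - b j ^ 2)) = K
  · obtain ⟨t₁, ht₁, h₁⟩ := hex
    filter_upwards [Ioo_mem_nhdsGT ht₁.1] with t ht hK
    obtain ⟨z, hz, hz0⟩ := exists_hasDerivAt_eq_zero ht.2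
      (fun x hx => (hderiv x (lt_of_lt_of_le ht.1 hx.1)).continuousAt.continuousWithinAt)
      (hK.trans h₁.symm) (fun x hx => hderiv x (ht.1.trans hx.1))
    exact hsub ⟨ht.1.trans hz.1, hz.2.trans ht₁.2⟩ hz0
  · filter_upwards [Ioo_mem_nhdsGT hu'] with t ht hK
    exact hex ⟨t, ht, hK⟩

theorem log_abs_neg_add_of_sq_eq {b t s : ℝ} (hb : 0 < b) (ht : b < t)
    (hs : s = √(t ^ 2 - b ^ 2) ∨ s = -√(t ^ 2 - b ^ 2)) :
    Real.log |-t + s| - Real.log b =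
      (if s = √(t ^ 2 - b ^ 2) then -1 else 1) *
        (Real.log (t + √(t ^ 2 - b ^ 2)) - Real.log b) := by
  set w := √(t ^ 2 - b ^ 2) with hw
  have hpos : 0 < t ^ 2 - b ^ 2 := by nlinarith
  have hw0 : 0 < w := Real.sqrt_pos.2 hpos
  have hww : w * w = t ^ 2 - b ^ 2 := Real.mul_self_sqrt hpos.le
  have hwt : w < t := by nlinarith
  rcases hs with rfl | rfl
  · have h1 : |-t + w| = b ^ 2 / (t + w) := by
      rw [abs_of_neg (by linarith), eq_div_iff (by linarith)]
      linarith
    rw [if_pos rfl, h1, Real.log_div (by positivity) (by linarith), Real.log_pow]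
    push_cast
    ring
  · have h1 : |-t + -w| = t + w := by rw [abs_of_neg (by linarith)]; ring
    rw [if_neg (by linarith), h1, one_mul]

/-- The roots `uⱼ` of `aⱼ(u² + 1) + tu` are multiplicatively independent, outside the zeros of a
nonzero integral polynomial in `t`. -/
theorem exists_relation_polynomial {r : ℕ} {a : Fin r → ℤ} (ha : ∀ i, a i ≠ 0)
    (hdist : ∀ i j, i ≠ j → a i ≠ a j ∧ a i ≠ -a j) {n : Fin r → ℕ} (hn : n ≠ 0) :
    ∃ P : ℤ[X], P ≠ 0 ∧ ∀ {F : Type} [Field F] (t : F) (s : Fin r → F),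
      (∀ j, s j ^ 2 = t ^ 2 - 4 * (a j : F) ^ 2) →
      ∏ j, (-t + s j) ^ n j = ∏ j, (2 * (a j : F)) ^ n j → aeval t P = 0 := by
  classical
  set D : Fin r → ℤ[X] := fun j => if n j = 0 then 0 else X ^ 2 - C (4 * a j ^ 2) with hD
  set Q : MvPolynomial (Fin r) ℤ[X] :=
    ∏ j, (MvPolynomial.C (-X) + MvPolynomial.X j) ^ n j - MvPolynomial.C (∏ j, C (2 * a j) ^ n j)
    with hQ
  have hDeval : ∀ {F : Type} [Field F] (t : F) (j : Fin r), n j ≠ 0 →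
      aeval t (D j) = t ^ 2 - 4 * (a j : F) ^ 2 := by
    intro F _ t j h
    simp only [hD, if_neg h, map_sub, map_pow, aeval_X, aeval_C]
    simp
  have hQeval : ∀ {F : Type} [Field F] (t : F) (s : Fin r → F),
      MvPolynomial.eval₂ (aeval t : ℤ[X] →ₐ[ℤ] F).toRingHom s Q =
        ∏ j, (-t + s j) ^ n j - ∏ j, (2 * (a j : F)) ^ n j := by
    intro F _ t s
    have h : ∀ f, (aeval t : ℤ[X] →ₐ[ℤ] F).toRingHom f = aeval t f := fun _ => rfl
    rw [← MvPolynomial.coe_eval₂Hom, hQ]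
    simp only [map_sub, map_prod, map_pow, map_add, MvPolynomial.coe_eval₂Hom,
      MvPolynomial.eval₂_C, MvPolynomial.eval₂_X, h, map_neg, aeval_X, aeval_C]
    simp
  obtain ⟨P, hP⟩ := exists_eliminant r D Q
  refine ⟨P, ?_, fun {F} _ t s hs heq => ?_⟩
  swap
  · refine (hP t (fun j => if n j = 0 then 0 else s j) fun j => ?_).1 ?_
    · by_cases h : n j = 0
      · simp [hD, h]
      · simp [hDeval t j h, h, hs]
    · rw [hQeval, sub_eq_zero, ← heq]
      refine prod_congr rfl fun j _ => ?_
      by_cases h : n j = 0 <;> simp [h]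
  rintro rfl
  set S : Finset (Fin r) := univ.filter fun j => n j ≠ 0 with hS
  have hSne : S.Nonempty := by
    obtain ⟨j, hj⟩ := Function.ne_iff.1 hn
    exact ⟨j, by simpa [hS] using hj⟩
  set b : Fin r → ℝ := fun j => |2 * (a j : ℝ)| with hb
  have hbpos : ∀ j, 0 < b j := fun j => abs_pos.2 (mul_ne_zero two_ne_zero (by exact_mod_cast ha j))
  have hbsq : ∀ j, b j ^ 2 = 4 * (a j : ℝ) ^ 2 := fun j => by
    simp only [hb, sq_abs]; ring
  obtain ⟨i, hi, himax⟩ := S.exists_max_image b hSne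
  have hmax : ∀ j ∈ S, j ≠ i → b j < b i := by
    intro j hj hji
    refine lt_of_le_of_ne (himax j hj) fun h => ?_
    rw [hb] at h
    simp only [abs_mul, mul_eq_mul_left_iff] at h
    rcases h with h | h
    · rcases abs_eq_abs.1 h with h | h
      · exact (hdist j i hji).1 (by exact_mod_cast h)
      · exact (hdist j i hji).2 (by exact_mod_cast h)
    · simp at h
  have hev : ∀ᶠ t in 𝓝[>] b i, ∀ ε : Fin r → Bool,
      ∑ j ∈ S, (n j * (if ε j then -1 else 1 : ℝ)) * Real.log (t + √(t ^ 2 - b j ^ 2)) ≠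
        ∑ j ∈ S, (n j * (if ε j then -1 else 1 : ℝ)) * Real.log (b j) := by
    refine eventually_all.2 fun ε => ?_
    refine eventually_sum_log_add_sqrt_ne (c := fun j => n j * (if ε j then -1 else 1 : ℝ))
      (fun j _ => hbpos j) hi hmax ?_ _
    have : n i ≠ 0 := (mem_filter.1 hi).2
    refine mul_ne_zero (by exact_mod_cast this) ?_
    split_ifs <;> norm_num
  obtain ⟨t, ht, hit⟩ := (hev.and self_mem_nhdsWithin).exists
  have hit' : b i < t := hit
  have hbt : ∀ j ∈ S, b j < t := fun j hj => lt_of_le_of_lt (himax j hj) hit'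
  obtain ⟨s', hs', h0⟩ := (hP t (fun j => if n j = 0 then 0 else √(t ^ 2 - b j ^ 2)) fun j => by
    by_cases h : n j = 0
    · simp [hD, h]
    · have hjS : j ∈ S := by simp [hS, h]
      have := hbt j hjS
      have := hbpos j
      have h1 : 0 ≤ t ^ 2 - b j ^ 2 := by nlinarith
      rw [if_neg h, hDeval t j h, Real.sq_sqrt h1, hbsq]).2 (by simp)
  rw [hQeval, sub_eq_zero] at h0
  have hlogeq : ∑ j ∈ S, (n j : ℝ) * (Real.log |-t + s' j| - Real.log (b j)) = 0 := by
    have h1 : ∏ j ∈ S, |-t + s' j| ^ n j = ∏ j ∈ S, b j ^ n j := by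
      have h2 : ∀ f : Fin r → ℝ, ∏ j ∈ S, f j ^ n j = ∏ j, f j ^ n j := fun f =>
        prod_subset (subset_univ _) fun j _ hj => by
          have : n j = 0 := by simpa [hS] using hj
          rw [this, pow_zero]
      rw [h2, h2]
      simp only [hb, ← abs_pow, ← abs_prod]
      rw [h0]
    have hbn : ∀ j ∈ S, b j ^ n j ≠ 0 := fun j _ => pow_ne_zero _ (hbpos j).ne'
    have hsn : ∀ j ∈ S, |-t + s' j| ^ n j ≠ 0 := by
      rw [← prod_ne_zero_iff, h1]
      exact prod_ne_zero_iff.2 hbn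
    have h3 := congrArg Real.log h1
    rw [Real.log_prod hsn, Real.log_prod hbn] at h3
    simp only [Real.log_pow] at h3
    simp only [mul_sub, sum_sub_distrib, h3, sub_self]
  refine ht (fun j => decide (s' j = √(t ^ 2 - b j ^ 2))) ?_
  rw [← sub_eq_zero, ← sum_sub_distrib, ← hlogeq]
  refine sum_congr rfl fun j hj => ?_
  have hnj : n j ≠ 0 := (mem_filter.1 hj).2
  rw [log_abs_neg_add_of_sq_eq (hbpos j) (hbt j hj) (by simpa [hnj] using hs' j)]
  simp only [decide_eq_true_eq]
  ring

end Elimination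

section TwistedSum

variable {R : Type*} [CommRing R]

/-- The summand of the twisted Kloosterman sum `K(a, -a, χ)` with respect to `ψ`. -/
noncomputable def kloosSummand (ψ : AddChar R ℂ) (χ : MulChar R ℂ) (a : R) (x : Rˣ) : ℂ :=
  ψ (a * x - a * ↑x⁻¹) * χ x

/-- The homomorphism `z ↦ 1 + vz + v²z²/2`, for `v³ = 0`. -/
def truncExp (v e : R) (hv : v ^ 3 = 0) (he : 2 * e = 1) : Multiplicative R →* Rˣ :=
  MonoidHom.toHomUnits
    { toFun := fun z => 1 + v * z.toAdd + v ^ 2 * (z.toAdd ^ 2 * e)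
      map_one' := by simp
      map_mul' := fun x y => by
        simp only [toAdd_mul]
        linear_combination (v ^ 2 * x.toAdd * y.toAdd) * he -
          (x.toAdd ^ 2 * y.toAdd * e + x.toAdd * y.toAdd ^ 2 * e + v * x.toAdd ^ 2 * y.toAdd ^ 2 * e ^ 2) * hv }

variable {v e : R} {hv : v ^ 3 = 0} {he : 2 * e = 1}

theorem val_truncExp (z : R) :
    (truncExp v e hv he (.ofAdd z) : R) = 1 + v * z + v ^ 2 * (z ^ 2 * e) := rfl

theorem val_inv_truncExp (z : R) :
    (↑(truncExp v e hv he (.ofAdd z))⁻¹ : R) = 1 - v * z + v ^ 2 * (z ^ 2 * e) := by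
  rw [← map_inv, ← ofAdd_neg, val_truncExp]
  ring

theorem exists_truncExp_eq (x : Rˣ) :
    (∃ z, truncExp v e hv he z = x) ↔ ∃ y, (x : R) = 1 + v * y := by
  constructor
  · rintro ⟨z, rfl⟩
    exact ⟨z.toAdd + v * (z.toAdd ^ 2 * e), by
      rw [← ofAdd_toAdd z, val_truncExp, toAdd_ofAdd]; ring⟩
  · rintro ⟨y, hy⟩
    refine ⟨.ofAdd (y - v * y ^ 2 * e), Units.ext ?_⟩
    rw [val_truncExp, hy]
    linear_combination (-2 * y ^ 3 * e ^ 2 + v * y ^ 4 * e ^ 3) * hv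

theorem kloosSummand_mul_truncExp (ψ : AddChar R ℂ) (χ : MulChar R ℂ) (a t : R)
    (hχ : ∀ z, χ (1 + v * z + v ^ 2 * (z ^ 2 * e)) = ψ (v * t * z)) (x : Rˣ) (z : R) :
    kloosSummand ψ χ a (x * truncExp v e hv he (.ofAdd z)) = kloosSummand ψ χ a x *
      ψ (v * z * (a * x + a * ↑x⁻¹ + t) + v ^ 2 * (z ^ 2 * e) * (a * x - a * ↑x⁻¹)) := by
  rw [kloosSummand, kloosSummand, mul_inv, Units.val_mul, Units.val_mul, map_mul,
    val_inv_truncExp, val_truncExp, hχ, mul_left_comm, ← AddChar.map_add_eq_mul, mul_right_comm (ψ _),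
    ← AddChar.map_add_eq_mul, mul_comm (χ x)]
  congr 2
  ring

variable [Fintype R]

theorem MulChar.norm_apply_units (χ : MulChar R ℂ) (x : Rˣ) : ‖χ x‖ = 1 := by
  have h : χ x * star (χ x) = 1 := by
    rw [MulChar.star_apply', MulChar.inv_apply, Ring.inverse_unit, ← map_mul, x.mul_inv, map_one]
  have h2 : (Complex.normSq (χ x) : ℂ) = 1 := by rw [← Complex.mul_conj]; exact h
  have h3 : Complex.normSq (χ x) = 1 := by exact_mod_cast h2
  rw [Complex.normSq_eq_norm_sq] at h3
  exact (pow_eq_one_iff_of_nonneg (norm_nonneg _) two_ne_zero).1 h3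

theorem kloosSummand_inv (ψ : AddChar R ℂ) (χ : MulChar R ℂ) (a : R) (x : Rˣ) :
    kloosSummand ψ χ a x⁻¹ = (starRingEnd ℂ) (kloosSummand ψ χ a x) := by
  have h : (starRingEnd ℂ) (χ x) = χ ↑x⁻¹ := by
    rw [starRingEnd_apply, MulChar.star_apply', MulChar.inv_apply, Ring.inverse_unit]
  rw [kloosSummand, kloosSummand, map_mul, h, ← AddChar.map_neg_eq_conj]
  congr 2
  simp

variable [DecidableEq R]

theorem sum_kloosSummand_eq_sum_critical {ψ : AddChar R ℂ} (hψ : ψ.IsPrimitive)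
    (χ : MulChar R ℂ) (a t : R) {w : R} (hw : w ^ 2 = 0) (he : 2 * e = 1)
    (hχ : ∀ z, χ (1 + w * z) = ψ (w * t * z)) :
    ∑ x : Rˣ, kloosSummand ψ χ a x =
      ∑ x ∈ univ.filter fun x : Rˣ => w * (a * x + a * ↑x⁻¹ + t) = 0, kloosSummand ψ χ a x := by
  have hw3 : w ^ 3 = 0 := by rw [pow_succ, hw, zero_mul]
  have h1 : ∀ z : R, ∑ x : Rˣ, kloosSummand ψ χ a x =
      ∑ x : Rˣ, kloosSummand ψ χ a x * ψ (z * (w * (a * x + a * ↑x⁻¹ + t))) := by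
    intro z
    rw [← Equiv.sum_comp (Equiv.mulRight (truncExp w e hw3 he (.ofAdd z)))]
    refine sum_congr rfl fun x _ => ?_
    rw [Equiv.coe_mulRight, kloosSummand_mul_truncExp ψ χ a t (by simpa [hw] using hχ), hw]
    congr 2
    ring
  have hR : (Fintype.card R : ℂ) ≠ 0 := by exact_mod_cast Fintype.card_ne_zero
  refine mul_left_cancel₀ hR ?_
  calc (Fintype.card R : ℂ) * ∑ x : Rˣ, kloosSummand ψ χ a x
      = ∑ z : R, ∑ x : Rˣ, kloosSummand ψ χ a x := by simp
    _ = ∑ z : R, ∑ x : Rˣ, kloosSummand ψ χ a x * ψ (z * (w * (a * x + a * ↑x⁻¹ + t))) :=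
        sum_congr rfl fun z _ => h1 z
    _ = _ := by
      rw [sum_comm, mul_sum, sum_filter]
      refine sum_congr rfl fun x _ => ?_
      rw [← mul_sum, AddChar.sum_mulShift _ hψ]
      split_ifs
      · rw [mul_comm]
      · simp

theorem card_truncExp_eq (x : Rˣ) (hx : ∃ y, (x : R) = 1 + v * y) :
    #{z | truncExp v e hv he z = x} = #{z : R | v * z = 0} := by
  rw [MonoidHom.card_fiber_eq_of_mem_range (truncExp v e hv he) ((exists_truncExp_eq x).2 hx)
    ⟨1, map_one _⟩]
  refine card_equiv Multiplicative.toAdd fun z => ?_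
  simp only [mem_filter, mem_univ, true_and]
  rw [Units.ext_iff, ← ofAdd_toAdd z, val_truncExp, toAdd_ofAdd, Units.val_one]
  constructor
  · intro h
    linear_combination (1 - v * z.toAdd * e) * h + z.toAdd ^ 3 * e ^ 2 * hv
  · intro h
    linear_combination (1 + v * z.toAdd * e) * h

theorem norm_sq_gaussSum_eq {ψ : AddChar R ℂ} (hψ : ψ.IsPrimitive) (he : 2 * e = 1) (v : R)
    {α : R} (hα : IsUnit α) :
    ‖∑ z : R, ψ (v ^ 2 * (z ^ 2 * e) * α)‖ ^ 2 = Fintype.card R * #{y : R | v ^ 2 * y = 0} := by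
  have key : (∑ z : R, ψ (v ^ 2 * (z ^ 2 * e) * α)) *
      (starRingEnd ℂ) (∑ z : R, ψ (v ^ 2 * (z ^ 2 * e) * α)) =
        Fintype.card R * #{y : R | v ^ 2 * y = 0} := by
    calc _ = ∑ z : R, ∑ y : R,
          ψ (v ^ 2 * ((z + y) ^ 2 * e) * α) * ψ (-(v ^ 2 * (z ^ 2 * e) * α)) := by
          rw [map_sum, mul_comm, sum_mul]
          refine sum_congr rfl fun z _ => ?_
          rw [mul_sum, ← Equiv.sum_comp (Equiv.addLeft z)]
          refine sum_congr rfl fun y _ => ?_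
          rw [AddChar.map_neg_eq_conj, mul_comm]
          rfl
      _ = ∑ y : R, ψ (v ^ 2 * (y ^ 2 * e) * α) * ∑ z : R, ψ (z * (v ^ 2 * α * y)) := by
          rw [sum_comm]
          refine sum_congr rfl fun y _ => ?_
          rw [mul_sum]
          refine sum_congr rfl fun z _ => ?_
          rw [← AddChar.map_add_eq_mul, ← AddChar.map_add_eq_mul]
          congr 1
          linear_combination (v ^ 2 * α * z * y) * he
      _ = ∑ y : R, if v ^ 2 * y = 0 then (Fintype.card R : ℂ) else 0 := by
          refine sum_congr rfl fun y _ => ?_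
          have hiff : v ^ 2 * α * y = 0 ↔ v ^ 2 * y = 0 := by
            rw [mul_right_comm, hα.mul_left_eq_zero]
          rw [AddChar.sum_mulShift _ hψ]
          simp only [hiff]
          split_ifs with h
          · have h0 : v ^ 2 * (y ^ 2 * e) * α = 0 := by linear_combination (y * e * α) * h
            rw [h0, AddChar.map_zero_eq_one, one_mul]
          · simp
      _ = _ := by
          rw [← sum_filter, sum_const, nsmul_eq_mul, mul_comm]
  rw [Complex.mul_conj, Complex.normSq_eq_norm_sq] at key
  exact_mod_cast key

/-- The contribution to the twisted Kloosterman sum of a neighbourhood of a critical point. -/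
theorem sum_kloosSummand_near_critical (ψ : AddChar R ℂ) (χ : MulChar R ℂ) (a t : R)
    (hv : v ^ 3 = 0) (he : 2 * e = 1)
    (hχ : ∀ z, χ (1 + v * z + v ^ 2 * (z ^ 2 * e)) = ψ (v * t * z)) {x₀ : Rˣ}
    (hx₀ : a * x₀ + a * ↑x₀⁻¹ + t = 0) [DecidablePred fun x : Rˣ => ∃ y, (x : R) = x₀ + v * y] :
    #{z : R | v * z = 0} * ∑ x ∈ univ.filter fun x : Rˣ => ∃ y, (x : R) = x₀ + v * y, kloosSummand ψ χ a x =
      kloosSummand ψ χ a x₀ * ∑ z : R, ψ (v ^ 2 * (z ^ 2 * e) * (a * x₀ - a * ↑x₀⁻¹)) := by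
  have h1 : kloosSummand ψ χ a x₀ * ∑ z : R, ψ (v ^ 2 * (z ^ 2 * e) * (a * x₀ - a * ↑x₀⁻¹)) =
      ∑ z : Multiplicative R, kloosSummand ψ χ a (x₀ * truncExp v e hv he z) := by
    rw [← Equiv.sum_comp Multiplicative.ofAdd, mul_sum]
    refine sum_congr rfl fun z _ => ?_
    rw [kloosSummand_mul_truncExp ψ χ a t hχ, hx₀, mul_zero, zero_add]
  rw [h1, ← sum_fiberwise_of_maps_to (s := univ) (t := ({x | ∃ y, (x : R) = x₀ + v * y} : Finset Rˣ))
    (g := fun z => x₀ * truncExp v e hv he z), mul_sum]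
  · refine sum_congr rfl fun x hx => ?_
    rw [sum_congr rfl fun z hz => by rw [(mem_filter.1 hz).2], sum_const, nsmul_eq_mul]
    congr 2
    obtain ⟨y, hy⟩ := (mem_filter.1 hx).2
    rw [← card_truncExp_eq (hv := hv) (he := he) (x₀⁻¹ * x)
      ⟨↑x₀⁻¹ * y, by rw [Units.val_mul, hy, mul_add, x₀.inv_mul]; ring⟩]
    congr 1
    ext z
    simp [eq_inv_mul_iff_mul_eq]
  · intro z _
    obtain ⟨y, hy⟩ := (exists_truncExp_eq (hv := hv) (he := he) _).1 ⟨z, rfl⟩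
    simp only [mem_filter, mem_univ, true_and]
    exact ⟨x₀ * y, by rw [Units.val_mul, hy]; ring⟩

end TwistedSum

section PrimePower

theorem natCast_pow_self_zmod (p k : ℕ) : (p : ZMod (p ^ k)) ^ k = 0 := by
  rw [← Nat.cast_pow, ZMod.natCast_self]

theorem natCast_pow_zmod_of_le {p k i : ℕ} (h : k ≤ i) : (p : ZMod (p ^ k)) ^ i = 0 :=
  pow_eq_zero_of_le h (natCast_pow_self_zmod p k)

variable {p k : ℕ} [Fact p.Prime]

theorem two_ne_zero_zmod (hp2 : p ≠ 2) : (2 : ZMod p) ≠ 0 := by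
  have h : ¬ p ∣ 2 := fun h => hp2 ((Nat.prime_dvd_prime_iff_eq Fact.out Nat.prime_two).1 h)
  rw [← ZMod.natCast_eq_zero_iff] at h
  exact_mod_cast h

/-- Reduction modulo `p`. -/
def redMod (p k : ℕ) (hk : k ≠ 0) : ZMod (p ^ k) →+* ZMod p :=
  ZMod.castHom (dvd_pow_self p hk) (ZMod p)

theorem isUnit_iff_redMod_ne_zero (hk : k ≠ 0) (x : ZMod (p ^ k)) :
    IsUnit x ↔ redMod p k hk x ≠ 0 := by
  have hp : p.Prime := Fact.out
  rw [← ZMod.natCast_zmod_val x, ZMod.isUnit_iff_coprime, map_natCast, Ne,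
    ZMod.natCast_eq_zero_iff, Nat.coprime_pow_right_iff (Nat.pos_of_ne_zero hk), Nat.coprime_comm,
    hp.coprime_iff_not_dvd]

theorem natCast_pow_mul_eq_zero_iff {i j : ℕ} (h : i + j = k) (y : ZMod (p ^ k)) :
    (p : ZMod (p ^ k)) ^ i * y = 0 ↔ ∃ y', y = (p : ZMod (p ^ k)) ^ j * y' := by
  constructor
  · intro h0
    rw [← ZMod.natCast_zmod_val y, ← Nat.cast_pow, ← Nat.cast_mul, ZMod.natCast_eq_zero_iff] at h0
    obtain ⟨c, hc⟩ := Nat.dvd_of_mul_dvd_mul_left (pow_pos (Fact.out : p.Prime).pos i)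
      (show p ^ i * p ^ j ∣ p ^ i * y.val by rwa [← pow_add, h])
    refine ⟨c, ?_⟩
    rw [← ZMod.natCast_zmod_val y, hc]
    push_cast
    rfl
  · rintro ⟨y', rfl⟩
    rw [← mul_assoc, ← pow_add, h, natCast_pow_self_zmod, zero_mul]

theorem card_natCast_pow_mul_eq_zero {i : ℕ} (h : i ≤ k) :
    #{y : ZMod (p ^ k) | (p : ZMod (p ^ k)) ^ i * y = 0} = p ^ i := by
  have h1 := IsAddCyclic.card_nsmulAddMonoidHom_ker (ZMod (p ^ k)) (p ^ i)
  rw [Nat.card_zmod, Nat.gcd_eq_right (pow_dvd_pow p h)] at h1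
  rw [← h1, Nat.card_eq_fintype_card, ← Fintype.card_subtype]
  refine Fintype.card_congr (Equiv.subtypeEquivRight fun y => ?_)
  simp [AddMonoidHom.mem_ker]

theorem eZMod_eq_stdAddChar (q : ℕ) [NeZero q] (x : ZMod q) : eZMod q x = ZMod.stdAddChar x := by
  have h := ZMod.stdAddChar_coe (N := q) (x.val : ℤ)
  rw [Int.cast_natCast, ZMod.natCast_zmod_val, Int.cast_natCast] at h
  rw [h, eZMod]

theorem Kloos_eq_sum_kloosSummand (q : ℕ) [NeZero q] (a : ZMod q) (χ : MulChar (ZMod q) ℂ) :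
    Kloos q a (-a) χ = ∑ x : (ZMod q)ˣ, kloosSummand ZMod.stdAddChar χ a x := by
  symm
  refine sum_bij (fun x _ => (x : ZMod q).val) (fun x _ => ?_) (fun x _ y _ h => ?_)
    (fun n hn => ?_) (fun x _ => ?_)
  · exact mem_filter.2 ⟨mem_range.2 (ZMod.val_lt _), ZMod.val_coe_unit_coprime x⟩
  · exact Units.ext (ZMod.val_injective q h)
  · obtain ⟨h1, h2⟩ := mem_filter.1 hn
    refine ⟨ZMod.unitOfCoprime n h2, mem_univ _, ?_⟩
    rw [ZMod.coe_unitOfCoprime, ZMod.val_cast_of_lt (mem_range.1 h1)]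
  · rw [kloosSummand, ZMod.natCast_zmod_val, eZMod_eq_stdAddChar, ZMod.inv_coe_unit]
    congr 2
    ring

theorem exists_sq_eq_of_isSquare_redMod (hp2 : p ≠ 2) (hk : k ≠ 0) {D : ZMod (p ^ k)}
    {s₀ : ZMod p} (hs₀ : s₀ ^ 2 = redMod p k hk D) (hne : s₀ ≠ 0) :
    ∃ s, s ^ 2 = D ∧ redMod p k hk s = s₀ := by
  have h2 := two_ne_zero_zmod hp2
  have key : ∀ n : ℕ, ∃ s y, redMod p k hk s = s₀ ∧ s ^ 2 - D = (p : ZMod (p ^ k)) ^ (n + 1) * y := by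
    intro n
    induction n with
    | zero =>
      refine ⟨(s₀.val : ZMod (p ^ k)), ?_⟩
      have hred : redMod p k hk (s₀.val : ZMod (p ^ k)) = s₀ := by
        rw [map_natCast, ZMod.natCast_zmod_val]
      have h1 : redMod p k hk ((s₀.val : ZMod (p ^ k)) ^ 2 - D) = 0 := by
        rw [map_sub, map_pow, hred, hs₀, sub_self]
      rw [← ZMod.natCast_zmod_val ((s₀.val : ZMod (p ^ k)) ^ 2 - D), map_natCast,
        ZMod.natCast_eq_zero_iff] at h1
      obtain ⟨c, hc⟩ := h1
      refine ⟨c, hred, ?_⟩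
      rw [← ZMod.natCast_zmod_val ((s₀.val : ZMod (p ^ k)) ^ 2 - D), hc]
      push_cast
      ring
    | succ n ih =>
      obtain ⟨s, y, hs, hy⟩ := ih
      have hu : IsUnit (2 * s) := by
        rw [isUnit_iff_redMod_ne_zero hk, map_mul, hs, map_ofNat]
        exact mul_ne_zero h2 hne
      obtain ⟨w, hw⟩ := hu.exists_right_inv
      refine ⟨s - (s ^ 2 - D) * w, (p : ZMod (p ^ k)) ^ n * (y * w) ^ 2, ?_, ?_⟩
      · rw [hy, map_sub, hs]
        simp
      · have : (s - (s ^ 2 - D) * w) ^ 2 - D = ((s ^ 2 - D) * w) ^ 2 := by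
          linear_combination (-(s ^ 2 - D)) * hw
        rw [this, hy]
        ring
  obtain ⟨s, y, hs, hy⟩ := key k
  refine ⟨s, ?_, hs⟩
  rwa [natCast_pow_zmod_of_le (Nat.le_succ k), zero_mul, sub_eq_zero] at hy

/-- The character `χ` modulo `p ^ k` has parameter `t`. -/
def HasParam (p k : ℕ) [Fact p.Prime] (χ : MulChar (ZMod (p ^ k)) ℂ) (t : ZMod (p ^ k)) : Prop :=
  ∀ z, χ (1 + (p : ZMod (p ^ k)) ^ (k / 2) * z +
    ((p : ZMod (p ^ k)) ^ (k / 2)) ^ 2 * (z ^ 2 * (2 : ZMod (p ^ k))⁻¹)) =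
      ZMod.stdAddChar ((p : ZMod (p ^ k)) ^ (k / 2) * t * z)

theorem two_mul_inv_two_zmod_pow (hp2 : p ≠ 2) : 2 * (2 : ZMod (p ^ k))⁻¹ = 1 := by
  have h : Nat.Coprime 2 (p ^ k) :=
    Nat.Coprime.pow_right k ((Nat.coprime_primes Nat.prime_two Fact.out).2 hp2.symm)
  exact_mod_cast ZMod.coe_mul_inv_eq_one 2 h

theorem HasParam.apply_one_add {χ : MulChar (ZMod (p ^ k)) ℂ} {t : ZMod (p ^ k)}
    (h : HasParam p k χ t) {i : ℕ} (hi : k / 2 ≤ i) (hi2 : k ≤ 2 * i) (z : ZMod (p ^ k)) :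
    χ (1 + (p : ZMod (p ^ k)) ^ i * z) = ZMod.stdAddChar ((p : ZMod (p ^ k)) ^ i * t * z) := by
  have h1 := h ((p : ZMod (p ^ k)) ^ (i - k / 2) * z)
  have h2 : (p : ZMod (p ^ k)) ^ (k / 2) * (p : ZMod (p ^ k)) ^ (i - k / 2) =
      (p : ZMod (p ^ k)) ^ i := by rw [← pow_add, Nat.add_sub_cancel' hi]
  have h3 : ((p : ZMod (p ^ k)) ^ i) ^ 2 = 0 := by
    rw [← pow_mul, mul_comm]; exact natCast_pow_zmod_of_le hi2
  have e1 : 1 + (p : ZMod (p ^ k)) ^ (k / 2) * ((p : ZMod (p ^ k)) ^ (i - k / 2) * z) +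
      ((p : ZMod (p ^ k)) ^ (k / 2)) ^ 2 *
        (((p : ZMod (p ^ k)) ^ (i - k / 2) * z) ^ 2 * (2 : ZMod (p ^ k))⁻¹) =
      1 + (p : ZMod (p ^ k)) ^ i * z := by
    rw [← h2] at h3 ⊢
    linear_combination (z ^ 2 * (2 : ZMod (p ^ k))⁻¹) * h3
  have e2 : (p : ZMod (p ^ k)) ^ (k / 2) * t * ((p : ZMod (p ^ k)) ^ (i - k / 2) * z) =
      (p : ZMod (p ^ k)) ^ i * t * z := by
    rw [← h2]; ring
  rwa [e1, e2] at h1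

theorem Kloos_eq_sum_critical (hp2 : p ≠ 2) {χ : MulChar (ZMod (p ^ k)) ℂ}
    {t : ZMod (p ^ k)} (h : HasParam p k χ t) (a : ZMod (p ^ k)) :
    Kloos (p ^ k) a (-a) χ =
      ∑ x ∈ univ.filter fun x : (ZMod (p ^ k))ˣ =>
        ∃ y, a * x + a * ↑x⁻¹ + t = (p : ZMod (p ^ k)) ^ (k / 2) * y,
          kloosSummand ZMod.stdAddChar χ a x := by
  classical
  rw [Kloos_eq_sum_kloosSummand, sum_kloosSummand_eq_sum_critical
    (ZMod.isPrimitive_stdAddChar _) χ a t (w := (p : ZMod (p ^ k)) ^ (k - k / 2)) ?_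
    (two_mul_inv_two_zmod_pow hp2) (h.apply_one_add (by omega) (by omega))]
  · refine sum_congr (filter_congr fun x _ => ?_) fun _ _ => rfl
    exact natCast_pow_mul_eq_zero_iff (by omega) _
  · rw [← pow_mul]; exact natCast_pow_zmod_of_le (by omega)

theorem nKloos_eq_zero_of_not_isSquare (hp2 : p ≠ 2) (hk : 1 < k) {χ : MulChar (ZMod (p ^ k)) ℂ}
    {t : ZMod (p ^ k)} (h : HasParam p k χ t) (a : ℤ)
    (hsq : ¬ IsSquare (redMod p k (by omega) t ^ 2 - 4 * (a : ZMod p) ^ 2)) :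
    nKloos (p ^ k) a χ = 0 := by
  classical
  have : Kloos (p ^ k) (a : ZMod (p ^ k)) (-(a : ZMod (p ^ k))) χ = 0 := by
    rw [Kloos_eq_sum_critical hp2 h, filter_false_of_mem, sum_empty]
    rintro x _ ⟨y, hy⟩
    have hk2 : k / 2 ≠ 0 := by omega
    have h1 := congrArg (fun z => redMod p k (by omega) (z * x)) hy
    have h2 : redMod p k (by omega) ((p : ZMod (p ^ k)) ^ (k / 2) * y * x) = 0 := by
      simp [hk2]
    have h3 : ((a : ZMod (p ^ k)) * x + a * ↑x⁻¹ + t) * x = a * x ^ 2 + a + t * x := by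
      linear_combination (a : ZMod (p ^ k)) * x.inv_mul
    simp only [h3] at h1
    rw [h2, map_add, map_add, map_mul, map_mul, map_pow, map_intCast] at h1
    refine hsq ⟨2 * a * redMod p k (by omega) x + redMod p k (by omega) t, ?_⟩
    linear_combination (-4 * (a : ZMod p)) * h1
  rw [nKloos, this, smul_zero, Complex.zero_re]

theorem exists_nKloos_eq_of_sq_eq (hp2 : p ≠ 2) (hk : 1 < k) (t : ZMod (p ^ k)) {a : ℤ}
    (ha : (a : ZMod p) ≠ 0) {s₀ : ZMod p}
    (hs₀ : s₀ ^ 2 = redMod p k (by omega) t ^ 2 - 4 * (a : ZMod p) ^ 2) (hne : s₀ ≠ 0) :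
    ∃ (u : (ZMod (p ^ k))ˣ) (c : ℂ), ‖c‖ = 1 ∧
      2 * (a : ZMod p) * redMod p k (by omega) u = -redMod p k (by omega) t + s₀ ∧
      ∀ χ, HasParam p k χ t → nKloos (p ^ k) a χ = 2 * (c * χ u).re := by
  classical
  have hk0 : k ≠ 0 := by omega
  set v : ZMod (p ^ k) := (p : ZMod (p ^ k)) ^ (k / 2) with hv
  have hv3 : v ^ 3 = 0 := by rw [hv, ← pow_mul]; exact natCast_pow_zmod_of_le (by omega)
  set e := (2 : ZMod (p ^ k))⁻¹ with hedef
  have he : 2 * e = 1 := two_mul_inv_two_zmod_pow hp2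
  obtain ⟨s, hs, hred⟩ := exists_sq_eq_of_isSquare_redMod hp2 hk0
    (D := t ^ 2 - 4 * (a : ZMod (p ^ k)) ^ 2) (s₀ := s₀)
    (by rw [map_sub, map_mul, map_pow, map_pow, map_intCast, map_ofNat, hs₀]) hne
  have haU : IsUnit (a : ZMod (p ^ k)) := by
    rw [isUnit_iff_redMod_ne_zero hk0, map_intCast]; exact ha
  obtain ⟨b, hb⟩ := haU.exists_right_inv
  let u : (ZMod (p ^ k))ˣ := ⟨(-t + s) * e * b, (-t - s) * e * b,
    by linear_combination (-b ^ 2 * e ^ 2) * hs + (4 * e ^ 2) * (a * b + 1) * hb + (2 * e + 1) * he,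
    by linear_combination (-b ^ 2 * e ^ 2) * hs + (4 * e ^ 2) * (a * b + 1) * hb + (2 * e + 1) * he⟩
  have hu : (u : ZMod (p ^ k)) = (-t + s) * e * b := rfl
  have hui : (↑u⁻¹ : ZMod (p ^ k)) = (-t - s) * e * b := rfl
  have hα : a * (u : ZMod (p ^ k)) - a * ↑u⁻¹ = s := by
    rw [hu, hui]; linear_combination (2 * e * s) * hb + s * he
  have hκ : a * (u : ZMod (p ^ k)) + a * ↑u⁻¹ + t = 0 := by
    rw [hu, hui]; linear_combination (-2 * e * t) * hb - t * he
  have hsU : IsUnit s := by rw [isUnit_iff_redMod_ne_zero hk0, hred]; exact hne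
  have hdU : IsUnit ((u : ZMod (p ^ k)) - ↑u⁻¹) := by
    rw [← mul_sub] at hα
    rw [← hα] at hsU
    exact isUnit_of_mul_isUnit_right hsU
  set Z := ∑ z : ZMod (p ^ k), ZMod.stdAddChar (v ^ 2 * (z ^ 2 * e) * s) with hZ
  have hvred : redMod p k hk0 v = 0 := by
    have hk2 : k / 2 ≠ 0 := by omega
    simp [hv, hk2]
  -- the critical points are those congruent to `u` or to its inverse
  have hcrit : ∀ x : (ZMod (p ^ k))ˣ, (∃ y, a * (x : ZMod (p ^ k)) + a * ↑x⁻¹ + t = v * y) ↔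
      (∃ y, (x : ZMod (p ^ k)) = u + v * y) ∨ ∃ y, (↑x⁻¹ : ZMod (p ^ k)) = u + v * y := by
    intro x
    have hfac : (a * (x : ZMod (p ^ k)) + a * ↑x⁻¹ + t) * x =
        a * ((x - u) * (x - ↑u⁻¹)) := by
      linear_combination (x : ZMod (p ^ k)) * hκ + a * x.inv_mul - a * u.mul_inv
    constructor
    · rintro ⟨y, hy⟩
      rw [hy] at hfac
      by_cases hxu : IsUnit ((x : ZMod (p ^ k)) - u)
      · right
        obtain ⟨w, hw⟩ := hxu.exists_right_inv
        have h1 : (x : ZMod (p ^ k)) - ↑u⁻¹ = v * (y * x * w * b) := by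
          linear_combination (-w * b) * hfac - ((x : ZMod (p ^ k)) - ↑u⁻¹) * hw -
            ((x : ZMod (p ^ k)) - ↑u⁻¹) * ((x - u) * w) * hb
        refine ⟨-(y * x * w * b) * u * ↑x⁻¹, ?_⟩
        linear_combination (-(u : ZMod (p ^ k)) * ↑x⁻¹) * h1 + u * x.inv_mul - ↑x⁻¹ * u.mul_inv
      · left
        have hxui : IsUnit ((x : ZMod (p ^ k)) - ↑u⁻¹) := by
          rw [isUnit_iff_redMod_ne_zero hk0, not_not, map_sub, sub_eq_zero] at hxu
          rw [isUnit_iff_redMod_ne_zero hk0, map_sub] at hdU ⊢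
          rwa [hxu]
        obtain ⟨w, hw⟩ := hxui.exists_right_inv
        refine ⟨y * x * w * b, ?_⟩
        linear_combination (-w * b) * hfac - ((x : ZMod (p ^ k)) - u) * hw -
            ((x : ZMod (p ^ k)) - u) * ((x - ↑u⁻¹) * w) * hb
    · rintro (⟨y, hy⟩ | ⟨y, hy⟩)
      · refine ⟨a * y * (x - ↑u⁻¹) * ↑x⁻¹, ?_⟩
        linear_combination ↑x⁻¹ * hfac - (a * (x : ZMod (p ^ k)) + a * ↑x⁻¹ + t) * x.mul_inv +
          (a * (x - ↑u⁻¹) * (↑x⁻¹ : ZMod (p ^ k))) * hy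
      · have h1 : (x : ZMod (p ^ k)) - ↑u⁻¹ = v * (-y * ↑u⁻¹ * x) := by
          linear_combination (-(↑u⁻¹ : ZMod (p ^ k)) * x) * hy + ↑u⁻¹ * x.inv_mul - x * u.inv_mul
        refine ⟨a * (-y * ↑u⁻¹ * x) * (x - u) * ↑x⁻¹, ?_⟩
        linear_combination ↑x⁻¹ * hfac - (a * (x : ZMod (p ^ k)) + a * ↑x⁻¹ + t) * x.mul_inv +
          (a * (x - u) * (↑x⁻¹ : ZMod (p ^ k))) * h1
  have hdisj : ∀ x : (ZMod (p ^ k))ˣ, (∃ y, (x : ZMod (p ^ k)) = u + v * y) →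
      ¬ ∃ y, (↑x⁻¹ : ZMod (p ^ k)) = u + v * y := by
    rintro x ⟨y, hy⟩ ⟨y', hy'⟩
    rw [isUnit_iff_redMod_ne_zero hk0] at hdU
    apply hdU
    have h1 := congrArg (redMod p k hk0) hy
    have h2 := congrArg (redMod p k hk0) hy'
    have h3 := congrArg (redMod p k hk0) x.mul_inv
    have h4 := congrArg (redMod p k hk0) u.mul_inv
    simp only [map_add, map_mul, hvred, zero_mul, add_zero, map_one] at h1 h2 h3 h4
    rw [h1, h2] at h3
    rw [map_sub]
    linear_combination (redMod p k hk0 ↑u⁻¹) * h3 - (redMod p k hk0 u) * h4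
  have hcardN : #{z : ZMod (p ^ k) | v * z = 0} = p ^ (k / 2) :=
    card_natCast_pow_mul_eq_zero (by omega)
  have hcardM : #{z : ZMod (p ^ k) | v ^ 2 * z = 0} = p ^ (k / 2 * 2) := by
    rw [hv, ← pow_mul]; exact card_natCast_pow_mul_eq_zero (by omega)
  have hp0 : (0 : ℝ) < p := by exact_mod_cast (Fact.out : p.Prime).pos
  have hZnorm : ‖Z‖ = √((p : ℝ) ^ k) * (p : ℝ) ^ (k / 2) := by
    have := norm_sq_gaussSum_eq (ZMod.isPrimitive_stdAddChar (p ^ k)) he v hsU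
    rw [hcardM, ZMod.card] at this
    rw [← Real.sqrt_sq (norm_nonneg Z), this, Real.sqrt_eq_iff_mul_self_eq (by positivity)
      (by positivity), mul_mul_mul_comm, Real.mul_self_sqrt (by positivity)]
    push_cast
    ring
  have hsqrt : 0 < √((p : ℝ) ^ k) := Real.sqrt_pos.2 (by positivity)
  refine ⟨u, ZMod.stdAddChar s * Z / ((√((p : ℝ) ^ k) * (p : ℝ) ^ (k / 2) : ℝ) : ℂ), ?_, ?_, ?_⟩
  · rw [norm_div, norm_mul, AddChar.norm_apply, one_mul, hZnorm, Complex.norm_real,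
      Real.norm_of_nonneg (by positivity), div_self (by positivity)]
  · rw [← hred, ← map_intCast (redMod p k hk0), ← map_ofNat (redMod p k hk0), ← map_mul, ← map_mul,
      ← map_neg, ← map_add, hu]
    congr 1
    linear_combination (2 * e * (-t + s)) * hb + (-t + s) * he
  intro χ hχ
  have hsum := sum_kloosSummand_near_critical ZMod.stdAddChar χ (a : ZMod (p ^ k)) t hv3 he
    (fun z => hχ z) hκ
  rw [hα, hcardN, ← hZ, kloosSummand, hα] at hsum
  set A := ∑ x ∈ univ.filter fun x : (ZMod (p ^ k))ˣ => ∃ y, (x : ZMod (p ^ k)) = u + v * y,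
    kloosSummand ZMod.stdAddChar χ (a : ZMod (p ^ k)) x with hA
  have hK : Kloos (p ^ k) (a : ZMod (p ^ k)) (-(a : ZMod (p ^ k))) χ =
      A + (starRingEnd ℂ) A := by
    rw [Kloos_eq_sum_critical hp2 hχ, filter_congr fun x _ => hcrit x, filter_or, sum_union, hA, map_sum]
    · congr 1
      refine sum_equiv (Equiv.inv _) (fun x => ?_) fun x _ => ?_
      · simp
      · rw [Equiv.inv_apply, kloosSummand_inv, Complex.conj_conj]
    · rw [disjoint_filter]
      exact fun x _ => hdisj x
  have hpc : ((p : ℂ)) ≠ 0 := by exact_mod_cast hp0.ne'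
  have hA' : A = √((p : ℝ) ^ k) * (ZMod.stdAddChar s * Z /
      ((√((p : ℝ) ^ k) * (p : ℝ) ^ (k / 2) : ℝ) : ℂ) * χ u) := by
    have h1 : ((√((p : ℝ) ^ k) : ℝ) : ℂ) ≠ 0 := by exact_mod_cast hsqrt.ne'
    push_cast at hsum ⊢
    field_simp
    linear_combination hsum
  have hpow : (((p ^ k : ℕ) : ℝ)) ^ (-(1 / 2 : ℝ)) = (√((p : ℝ) ^ k))⁻¹ := by
    rw [Real.rpow_neg (by positivity), ← Real.sqrt_eq_rpow, Nat.cast_pow]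
  rw [nKloos, hpow, hK, Complex.add_conj, Complex.real_smul, hA', Complex.re_ofReal_mul,
    Complex.re_ofReal_mul, Complex.ofReal_re]
  field_simp

end PrimePower

section FiberMoments

theorem two_mul_re_pow_eq_sum {w : ℂ} (hw : ‖w‖ = 1) (m : ℕ) :
    (((2 * w.re) ^ m : ℝ) : ℂ) =
      ∑ i ∈ range (m + 1), (m.choose i : ℂ) * w ^ (2 * (i : ℤ) - m) := by
  have hw0 : w ≠ 0 := by
    rintro rfl
    simp at hw
  have hinv : (starRingEnd ℂ) w = w⁻¹ := (Complex.inv_eq_conj hw).symm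
  have hre : ((2 * w.re : ℝ) : ℂ) = w + w⁻¹ := by rw [← hinv, Complex.add_conj]
  rw [Complex.ofReal_pow, hre, add_pow]
  refine sum_congr rfl fun i hi => ?_
  have h : (2 * (i : ℤ) - m) = (i : ℤ) - ((m - i : ℕ) : ℤ) := by
    have := mem_range.1 hi
    omega
  rw [h, zpow_sub₀ hw0, zpow_natCast, zpow_natCast, inv_pow, mul_comm, div_eq_mul_inv]

theorem prod_sum_choose_ite {r : ℕ} (m : Fin r → ℕ) :
    (∑ i ∈ Fintype.piFinset fun j => range (m j + 1),
      if ∀ j, 2 * i j = m j then ∏ j, ((m j).choose (i j) : ℝ) else 0) =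
      ∏ j, if Even (m j) then ((m j).choose (m j / 2) : ℝ) else 0 := by
  calc _ = ∑ i ∈ Fintype.piFinset fun j => range (m j + 1),
        ∏ j, if 2 * i j = m j then ((m j).choose (i j) : ℝ) else 0 := by
        refine sum_congr rfl fun i _ => ?_
        split_ifs with h
        · exact prod_congr rfl fun j _ => by rw [if_pos (h j)]
        · push Not at h
          obtain ⟨j, hj⟩ := h
          exact (prod_eq_zero (mem_univ j) (if_neg hj)).symm
    _ = ∏ j, ∑ i ∈ range (m j + 1), if 2 * i = m j then ((m j).choose i : ℝ) else 0 :=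
        (prod_univ_sum (fun j => range (m j + 1))
          fun j i => if 2 * i = m j then ((m j).choose i : ℝ) else 0).symm
    _ = _ := by
        refine prod_congr rfl fun j _ => ?_
        split_ifs with h
        · obtain ⟨c, hc⟩ := h
          rw [sum_eq_single_of_mem c (mem_range.2 (by omega)) fun b _ hb => if_neg (by omega),
            if_pos (by omega)]
          congr 2
          omega
        · exact sum_eq_zero fun i _ => if_neg fun hi => h ⟨i, by omega⟩

variable {p k : ℕ} [Fact p.Prime]

theorem HasParam.mul_changeLevel (hk : 1 < k) {χ : MulChar (ZMod (p ^ k)) ℂ} {t : ZMod (p ^ k)}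
    (hχ : HasParam p k χ t) (ψ : DirichletCharacter ℂ p) :
    HasParam p k (χ * DirichletCharacter.changeLevel (dvd_pow_self p (by omega)) ψ) t := by
  intro z
  have hk2 : k / 2 ≠ 0 := by omega
  set y := 1 + (p : ZMod (p ^ k)) ^ (k / 2) * z +
    ((p : ZMod (p ^ k)) ^ (k / 2)) ^ 2 * (z ^ 2 * (2 : ZMod (p ^ k))⁻¹) with hy
  have hred : redMod p k (by omega) y = 1 := by
    simp [hy, hk2]
  have hu : IsUnit y := by
    rw [isUnit_iff_redMod_ne_zero (by omega), hred]
    exact one_ne_zero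
  obtain ⟨u, hu⟩ := hu
  rw [MulChar.mul_apply, hχ z, ← hu, DirichletCharacter.changeLevel_eq_cast_of_dvd, hu]
  have h : (y.cast : ZMod p) = 1 := hred
  rw [h, map_one, mul_one]

/-- Orthogonality of the characters with a given parameter. -/
theorem sum_filter_apply_eq_zero (hk : 1 < k) {T : MulChar (ZMod (p ^ k)) ℂ → ZMod (p ^ k)}
    (hT : ∀ χ (ψ : DirichletCharacter ℂ p),
      T (χ * DirichletCharacter.changeLevel (dvd_pow_self p (by omega)) ψ) = T χ)
    (t : ZMod (p ^ k)) {u : (ZMod (p ^ k))ˣ} (hu : redMod p k (by omega) u ≠ 1) :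
    ∑ χ : MulChar (ZMod (p ^ k)) ℂ with T χ = t, χ u = 0 := by
  obtain ⟨ψ, hψ⟩ := DirichletCharacter.exists_apply_ne_one_of_hasEnoughRootsOfUnity ℂ hu
  set Ψ := DirichletCharacter.changeLevel (dvd_pow_self p (show k ≠ 0 by omega)) ψ with hΨ
  have hΨu : Ψ u = ψ (redMod p k (by omega) u) :=
    DirichletCharacter.changeLevel_eq_cast_of_dvd ψ _ u
  refine eq_zero_of_mul_eq_self_left hψ ?_
  rw [← hΨu, mul_sum]
  refine sum_equiv (Equiv.mulRight Ψ) (fun χ => ?_) fun χ _ => ?_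
  · simp only [mem_filter, mem_univ, true_and, Equiv.coe_mulRight, hΨ, hT]
  · rw [Equiv.coe_mulRight, MulChar.mul_apply, mul_comm]

theorem prod_zpow_ne_one_of_no_relation {r : ℕ} {F : Type*} [Field F] {t : F} {b : Fin r → F}
    (hb : ∀ j, b j ≠ 0) {m : Fin r → ℕ}
    (hrel : ∀ n : Fin r → ℕ, n ≠ 0 → n ≤ m → ∀ s : Fin r → F, (∀ j, s j ^ 2 = t ^ 2 - b j ^ 2) →
      ∏ j, (-t + s j) ^ n j ≠ ∏ j, b j ^ n j)
    {s : Fin r → F} (hs : ∀ j, s j ^ 2 = t ^ 2 - b j ^ 2) {x : Fin r → F}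
    (hx : ∀ j, b j * x j = -t + s j) {e : Fin r → ℤ} (he : e ≠ 0) (hem : ∀ j, (e j).natAbs ≤ m j) :
    ∏ j, x j ^ e j ≠ 1 := by
  intro h1
  have hinv : ∀ j, b j * (x j)⁻¹ = -t + -s j := by
    intro j
    have h : (b j * x j) * (-t + -s j) = b j ^ 2 := by
      rw [hx]
      linear_combination -hs j
    have hx0 : x j ≠ 0 := by
      intro h0
      rw [h0, mul_zero, zero_mul] at h
      exact hb j (pow_eq_zero_iff two_ne_zero |>.1 h.symm)
    refine mul_left_cancel₀ (mul_ne_zero (hb j) hx0) ?_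
    rw [h]
    field_simp
  refine hrel (fun j => (e j).natAbs) ?_ hem (fun j => if 0 ≤ e j then s j else -s j) ?_ ?_
  · obtain ⟨j, hj⟩ := Function.ne_iff.1 he
    exact Function.ne_iff.2 ⟨j, Int.natAbs_ne_zero.2 hj⟩
  · intro j
    split_ifs
    · exact hs j
    · rw [neg_sq, hs j]
  · have h2 : ∀ j, (-t + if 0 ≤ e j then s j else -s j) ^ (e j).natAbs =
        b j ^ (e j).natAbs * x j ^ e j := by
      intro j
      split_ifs with h
      · rw [← hx, mul_pow]
        congr 1
        rw [← zpow_natCast, Int.natAbs_of_nonneg h]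
      · rw [← hinv, mul_pow]
        congr 1
        rw [← zpow_natCast, inv_zpow', Int.ofNat_natAbs_of_nonpos (le_of_not_ge h), neg_neg]
    rw [prod_congr rfl fun j _ => h2 j, prod_mul_distrib, h1, mul_one]

open Classical in
/-- The mixed moment over the characters with a given parameter. -/
theorem sum_filter_prod_nKloos_pow (hp2 : p ≠ 2) (hk : 1 < k) {r : ℕ} {a : Fin r → ℤ}
    (ha : ∀ j, (a j : ZMod p) ≠ 0) {m : Fin r → ℕ} (hm : ∀ j, 0 < m j)
    {T : MulChar (ZMod (p ^ k)) ℂ → ZMod (p ^ k)} (hTp : ∀ χ, HasParam p k χ (T χ))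
    (hT : ∀ χ (ψ : DirichletCharacter ℂ p),
      T (χ * DirichletCharacter.changeLevel (dvd_pow_self p (by omega)) ψ) = T χ)
    (t : ZMod (p ^ k))
    (hD : ∀ j, redMod p k (by omega) t ^ 2 - 4 * (a j : ZMod p) ^ 2 ≠ 0)
    (hrel : ∀ n : Fin r → ℕ, n ≠ 0 → n ≤ m → ∀ s : Fin r → ZMod p,
      (∀ j, s j ^ 2 = redMod p k (by omega) t ^ 2 - 4 * (a j : ZMod p) ^ 2) →
      ∏ j, (-redMod p k (by omega) t + s j) ^ n j ≠ ∏ j, (2 * (a j : ZMod p)) ^ n j) :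
    ∑ χ : MulChar (ZMod (p ^ k)) ℂ with T χ = t, ∏ j, nKloos (p ^ k) (a j) χ ^ m j =
      #{χ : MulChar (ZMod (p ^ k)) ℂ | T χ = t} *
        if ∀ j, IsSquare (redMod p k (by omega) t ^ 2 - 4 * (a j : ZMod p) ^ 2) then
          ∏ j, (if Even (m j) then ((m j).choose (m j / 2) : ℝ) else 0) else 0 := by
  have hk0 : k ≠ 0 := by omega
  split_ifs with hsq
  swap
  · push Not at hsq
    obtain ⟨j, hj⟩ := hsq
    rw [mul_zero]
    refine sum_eq_zero fun χ hχ => prod_eq_zero (mem_univ j) ?_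
    have h := hTp χ
    rw [(mem_filter.1 hχ).2] at h
    rw [nKloos_eq_zero_of_not_isSquare hp2 hk h _ hj, zero_pow (hm j).ne']
  choose s hs using fun j => (isSquare_iff_exists_sq _).1 (hsq j)
  have hs' : ∀ j, s j ^ 2 = redMod p k hk0 t ^ 2 - 4 * (a j : ZMod p) ^ 2 := fun j => (hs j).symm
  choose u c hc hu hK using fun j => exists_nKloos_eq_of_sq_eq hp2 hk t (ha j) (hs' j)
    (fun h => hD j (by rw [hs j, h]; simp))
  have hne : ∀ i ∈ Fintype.piFinset fun j => range (m j + 1), ¬ (∀ j, 2 * i j = m j) →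
      redMod p k hk0 ↑(∏ j, u j ^ (2 * (i j : ℤ) - m j)) ≠ 1 := by
    intro i hi hi2
    have h := prod_zpow_ne_one_of_no_relation (t := redMod p k hk0 t)
      (b := fun j => 2 * (a j : ZMod p)) (m := m) (s := s) (x := fun j => redMod p k hk0 (u j))
      (e := fun j => 2 * (i j : ℤ) - m j)
      (fun j => mul_ne_zero (two_ne_zero_zmod hp2) (ha j))
      (fun n hn hnm s hs => hrel n hn hnm s fun j => by rw [hs j]; ring)
      (fun j => by rw [hs' j]; ring) hu ?_ ?_
    · have hmap : ∀ x : (ZMod (p ^ k))ˣ, redMod p k hk0 x =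
          (Units.map (redMod p k hk0 : ZMod (p ^ k) →* ZMod p) x : (ZMod p)ˣ) := fun _ => rfl
      have hprod : redMod p k hk0 ↑(∏ j, u j ^ (2 * (i j : ℤ) - m j)) =
          ∏ j, redMod p k hk0 (u j) ^ (2 * (i j : ℤ) - m j) := by
        simp only [hmap, map_prod, map_zpow, Units.coe_prod, Units.val_zpow_eq_zpow_val]
      rwa [hprod]
    · push Not at hi2
      obtain ⟨j, hj⟩ := hi2
      exact Function.ne_iff.2 ⟨j, by simp only [Pi.zero_apply]; omega⟩
    · intro j
      have := mem_range.1 (Fintype.mem_piFinset.1 hi j)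
      omega
  have hexp : ∀ χ : MulChar (ZMod (p ^ k)) ℂ, T χ = t →
      ((∏ j, nKloos (p ^ k) (a j) χ ^ m j : ℝ) : ℂ) =
        ∑ i ∈ Fintype.piFinset fun j => range (m j + 1),
          (∏ j, ((m j).choose (i j) : ℂ) * c j ^ (2 * (i j : ℤ) - m j)) *
            χ ↑(∏ j, u j ^ (2 * (i j : ℤ) - m j)) := by
    intro χ hχ
    have hpar := hTp χ
    rw [hχ] at hpar
    have h1 : ∀ j, ((nKloos (p ^ k) (a j) χ ^ m j : ℝ) : ℂ) =
        ∑ i ∈ range (m j + 1), ((m j).choose i : ℂ) * (c j * χ (u j)) ^ (2 * (i : ℤ) - m j) := by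
      intro j
      rw [hK j χ hpar, two_mul_re_pow_eq_sum]
      rw [norm_mul, hc, MulChar.norm_apply_units, one_mul]
    rw [Complex.ofReal_prod, prod_congr rfl fun j _ => h1 j, prod_univ_sum]
    refine sum_congr rfl fun i _ => ?_
    have h2 : χ ↑(∏ j, u j ^ (2 * (i j : ℤ) - m j)) = ∏ j, χ (u j) ^ (2 * (i j : ℤ) - m j) := by
      have : ∀ x : (ZMod (p ^ k))ˣ, χ x = (MulChar.toUnitHom χ x : ℂ) := fun x =>
        (MulChar.coe_toUnitHom χ x).symm
      simp only [this, map_prod, map_zpow]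
      push_cast
      rfl
    rw [h2, ← prod_mul_distrib]
    refine prod_congr rfl fun j _ => ?_
    rw [mul_zpow, mul_assoc]
  rw [← Complex.ofReal_inj, Complex.ofReal_sum, sum_congr rfl fun χ hχ =>
    hexp χ (mem_filter.1 hχ).2, sum_comm, ← prod_sum_choose_ite]
  rw [Complex.ofReal_mul, Complex.ofReal_natCast, Complex.ofReal_sum, mul_sum]
  refine sum_congr rfl fun i hi => ?_
  rw [← mul_sum]
  split_ifs with h
  · have h0 : ∀ j, 2 * (i j : ℤ) - m j = 0 := fun j => by have := h j; omega
    simp only [h0, zpow_zero, prod_const_one, Units.val_one, map_one, sum_const, nsmul_eq_mul,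
      mul_one, Complex.ofReal_prod, Complex.ofReal_natCast]
    rw [mul_comm]
  · rw [sum_filter_apply_eq_zero hk hT t (hne i hi h)]
    simp

end FiberMoments

section ParameterTransfer

theorem stdAddChar_natCast_mul {M N Q : ℕ} [NeZero N] [NeZero Q] (h : M * N = Q) (x : ZMod Q) :
    ZMod.stdAddChar ((M : ZMod Q) * x) =
      ZMod.stdAddChar (ZMod.castHom (Dvd.intro_left M h) (ZMod N) x) := by
  obtain ⟨n, rfl⟩ := ZMod.natCast_zmod_surjective x
  have hM : M ≠ 0 := by
    rintro rfl
    exact NeZero.ne Q (by omega)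
  have h1 := ZMod.stdAddChar_coe (N := Q) ((M * n : ℕ) : ℤ)
  have h2 := ZMod.stdAddChar_coe (N := N) (n : ℤ)
  rw [map_natCast]
  push_cast at h1 h2
  rw [h1, h2, ← h]
  congr 1
  have hM' : (M : ℂ) ≠ 0 := Nat.cast_ne_zero.2 hM
  have hN' : (N : ℂ) ≠ 0 := Nat.cast_ne_zero.2 (NeZero.ne N)
  push_cast
  field_simp

theorem natCast_mul_eq_of_castHom_eq {M N Q : ℕ} [NeZero Q] (h : M * N = Q) {x y : ZMod Q}
    (hxy : ZMod.castHom (Dvd.intro_left M h) (ZMod N) x =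
      ZMod.castHom (Dvd.intro_left M h) (ZMod N) y) : (M : ZMod Q) * x = M * y := by
  obtain ⟨n, rfl⟩ := ZMod.natCast_zmod_surjective x
  obtain ⟨n', rfl⟩ := ZMod.natCast_zmod_surjective y
  rw [map_natCast, map_natCast, ZMod.natCast_eq_natCast_iff] at hxy
  have := Nat.ModEq.mul_left' M hxy
  rw [h] at this
  exact_mod_cast (ZMod.natCast_eq_natCast_iff _ _ _).2 this

variable {p k : ℕ} [Fact p.Prime]

theorem hasParam_of_apply_eq_eZMod (hp2 : p ≠ 2) {χ : MulChar (ZMod (p ^ k)) ℂ}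
    {t : ZMod (p ^ (k - k / 2))}
    (heven : k % 2 = 0 → ∀ x : ZMod (p ^ (k - k / 2)),
      χ (1 + (p : ZMod (p ^ k)) ^ (k / 2) * (x.val : ZMod (p ^ k))) =
        eZMod (p ^ (k - k / 2)) (t * x))
    (hodd : k % 2 = 1 → ∀ x : ZMod (p ^ (k - k / 2)),
      χ (1 + (p : ZMod (p ^ k)) ^ (k / 2) * (x.val : ZMod (p ^ k)) +
          (p : ZMod (p ^ k)) ^ (2 * (k / 2)) *
            (((x ^ 2 * (2 : ZMod (p ^ (k - k / 2)))⁻¹).val : ZMod (p ^ k)))) =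
        eZMod (p ^ (k - k / 2)) (t * x)) :
    HasParam p k χ (t.val : ZMod (p ^ k)) := by
  intro z
  have hpk : p ^ (k / 2) * p ^ (k - k / 2) = p ^ k := by
    rw [← pow_add]
    congr 1
    omega
  set f := ZMod.castHom (Dvd.intro_left _ hpk) (ZMod (p ^ (k - k / 2))) with hf
  have hval : ∀ x : ZMod (p ^ (k - k / 2)), f (x.val : ZMod (p ^ k)) = x := fun x => by
    rw [map_natCast, ZMod.natCast_zmod_val]
  have hmul : ∀ {x y : ZMod (p ^ k)}, f x = f y →
      (p : ZMod (p ^ k)) ^ (k / 2) * x = (p : ZMod (p ^ k)) ^ (k / 2) * y := fun {x y} hxy => by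
    have := natCast_mul_eq_of_castHom_eq hpk hxy
    rwa [Nat.cast_pow] at this
  have hright : ZMod.stdAddChar ((p : ZMod (p ^ k)) ^ (k / 2) * (t.val : ZMod (p ^ k)) * z) =
      eZMod (p ^ (k - k / 2)) (t * f z) := by
    rw [eZMod_eq_stdAddChar, mul_assoc, ← Nat.cast_pow, stdAddChar_natCast_mul hpk, ← hf, map_mul,
      hval]
  rw [hright]
  rcases Nat.mod_two_eq_zero_or_one k with h | h
  · have h0 : (p : ZMod (p ^ k)) ^ (k / 2 * 2) = 0 := natCast_pow_zmod_of_le (by omega)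
    rw [← heven h, hmul (hval (f z)), ← pow_mul, h0, zero_mul, add_zero]
  · have h2 : f (2 : ZMod (p ^ k))⁻¹ = (2 : ZMod (p ^ (k - k / 2)))⁻¹ := by
      have h3 : 2 * f (2 : ZMod (p ^ k))⁻¹ = 1 := by
        rw [← map_ofNat f 2, ← map_mul, two_mul_inv_two_zmod_pow hp2, map_one]
      have h4 : 2 * (2 : ZMod (p ^ (k - k / 2)))⁻¹ = 1 := two_mul_inv_two_zmod_pow hp2
      calc _ = (2 * (2 : ZMod (p ^ (k - k / 2)))⁻¹) * f (2 : ZMod (p ^ k))⁻¹ := by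
            rw [h4, one_mul]
        _ = _ := by rw [mul_right_comm, h3, one_mul]
    rw [← hodd h, hmul (hval (f z)), ← pow_mul, mul_comm (k / 2) 2, two_mul, pow_add, mul_assoc,
      mul_assoc]
    congr 3
    refine hmul ?_
    rw [hval, map_mul, map_pow, h2]

theorem HasParam.natCast_pow_mul_eq {χ : MulChar (ZMod (p ^ k)) ℂ} {t t' : ZMod (p ^ k)}
    (h : HasParam p k χ t) (h' : HasParam p k χ t') :
    (p : ZMod (p ^ k)) ^ (k / 2) * t = (p : ZMod (p ^ k)) ^ (k / 2) * t' := by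
  have := (h 1).symm.trans (h' 1)
  simpa using ZMod.injective_stdAddChar this

theorem HasParam.val_injective {χ : MulChar (ZMod (p ^ k)) ℂ} {t t' : ZMod (p ^ (k - k / 2))}
    (h : HasParam p k χ (t.val : ZMod (p ^ k))) (h' : HasParam p k χ (t'.val : ZMod (p ^ k))) :
    t = t' := by
  have hpk : p ^ (k / 2) * p ^ (k - k / 2) = p ^ k := by
    rw [← pow_add]
    congr 1
    omega
  have h1 := h.natCast_pow_mul_eq h'
  norm_cast at h1
  rw [ZMod.natCast_eq_natCast_iff, ← hpk] at h1
  have h2 := Nat.ModEq.mul_left_cancel' (pow_ne_zero _ (Fact.out : p.Prime).ne_zero) h1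
  rw [← ZMod.natCast_eq_natCast_iff] at h2
  simpa using h2

theorem abs_nKloos_le_two (hp2 : p ≠ 2) (hk : 1 < k) {χ : MulChar (ZMod (p ^ k)) ℂ}
    {t : ZMod (p ^ k)} (h : HasParam p k χ t) {a : ℤ} (ha : (a : ZMod p) ≠ 0)
    (hne : redMod p k (by omega) t ^ 2 - 4 * (a : ZMod p) ^ 2 ≠ 0) :
    |nKloos (p ^ k) a χ| ≤ 2 := by
  by_cases hsq : IsSquare (redMod p k (by omega) t ^ 2 - 4 * (a : ZMod p) ^ 2)
  · obtain ⟨s, hs⟩ := (isSquare_iff_exists_sq _).1 hsq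
    obtain ⟨u, c, hc, -, hK⟩ := exists_nKloos_eq_of_sq_eq hp2 hk t ha hs.symm
      (by rintro rfl; exact hne (by rw [hs]; simp))
    rw [hK χ h, abs_mul, abs_two]
    have : ‖c * χ u‖ = 1 := by rw [norm_mul, hc, MulChar.norm_apply_units, one_mul]
    linarith [Complex.abs_re_le_norm (c * χ u)]
  · rw [nKloos_eq_zero_of_not_isSquare hp2 hk h a hsq]
    simp

open Classical in
/-- The parameters are equidistributed modulo `p`. -/
theorem card_filter_redMod_mul (hk : 1 < k) {T : MulChar (ZMod (p ^ k)) ℂ → ZMod (p ^ k)}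
    (hTp : ∀ χ, HasParam p k χ (T χ)) (τ : ZMod p) :
    #{χ : MulChar (ZMod (p ^ k)) ℂ | redMod p k (by omega) (T χ) = τ} * p =
      (p ^ k).totient := by
  have hk0 : k ≠ 0 := by omega
  have hpk : p ^ (k - 1) * p = p ^ k := by
    rw [← pow_succ]
    congr 1
    omega
  have hχ : ∀ (χ : MulChar (ZMod (p ^ k)) ℂ) (z : ZMod p),
      χ (1 + (p : ZMod (p ^ k)) ^ (k - 1) * (z.val : ZMod (p ^ k))) =
        ZMod.stdAddChar (redMod p k hk0 (T χ) * z) := by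
    intro χ z
    rw [(hTp χ).apply_one_add (by omega) (by omega), mul_assoc, ← Nat.cast_pow,
      stdAddChar_natCast_mul hpk, map_mul, map_natCast, ZMod.natCast_zmod_val]
    rfl
  have hind : ∀ χ : MulChar (ZMod (p ^ k)) ℂ,
      (if redMod p k hk0 (T χ) = τ then (p : ℂ) else 0) = ∑ z : ZMod p,
        ZMod.stdAddChar (-τ * z) *
          χ (1 + (p : ZMod (p ^ k)) ^ (k - 1) * (z.val : ZMod (p ^ k))) := by
    intro χ
    have h := AddChar.sum_mulShift (redMod p k hk0 (T χ) - τ) (ZMod.isPrimitive_stdAddChar p)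
    simp only [ZMod.card, sub_eq_zero, Nat.cast_ite, Nat.cast_zero] at h
    convert h.symm using 1
    refine sum_congr rfl fun z _ => ?_
    rw [hχ, ← AddChar.map_add_eq_mul]
    congr 1
    ring
  have hone : ∀ z : ZMod p,
      1 + (p : ZMod (p ^ k)) ^ (k - 1) * (z.val : ZMod (p ^ k)) = 1 ↔ z = 0 := by
    intro z
    rw [add_eq_left]
    constructor
    · intro h
      rw [natCast_pow_mul_eq_zero_iff (j := 1) (by omega)] at h
      obtain ⟨y, hy⟩ := h
      have := congrArg (redMod p k hk0) hy
      simpa using this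
    · rintro rfl
      simp
  rw [← Nat.cast_inj (R := ℂ), Nat.cast_mul, card_filter]
  push_cast
  rw [sum_mul, sum_congr rfl fun χ _ => (show _ = (if redMod p k hk0 (T χ) = τ then (p : ℂ) else 0)
    by split_ifs <;> simp), sum_congr rfl fun χ _ => hind χ, sum_comm]
  simp_rw [← mul_sum]
  rw [sum_eq_single 0]
  · have := DirichletCharacter.sum_characters_eq ℂ (n := p ^ k) 1
    rw [if_pos rfl] at this
    rw [(hone 0).2 rfl, this]
    simp
  · intro z _ hz
    have := DirichletCharacter.sum_characters_eq ℂ (n := p ^ k)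
      (1 + (p : ZMod (p ^ k)) ^ (k - 1) * (z.val : ZMod (p ^ k)))
    rw [if_neg (mt (hone z).1 hz)] at this
    rw [this, mul_zero]
  · simp

end ParameterTransfer

section MixedMoments

open Polynomial Filter

theorem exists_relation_polynomial_forall_le {r : ℕ} {a : Fin r → ℤ} (ha : ∀ i, a i ≠ 0)
    (hdist : ∀ i j, i ≠ j → a i ≠ a j ∧ a i ≠ -a j) (m : Fin r → ℕ) :
    ∃ P : ℤ[X], P ≠ 0 ∧ ∀ n : Fin r → ℕ, n ≠ 0 → n ≤ m → ∀ {F : Type} [Field F] (t : F)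
      (s : Fin r → F), (∀ j, s j ^ 2 = t ^ 2 - 4 * (a j : F) ^ 2) →
      ∏ j, (-t + s j) ^ n j = ∏ j, (2 * (a j : F)) ^ n j → aeval t P = 0 := by
  classical
  have h : ∀ n : Fin r → ℕ, ∃ P : ℤ[X], P ≠ 0 ∧ (n ≠ 0 → ∀ {F : Type} [Field F] (t : F)
      (s : Fin r → F), (∀ j, s j ^ 2 = t ^ 2 - 4 * (a j : F) ^ 2) →
      ∏ j, (-t + s j) ^ n j = ∏ j, (2 * (a j : F)) ^ n j → aeval t P = 0) := by
    intro n
    by_cases hn : n = 0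
    · exact ⟨1, one_ne_zero, fun h => absurd hn h⟩
    · obtain ⟨P, hP0, hP⟩ := exists_relation_polynomial ha hdist hn
      exact ⟨P, hP0, fun _ => hP⟩
  choose P hP0 hP using h
  refine ⟨∏ n ∈ Finset.Iic m, P n, prod_ne_zero_iff.2 fun n _ => hP0 n, ?_⟩
  intro n hn hnm F _ t s hs hprod
  rw [map_prod]
  exact prod_eq_zero (Finset.mem_Iic.2 hnm) (hP n hn t s hs hprod)

theorem eventually_map_zmod_ne_zero {P : ℤ[X]} (hP : P ≠ 0) :
    ∀ᶠ p : ℕ in atTop, P.map (Int.castRingHom (ZMod p)) ≠ 0 := by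
  filter_upwards [eventually_intCast_zmod_ne_zero (leadingCoeff_ne_zero.2 hP)] with p hp h
  apply hp
  simpa using congrArg (fun Q => Q.coeff P.natDegree) h

theorem card_filter_aeval_eq_zero_le {F : Type*} [Field F] [Fintype F] [DecidableEq F] {P : ℤ[X]}
    (hP : P.map (Int.castRingHom F) ≠ 0) : #{x : F | aeval x P = 0} ≤ P.natDegree := by
  calc #{x : F | aeval x P = 0} ≤ #(P.map (Int.castRingHom F)).roots.toFinset := by
        refine card_le_card fun x hx => ?_
        rw [Multiset.mem_toFinset, mem_roots hP, IsRoot, eval_map]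
        exact (mem_filter.1 hx).2
    _ ≤ (P.map (Int.castRingHom F)).roots.card := Multiset.toFinset_card_le _
    _ ≤ _ := card_roots' _
    _ ≤ _ := natDegree_map_le

theorem prod_choose_ite_nonneg {r : ℕ} (m : Fin r → ℕ) :
    0 ≤ ∏ j, (if Even (m j) then ((m j).choose (m j / 2) : ℝ) else 0) :=
  prod_nonneg fun j _ => by split_ifs <;> positivity

theorem prod_choose_ite_le {r : ℕ} (m : Fin r → ℕ) :
    ∏ j, (if Even (m j) then ((m j).choose (m j / 2) : ℝ) else 0) ≤ 2 ^ ∑ j, m j := by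
  rw [← prod_pow_eq_pow_sum]
  refine prod_le_prod (fun j _ => by split_ifs <;> positivity) fun j _ => ?_
  split_ifs
  · exact_mod_cast Nat.choose_le_two_pow _ _
  · positivity

variable {p k : ℕ} [Fact p.Prime]

open Classical in
theorem abs_sum_filter_prod_nKloos_pow_sub_le (hp2 : p ≠ 2) (hk : 1 < k) {r : ℕ} {a : Fin r → ℤ}
    (ha : ∀ j, (a j : ZMod p) ≠ 0) {m : Fin r → ℕ} (hm : ∀ j, 0 < m j)
    {T : MulChar (ZMod (p ^ k)) ℂ → ZMod (p ^ k)} (hTp : ∀ χ, HasParam p k χ (T χ))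
    (hT : ∀ χ (ψ : DirichletCharacter ℂ p),
      T (χ * DirichletCharacter.changeLevel (dvd_pow_self p (by omega)) ψ) = T χ)
    {P : ℤ[X]} (hP : P.map (Int.castRingHom (ZMod p)) ≠ 0)
    (hrel : ∀ n : Fin r → ℕ, n ≠ 0 → n ≤ m → ∀ (t : ZMod p) (s : Fin r → ZMod p),
      (∀ j, s j ^ 2 = t ^ 2 - 4 * (a j : ZMod p) ^ 2) →
      ∏ j, (-t + s j) ^ n j = ∏ j, (2 * (a j : ZMod p)) ^ n j → aeval t P = 0)
    {N : ℝ} (hN : N * p = (p ^ k).totient) :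
    |∑ χ : MulChar (ZMod (p ^ k)) ℂ with
        ∀ j, redMod p k (by omega) (T χ) ^ 2 - 4 * (a j : ZMod p) ^ 2 ≠ 0,
        ∏ j, nKloos (p ^ k) (a j) χ ^ m j -
      N * ((∏ j, if Even (m j) then ((m j).choose (m j / 2) : ℝ) else 0) *
        Nat.card {x : ZMod p // ∀ j, x ^ 2 - 4 * (a j : ZMod p) ^ 2 ≠ 0 ∧
          IsSquare (x ^ 2 - 4 * (a j : ZMod p) ^ 2)})| ≤
      P.natDegree * (N * (2 * 2 ^ ∑ j, m j)) := by
  have hk0 : k ≠ 0 := by omega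
  have hp0 : (p : ℝ) ≠ 0 := Nat.cast_ne_zero.2 (Fact.out : p.Prime).ne_zero
  set c := ∏ j, if Even (m j) then ((m j).choose (m j / 2) : ℝ) else 0 with hc
  set f : MulChar (ZMod (p ^ k)) ℂ → ℝ := fun χ => ∏ j, nKloos (p ^ k) (a j) χ ^ m j with hf
  have hcard : ∀ τ : ZMod p,
      (#{χ : MulChar (ZMod (p ^ k)) ℂ | redMod p k hk0 (T χ) = τ} : ℝ) = N := by
    intro τ
    refine mul_right_cancel₀ hp0 ?_
    rw [hN, ← card_filter_redMod_mul hk hTp τ]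
    push_cast
    rfl
  have hN0 : 0 ≤ N := by
    rw [← hcard 0]
    positivity
  have hsum : ∑ χ : MulChar (ZMod (p ^ k)) ℂ with
        ∀ j, redMod p k hk0 (T χ) ^ 2 - 4 * (a j : ZMod p) ^ 2 ≠ 0, f χ =
      ∑ τ : ZMod p with ∀ j, τ ^ 2 - 4 * (a j : ZMod p) ^ 2 ≠ 0,
        ∑ χ : MulChar (ZMod (p ^ k)) ℂ with redMod p k hk0 (T χ) = τ, f χ := by
    rw [← sum_fiberwise_of_maps_to (g := fun χ => redMod p k hk0 (T χ))
      (t := {τ : ZMod p | ∀ j, τ ^ 2 - 4 * (a j : ZMod p) ^ 2 ≠ 0})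
      fun χ hχ => by simpa using hχ]
    refine sum_congr rfl fun τ hτ => sum_congr ?_ fun _ _ => rfl
    rw [filter_filter]
    refine filter_congr fun χ _ => ⟨fun h => h.2, fun h => ⟨?_, h⟩⟩
    rw [h]
    exact (mem_filter.1 hτ).2
  have hcount : N * (c * Nat.card {x : ZMod p // ∀ j, x ^ 2 - 4 * (a j : ZMod p) ^ 2 ≠ 0 ∧
        IsSquare (x ^ 2 - 4 * (a j : ZMod p) ^ 2)}) =
      ∑ τ : ZMod p with ∀ j, τ ^ 2 - 4 * (a j : ZMod p) ^ 2 ≠ 0,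
        N * if ∀ j, IsSquare (τ ^ 2 - 4 * (a j : ZMod p) ^ 2) then c else 0 := by
    rw [← mul_sum, ← sum_filter, filter_filter, sum_const, nsmul_eq_mul, mul_comm c,
      Nat.card_eq_fintype_card, Fintype.card_subtype]
    simp only [forall_and]
  have hgeneric : ∀ τ : ZMod p, (∀ j, τ ^ 2 - 4 * (a j : ZMod p) ^ 2 ≠ 0) → aeval τ P ≠ 0 →
      ∑ χ : MulChar (ZMod (p ^ k)) ℂ with redMod p k hk0 (T χ) = τ, f χ =
        N * if ∀ j, IsSquare (τ ^ 2 - 4 * (a j : ZMod p) ^ 2) then c else 0 := by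
    intro τ hτ hPτ
    have hmaps : ∀ χ ∈ ({χ | redMod p k hk0 (T χ) = τ} : Finset (MulChar (ZMod (p ^ k)) ℂ)),
        T χ ∈ ({t | redMod p k hk0 t = τ} : Finset (ZMod (p ^ k))) := fun χ hχ => by simpa using hχ
    have hfilter : ∀ t ∈ ({t | redMod p k hk0 t = τ} : Finset (ZMod (p ^ k))),
        ({χ | redMod p k hk0 (T χ) = τ} : Finset (MulChar (ZMod (p ^ k)) ℂ)).filter (T · = t) =
          ({χ | T χ = t} : Finset (MulChar (ZMod (p ^ k)) ℂ)) := by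
      intro t ht
      rw [filter_filter]
      refine filter_congr fun χ _ => ⟨fun h => h.2, fun h => ⟨?_, h⟩⟩
      rw [h]
      exact (mem_filter.1 ht).2
    rw [← hcard τ, card_eq_sum_card_fiberwise (f := T) fun χ hχ => by exact_mod_cast hmaps χ hχ,
      ← sum_fiberwise_of_maps_to hmaps, Nat.cast_sum, sum_mul]
    refine sum_congr rfl fun t ht => ?_
    have htτ : redMod p k hk0 t = τ := (mem_filter.1 ht).2
    rw [hfilter t ht]
    subst htτ
    exact sum_filter_prod_nKloos_pow hp2 hk ha hm hTp hT t hτ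
      fun n hn hnm s hs h => hPτ (hrel n hn hnm _ s hs h)
  have hbound : ∀ τ : ZMod p, (∀ j, τ ^ 2 - 4 * (a j : ZMod p) ^ 2 ≠ 0) →
      |∑ χ : MulChar (ZMod (p ^ k)) ℂ with redMod p k hk0 (T χ) = τ, f χ -
        N * if ∀ j, IsSquare (τ ^ 2 - 4 * (a j : ZMod p) ^ 2) then c else 0| ≤
          N * (2 * 2 ^ ∑ j, m j) := by
    intro τ hτ
    have h1 : |∑ χ : MulChar (ZMod (p ^ k)) ℂ with redMod p k hk0 (T χ) = τ, f χ| ≤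
        N * 2 ^ ∑ j, m j := by
      rw [← hcard τ, ← nsmul_eq_mul]
      refine (abs_sum_le_sum_abs _ _).trans (sum_le_card_nsmul _ _ _ fun χ hχ => ?_)
      have hχτ : redMod p k hk0 (T χ) = τ := (mem_filter.1 hχ).2
      rw [hf, abs_prod, ← prod_pow_eq_pow_sum]
      refine prod_le_prod (fun j _ => abs_nonneg _) fun j _ => ?_
      rw [abs_pow]
      refine pow_le_pow_left₀ (abs_nonneg _) ?_ _
      refine abs_nKloos_le_two hp2 hk (hTp χ) (ha j) ?_
      rw [hχτ]
      exact hτ j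
    have h2 : |N * if ∀ j, IsSquare (τ ^ 2 - 4 * (a j : ZMod p) ^ 2) then c else 0| ≤
        N * 2 ^ ∑ j, m j := by
      rw [abs_mul, abs_of_nonneg hN0]
      refine mul_le_mul_of_nonneg_left ?_ hN0
      split_ifs
      · rw [abs_of_nonneg (prod_choose_ite_nonneg m)]
        exact prod_choose_ite_le m
      · rw [abs_zero]
        positivity
    linarith [abs_sub (∑ χ : MulChar (ZMod (p ^ k)) ℂ with redMod p k hk0 (T χ) = τ, f χ)
      (N * if ∀ j, IsSquare (τ ^ 2 - 4 * (a j : ZMod p) ^ 2) then c else 0)]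
  rw [hsum, hcount, ← sum_sub_distrib]
  calc _ ≤ ∑ τ : ZMod p with ∀ j, τ ^ 2 - 4 * (a j : ZMod p) ^ 2 ≠ 0,
        |∑ χ : MulChar (ZMod (p ^ k)) ℂ with redMod p k hk0 (T χ) = τ, f χ -
          N * if ∀ j, IsSquare (τ ^ 2 - 4 * (a j : ZMod p) ^ 2) then c else 0| :=
        abs_sum_le_sum_abs _ _
    _ ≤ ∑ τ : ZMod p with ∀ j, τ ^ 2 - 4 * (a j : ZMod p) ^ 2 ≠ 0,
        if aeval τ P = 0 then N * (2 * 2 ^ ∑ j, m j) else 0 := by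
        refine sum_le_sum fun τ hτ => ?_
        have hτ' := (mem_filter.1 hτ).2
        by_cases h : aeval τ P = 0
        · rw [if_pos h]
          exact hbound τ hτ'
        · rw [if_neg h, hgeneric τ hτ' h, sub_self, abs_zero]
    _ ≤ ∑ τ : ZMod p, if aeval τ P = 0 then N * (2 * 2 ^ ∑ j, m j) else 0 := by
        refine sum_le_sum_of_subset_of_nonneg (filter_subset _ _) fun τ _ _ => ?_
        split_ifs <;> positivity
    _ = #{τ : ZMod p | aeval τ P = 0} * (N * (2 * 2 ^ ∑ j, m j)) := by
        rw [← sum_filter, sum_const, nsmul_eq_mul]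
    _ ≤ _ := by
        refine mul_le_mul_of_nonneg_right ?_ (by positivity)
        exact_mod_cast card_filter_aeval_eq_zero_le hP

end MixedMoments

section Limit

open Filter Topology

theorem tendsto_card_isSquare_div {r : ℕ} {a : Fin r → ℤ} (ha : ∀ i, a i ≠ 0)
    (hdist : ∀ i j, i ≠ j → a i ≠ a j ∧ a i ≠ -a j) :
    Tendsto (fun p : ℕ => (Nat.card {x : ZMod p // ∀ j, x ^ 2 - 4 * (a j : ZMod p) ^ 2 ≠ 0 ∧
        IsSquare (x ^ 2 - 4 * (a j : ZMod p) ^ 2)} : ℝ) / p)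
      (atTop ⊓ 𝓟 {p : ℕ | p.Prime}) (𝓝 (1 / 2 ^ r)) := by
  rw [Metric.tendsto_nhds]
  intro ε hε
  rw [eventually_inf_principal]
  filter_upwards [eventually_abs_card_isSquare_sub_le ha hdist (half_pos hε)] with p h hp
  have : Fact p.Prime := ⟨hp⟩
  have hp0 : (0 : ℝ) < p := Nat.cast_pos.2 hp.pos
  rw [Real.dist_eq, show ∀ x : ℝ, x / p - 1 / 2 ^ r = (x - p / 2 ^ r) / p from fun x => by
    field_simp, abs_div, abs_of_pos hp0, div_lt_iff₀ hp0]
  exact h.trans_lt (mul_lt_mul_of_pos_right (half_lt_self hε) hp0)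

theorem prod_momentMu {r : ℕ} (m : Fin r → ℕ) :
    ∏ j, momentMu (m j) =
      1 / 2 ^ r * ∏ j, if Even (m j) then ((m j).choose (m j / 2) : ℝ) else 0 := by
  have h : ∀ j, momentMu (m j) =
      1 / 2 * if Even (m j) then ((m j).choose (m j / 2) : ℝ) else 0 := by
    intro j
    rw [momentMu]
    split_ifs <;> simp
  rw [prod_congr rfl fun j _ => h j, prod_mul_distrib, prod_const, card_univ, Fintype.card_fin,
    one_div_pow]

theorem sub_four_mul_sq_ne_zero_iff {F : Type*} [Field F] {t b : F} :
    t ^ 2 - 4 * b ^ 2 ≠ 0 ↔ t ≠ 2 * b ∧ t ≠ -(2 * b) := by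
  rw [show t ^ 2 - 4 * b ^ 2 = (t - 2 * b) * (t - -(2 * b)) by ring, mul_ne_zero_iff,
    sub_ne_zero, sub_ne_zero]

theorem totient_prime_pow_div_mul {p k : ℕ} (hp : p.Prime) (hk : 1 < k) :
    (p : ℝ) ^ (k - 2) * (p - 1) * p = (p ^ k).totient := by
  rw [Nat.totient_prime_pow hp (by omega), Nat.cast_mul, Nat.cast_pow, Nat.cast_pred hp.pos,
    mul_right_comm, ← pow_succ]
  congr 2
  omega

end Limit

/-- **Convergence of mixed moments.** Fix distinct nonzero integers `a₁,…,a_r`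
(`a_i ≠ ±a_j` for `i ≠ j`), positive integers `m₁,…,m_r` and `k > 1`. For each prime
power `q = p^k` let `t_χ = T p χ` be the parameter of the character `χ` (characterized,
for `p` an odd prime, by `χ(1 + p^l x) = e_{p^l}(t_χ x)` for `k = 2l` even and by
`χ(1 + p^l x + p^{2l}(x²/2)) = e_{p^{l+1}}(t_χ x)` for `k = 2l+1` odd), and let
`S_q = {χ : t_χ ≢ ±2a_j (mod p) for all j}`. Then as `p → ∞` through the primes,
`(1/q) ∑_{χ ∈ S_q} ∏_j 𝒦_q(a_j,χ)^{m_j} → ∏_j ∫ x^{m_j} dμ`. -/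
theorem kloosterman_moments
    (r : ℕ) (hr : 1 ≤ r) (a : Fin r → ℤ) (ha : ∀ i, a i ≠ 0)
    (hdist : ∀ i j, i ≠ j → a i ≠ a j ∧ a i ≠ -a j)
    (m : Fin r → ℕ) (hm : ∀ i, 0 < m i) (k : ℕ) (hk : 1 < k)
    (T : (p : ℕ) → MulChar (ZMod (p ^ k)) ℂ → ZMod (p ^ (k - k / 2)))
    (hT : ∀ p : ℕ, p.Prime → p ≠ 2 → ∀ χ : MulChar (ZMod (p ^ k)) ℂ,
      (k % 2 = 0 → ∀ x : ZMod (p ^ (k - k / 2)),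
        χ (1 + (p : ZMod (p ^ k)) ^ (k / 2) * (x.val : ZMod (p ^ k))) =
          eZMod (p ^ (k - k / 2)) (T p χ * x)) ∧
      (k % 2 = 1 → ∀ x : ZMod (p ^ (k - k / 2)),
        χ (1 + (p : ZMod (p ^ k)) ^ (k / 2) * (x.val : ZMod (p ^ k)) +
            (p : ZMod (p ^ k)) ^ (2 * (k / 2)) *
              (((x ^ 2 * (2 : ZMod (p ^ (k - k / 2)))⁻¹).val : ZMod (p ^ k)))) =
          eZMod (p ^ (k - k / 2)) (T p χ * x))) :
    Filter.Tendsto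
      (fun p : ℕ =>
        (1 / (p ^ k : ℝ)) *
          ∑ χ ∈ Finset.univ.filter (fun χ : MulChar (ZMod (p ^ k)) ℂ =>
              ∀ j : Fin r, ((T p χ).val : ZMod p) ≠ 2 * ((a j : ℤ) : ZMod p) ∧
                ((T p χ).val : ZMod p) ≠ -(2 * ((a j : ℤ) : ZMod p))),
            ∏ j : Fin r, (nKloos (p ^ k) (a j) χ) ^ (m j))
      (Filter.atTop ⊓ Filter.principal {p : ℕ | p.Prime})
      (nhds (∏ j : Fin r, momentMu (m j))) := by
  classical
  have hk0 : k ≠ 0 := by omega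
  obtain ⟨P, hP0, hP⟩ := exists_relation_polynomial_forall_le ha hdist m
  set c := ∏ j, if Even (m j) then ((m j).choose (m j / 2) : ℝ) else 0 with hc
  set C : ℕ → ℝ := fun p => Nat.card {x : ZMod p // ∀ j, x ^ 2 - 4 * (a j : ZMod p) ^ 2 ≠ 0 ∧
    IsSquare (x ^ 2 - 4 * (a j : ZMod p) ^ 2)} with hC
  set K : ℝ := P.natDegree * (2 * 2 ^ ∑ j, m j) with hK
  have hinv : Filter.Tendsto (fun p : ℕ => (p : ℝ)⁻¹)
      (Filter.atTop ⊓ Filter.principal {p : ℕ | p.Prime}) (nhds 0) :=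
    tendsto_inv_atTop_nhds_zero_nat.mono_left inf_le_left
  have hmain : Filter.Tendsto (fun p : ℕ => (1 - (p : ℝ)⁻¹) * (C p / p * c))
      (Filter.atTop ⊓ Filter.principal {p : ℕ | p.Prime}) (nhds (∏ j : Fin r, momentMu (m j))) := by
    have := (hinv.const_sub 1).mul ((tendsto_card_isSquare_div ha hdist).mul_const c)
    rwa [sub_zero, one_mul, ← prod_momentMu] at this
  refine (tendsto_iff_of_dist ?_).1 hmain
  have hsmall := hinv.const_mul K
  rw [mul_zero] at hsmall
  refine squeeze_zero' (Filter.Eventually.of_forall fun _ => dist_nonneg) ?_ hsmall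
  rw [Filter.eventually_inf_principal]
  filter_upwards [eventually_two_mul_sq_ne ha hdist, eventually_map_zmod_ne_zero hP0]
    with p hne hPp hp
  have : Fact p.Prime := ⟨hp⟩
  have hp2 : p ≠ 2 := by
    rintro rfl
    exact hne.1 (by decide)
  have hpos : (0 : ℝ) < p := Nat.cast_pos.2 hp.pos
  have hpar : ∀ χ, HasParam p k χ ((T p χ).val : ZMod (p ^ k)) := fun χ =>
    hasParam_of_apply_eq_eZMod hp2 (hT p hp hp2 χ).1 (hT p hp hp2 χ).2
  have hinvar : ∀ χ (ψ : DirichletCharacter ℂ p),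
      (((T p (χ * DirichletCharacter.changeLevel (dvd_pow_self p hk0) ψ)).val : ZMod (p ^ k))) =
        ((T p χ).val : ZMod (p ^ k)) := by
    intro χ ψ
    rw [HasParam.val_injective (hpar _) ((hpar χ).mul_changeLevel hk ψ)]
  have hbound := abs_sum_filter_prod_nKloos_pow_sub_le hp2 hk hne.2.1 hm hpar hinvar hPp
    (fun n hn hnm t s hs h => hP n hn hnm t s hs h) (totient_prime_pow_div_mul hp hk)
  have hpk : (p : ℝ) ^ k = p ^ (k - 2) * p * p := by
    rw [← pow_succ, ← pow_succ]
    congr 1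
    omega
  have hfilter : ∀ χ : MulChar (ZMod (p ^ k)) ℂ,
      (∀ j, redMod p k hk0 ((T p χ).val : ZMod (p ^ k)) ^ 2 - 4 * (a j : ZMod p) ^ 2 ≠ 0) ↔
        ∀ j : Fin r, ((T p χ).val : ZMod p) ≠ 2 * ((a j : ℤ) : ZMod p) ∧
          ((T p χ).val : ZMod p) ≠ -(2 * ((a j : ℤ) : ZMod p)) := by
    intro χ
    simp only [map_natCast, sub_four_mul_sq_ne_zero_iff]
  simp only [hfilter] at hbound
  rw [dist_comm, Real.dist_eq]
  set S := ∑ χ ∈ Finset.univ.filter (fun χ : MulChar (ZMod (p ^ k)) ℂ =>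
    ∀ j : Fin r, ((T p χ).val : ZMod p) ≠ 2 * ((a j : ℤ) : ZMod p) ∧
      ((T p χ).val : ZMod p) ≠ -(2 * ((a j : ℤ) : ZMod p))),
    ∏ j : Fin r, (nKloos (p ^ k) (a j) χ) ^ (m j) with hS
  have hbound' : |S - (p : ℝ) ^ (k - 2) * (p - 1) * (c * C p)| ≤
      P.natDegree * ((p : ℝ) ^ (k - 2) * (p - 1) * (2 * 2 ^ ∑ j, m j)) := by
    convert hbound using 3
  have hq : (0 : ℝ) < p ^ k := pow_pos hpos k
  have heq : 1 / (p : ℝ) ^ k * S - (1 - (p : ℝ)⁻¹) * (C p / p * c) =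
      (S - (p : ℝ) ^ (k - 2) * (p - 1) * (c * C p)) / p ^ k := by
    rw [hpk]
    field_simp
  rw [heq, abs_div, abs_of_pos hq, div_le_iff₀ hq]
  refine hbound'.trans ?_
  have hK0 : 0 ≤ K := by positivity
  calc _ = K * ((p : ℝ) ^ (k - 2) * (p - 1)) := by rw [hK]; ring
    _ ≤ K * ((p : ℝ) ^ (k - 2) * p) := by
        refine mul_le_mul_of_nonneg_left (mul_le_mul_of_nonneg_left ?_ (by positivity)) hK0
        linarith
    _ = _ := by
        rw [hpk]
        field_simp
end

section
/- Fix nonzero integers a_1, …, a_r with a_i ≠ ±a_j for i ≠ j, and fix l ≥ 1. Then there is a constant C (depending only on a_1,…,a_r) such that for all sufficiently large primes p, |#Y'(p^l) − p^l| ≤ C·p^{l−1/2}. In other words, #Y'(p^l) = p^l + O(p^{l−1/2}) as p → ∞. -/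
open Finset

/-- The set `Y(p^l)` of tuples `x ∈ ((ℤ/p^lℤ)^*)^r` with
`a_1(x_1 + x_1⁻¹) = a_j(x_j + x_j⁻¹)` for all `j`. -/
def Yset (p l r : ℕ) (hr : 0 < r) (a : Fin r → ℤ) : Set (Fin r → (ZMod (p ^ l))ˣ) :=
  {x | ∀ j : Fin r,
    (a ⟨0, hr⟩ : ZMod (p ^ l)) *
        ((x ⟨0, hr⟩ : ZMod (p ^ l)) + (((x ⟨0, hr⟩)⁻¹ : (ZMod (p ^ l))ˣ) : ZMod (p ^ l))) =
      (a j : ZMod (p ^ l)) *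
        ((x j : ZMod (p ^ l)) + (((x j)⁻¹ : (ZMod (p ^ l))ˣ) : ZMod (p ^ l)))}

/-- The subset `Y'(p^l) ⊆ Y(p^l)` of tuples with `x_j ≢ ±1 (mod p)` for all `j`. -/
def Yset' (p l r : ℕ) (hr : 0 < r) (a : Fin r → ℤ) : Set (Fin r → (ZMod (p ^ l))ˣ) :=
  {x | x ∈ Yset p l r hr a ∧
    ∀ j : Fin r, (((x j : ZMod (p ^ l)).val : ZMod p)) ≠ 1 ∧
      (((x j : ZMod (p ^ l)).val : ZMod p)) ≠ -1}

namespace Stepanov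
open Polynomial

/-- The polynomial `q` for which the `k`-th derivative of `f ^ n * r` is `f ^ (n - k) * q`. -/
noncomputable def powMulDerivative {F : Type*} [CommRing F] (f : F[X]) (n : ℕ) :
    ℕ → F[X] →ₗ[F] F[X]
  | 0 => LinearMap.id
  | k + 1 => (LinearMap.mulLeft F (((n - k : ℕ) : F[X]) * derivative f) +
      LinearMap.mulLeft F f ∘ₗ derivative) ∘ₗ powMulDerivative f n k

lemma powMulDerivative_succ_apply {F : Type*} [CommRing F] (f : F[X]) (n k : ℕ) (r : F[X]) :
    powMulDerivative f n (k + 1) r = ((n - k : ℕ) : F[X]) * derivative f *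
      powMulDerivative f n k r + f * derivative (powMulDerivative f n k r) := by
  simp [powMulDerivative, mul_assoc]

lemma iterate_derivative_pow_mul {F : Type*} [CommRing F] (f : F[X]) {n k : ℕ} (hk : k ≤ n)
    (r w : F[X]) (hw : derivative w = 0) :
    derivative^[k] (f ^ n * r * w) = f ^ (n - k) * powMulDerivative f n k r * w := by
  induction k with
  | zero => simp [powMulDerivative]
  | succ k ih =>
    rw [Function.iterate_succ_apply', ih (by omega), powMulDerivative_succ_apply]
    obtain ⟨d, hd⟩ : ∃ d, n - k = d + 1 := ⟨n - k - 1, by omega⟩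
    have hd' : n - (k + 1) = d := by omega
    rw [hd', hd]
    simp only [derivative_mul, derivative_pow, hw, Nat.add_sub_cancel, map_natCast]
    ring

lemma degree_powMulDerivative_lt {F : Type*} [CommRing F] {f : F[X]} {m : ℕ}
    (hf : f.natDegree ≤ m) (n k : ℕ) {A : ℕ} {r : F[X]} (hr : r.degree < A) :
    (powMulDerivative f n k r).degree < (A + k * m : ℕ) := by
  induction k with
  | zero => simpa [powMulDerivative] using hr
  | succ k ih =>
    rw [powMulDerivative_succ_apply]
    set q := powMulDerivative f n k r
    by_cases hq : q = 0
    · simp [hq]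
      exact WithBot.bot_lt_coe _
    have hq' : q.natDegree < A + k * m := (natDegree_lt_iff_degree_lt hq).2 ih
    refine (degree_le_natDegree).trans_lt (Nat.cast_lt.2 ?_)
    have h1 : (((n - k : ℕ) : F[X]) * derivative f * q).natDegree ≤ m + q.natDegree := by
      refine natDegree_mul_le.trans (Nat.add_le_add_right (natDegree_mul_le.trans ?_) _)
      rw [natDegree_natCast, zero_add]
      exact (natDegree_derivative_le f).trans ((Nat.sub_le _ _).trans hf)
    have h2 : (f * derivative q).natDegree ≤ m + q.natDegree :=
      natDegree_mul_le.trans (Nat.add_le_add hf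
        ((natDegree_derivative_le q).trans (Nat.sub_le _ _)))
    have := natDegree_add_le_of_degree_le h1 h2
    rw [add_mul, one_mul]
    omega

lemma eq_zero_of_sq_mul_eq {F : Type*} [Field F] {f r s : F[X]} {α c : F} (hc : c ≠ 0)
    (hα : f.rootMultiplicity α = 1) (h : r ^ 2 * f = C c * s ^ 2) : r = 0 ∧ s = 0 := by
  have hf : f ≠ 0 := by rintro rfl; simp at hα
  by_cases hr : r = 0
  · have h1 : C c * s ^ 2 = 0 := by rw [← h, hr]; ring
    exact ⟨hr, pow_eq_zero_iff two_ne_zero |>.1 ((mul_eq_zero.1 h1).resolve_left (C_ne_zero.2 hc))⟩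
  have hs : s ≠ 0 := by rintro rfl; simp [hr, hf] at h
  have hcs : C c * s ^ 2 ≠ 0 := mul_ne_zero (C_ne_zero.2 hc) (pow_ne_zero _ hs)
  have h1 := congrArg (rootMultiplicity α) h
  rw [rootMultiplicity_mul (h ▸ hcs), rootMultiplicity_mul hcs, rootMultiplicity_C, hα, pow_two,
    pow_two, rootMultiplicity_mul (mul_ne_zero hr hr), rootMultiplicity_mul (mul_ne_zero hs hs)]
    at h1
  omega

variable {p : ℕ} [Fact p.Prime]

lemma eq_zero_of_X_pow_dvd {f : (ZMod p)[X]} {m A : ℕ} (hp : p ≠ 2) (hf : f.natDegree ≤ m)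
    (h0 : f.coeff 0 ≠ 0) {α : ZMod p} (hα : f.rootMultiplicity α = 1) (hA : 2 * A + m ≤ p)
    {r s : (ZMod p)[X]} (hr : r.degree < A) (hs : s.degree < A)
    (h : X ^ p ∣ r + f ^ (p / 2) * s) : r = 0 ∧ s = 0 := by
  have hodd : p / 2 + p / 2 + 1 = p := by
    have := (Fact.out : p.Prime).eq_two_or_odd
    omega
  have hpow : X ^ p ∣ f ^ p - C (f.coeff 0) := by
    have h1 : X ∣ f - C (f.coeff 0) := by simp [X_dvd_iff]
    have h2 := pow_dvd_pow_of_dvd h1 p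
    rwa [sub_pow_char, ← C_pow, ZMod.pow_card] at h2
  have hdvd : X ^ p ∣ r ^ 2 * f - C (f.coeff 0) * s ^ 2 := by
    have h1 : r ^ 2 * f - C (f.coeff 0) * s ^ 2 =
        (r + f ^ (p / 2) * s) * ((r - f ^ (p / 2) * s) * f) + (f ^ p - C (f.coeff 0)) * s ^ 2 := by
      have h2 : f ^ p = f ^ (p / 2) * f ^ (p / 2) * f := by
        rw [← pow_add, ← pow_succ, hodd]
      rw [h2]
      ring
    rw [h1]
    exact dvd_add (Dvd.dvd.mul_right h _) (Dvd.dvd.mul_right hpow _)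
  refine eq_zero_of_sq_mul_eq h0 hα (sub_eq_zero.1 ?_)
  refine eq_zero_of_dvd_of_degree_lt hdvd ?_
  rw [degree_X_pow]
  have key : ∀ {q u : (ZMod p)[X]}, q.degree < A → u.natDegree ≤ m →
      (q ^ 2 * u).degree < (p : WithBot ℕ) := by
    intro q u hq hu
    by_cases hq0 : q = 0
    · simp [hq0]
    have hq' : q.natDegree < A := (natDegree_lt_iff_degree_lt hq0).2 hq
    refine (degree_le_natDegree).trans_lt (Nat.cast_lt.2 ?_)
    have h2 : (q ^ 2 * u).natDegree ≤ 2 * q.natDegree + m :=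
      natDegree_mul_le.trans (Nat.add_le_add natDegree_pow_le hu)
    omega
  refine (degree_sub_le _ _).trans_lt (max_lt (key hr hf) ?_)
  rw [mul_comm]
  exact key hs (by simp)

lemma eq_zero_of_sum_eq_zero {f : (ZMod p)[X]} {m A : ℕ} (hp : p ≠ 2) (hf : f.natDegree ≤ m)
    (h0 : f.coeff 0 ≠ 0) {α : ZMod p} (hα : f.rootMultiplicity α = 1) (hA : 2 * A + m ≤ p)
    (J : ℕ) (r s : ℕ → (ZMod p)[X]) (hr : ∀ j, (r j).degree < A) (hs : ∀ j, (s j).degree < A)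
    (h : ∑ j ∈ range J, (r j + f ^ (p / 2) * s j) * X ^ (p * j) = 0) :
    ∀ j < J, r j = 0 ∧ s j = 0 := by
  induction J generalizing r s with
  | zero => simp
  | succ J ih =>
    have hsum : ∑ j ∈ range (J + 1), (r j + f ^ (p / 2) * s j) * X ^ (p * j) =
        X ^ p * (∑ j ∈ range J, (r (j + 1) + f ^ (p / 2) * s (j + 1)) * X ^ (p * j)) +
          (r 0 + f ^ (p / 2) * s 0) := by
      rw [sum_range_succ', mul_sum, mul_zero, pow_zero, mul_one]
      congr 1
      refine sum_congr rfl fun j _ => ?_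
      ring
    rw [hsum] at h
    have hz : r 0 = 0 ∧ s 0 = 0 := by
      refine eq_zero_of_X_pow_dvd hp hf h0 hα hA (hr 0) (hs 0) ?_
      exact (dvd_add_right (dvd_mul_right _ _)).1 (h ▸ dvd_zero _)
    rw [hz.1, hz.2, mul_zero, add_zero, add_zero] at h
    have ih' := ih (fun j => r (j + 1)) (fun j => s (j + 1)) (fun _ => hr _) (fun _ => hs _)
      ((mul_eq_zero.1 h).resolve_left (pow_ne_zero _ X_ne_zero))
    intro j hj
    cases j with
    | zero => exact hz
    | succ j => exact ih' j (by omega)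

lemma exists_ne_zero_sum_powMulDerivative_eq_zero {F : Type*} [Field F] {f : F[X]} {m : ℕ}
    (hf : f.natDegree ≤ m) (ε : F) (h : ℕ) {A l J : ℕ}
    (hcount : l * (A + l * m + J) < J * (A + A)) :
    ∃ r s : ℕ → F[X], (∀ j, (r j).degree < A) ∧ (∀ j, (s j).degree < A) ∧
      (∃ j < J, ¬ (r j = 0 ∧ s j = 0)) ∧
      ∀ k < l, ∑ j ∈ range J, (powMulDerivative f l k (r j) +
        C ε * powMulDerivative f (l + h) k (s j)) * X ^ j = 0 := by
  let V := Fin J → (degreeLT F A × degreeLT F A)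
  let Q : Fin l → V →ₗ[F] F[X] := fun k =>
    ∑ j : Fin J, LinearMap.mulRight F (X ^ (j : ℕ)) ∘ₗ
      ((powMulDerivative f l k ∘ₗ (degreeLT F A).subtype ∘ₗ LinearMap.fst F _ _ +
        LinearMap.mulLeft F (C ε) ∘ₗ powMulDerivative f (l + h) k ∘ₗ
          (degreeLT F A).subtype ∘ₗ LinearMap.snd F _ _) ∘ₗ LinearMap.proj j)
  have hQ : ∀ k v, Q k v = ∑ j : Fin J, (powMulDerivative f l k (v j).1 +
      C ε * powMulDerivative f (l + h) k (v j).2) * X ^ (j : ℕ) := by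
    intro k v
    simp [Q]
    rfl
  let T : V →ₗ[F] (Fin l → Fin (A + l * m + J) → F) :=
    LinearMap.pi fun k => LinearMap.pi fun b => lcoeff F b ∘ₗ Q k
  have : FiniteDimensional F (degreeLT F A) :=
    Module.Finite.equiv (degreeLTEquiv F A).symm
  have hfr : Module.finrank F (degreeLT F A) = A := by
    rw [(degreeLTEquiv F A).finrank_eq]
    simp
  have hker : LinearMap.ker T ≠ ⊥ := by
    apply LinearMap.ker_ne_bot_of_finrank_lt
    simp only [V, Module.finrank_pi_fintype, Module.finrank_prod, hfr, Module.finrank_self]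
    simpa using hcount
  obtain ⟨v, hv, hv0⟩ := Submodule.exists_mem_ne_zero_of_ne_bot hker
  rw [LinearMap.mem_ker] at hv
  refine ⟨fun j => if hj : j < J then (v ⟨j, hj⟩).1 else 0,
    fun j => if hj : j < J then (v ⟨j, hj⟩).2 else 0, ?_, ?_, ?_, ?_⟩
  · intro j
    dsimp only
    split_ifs with hj
    · exact mem_degreeLT.1 (v ⟨j, hj⟩).1.2
    · rw [degree_zero]
      exact WithBot.bot_lt_coe _
  · intro j
    dsimp only
    split_ifs with hj
    · exact mem_degreeLT.1 (v ⟨j, hj⟩).2.2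
    · rw [degree_zero]
      exact WithBot.bot_lt_coe _
  · by_contra! hcon
    refine hv0 (funext fun j => ?_)
    have := hcon j j.2
    simp only [j.2, dite_true] at this
    exact Prod.ext (Subtype.ext this.1) (Subtype.ext this.2)
  · intro k hk
    rw [Finset.sum_range]
    have h1 : Q ⟨k, hk⟩ v = 0 := by
      have hdeg : (Q ⟨k, hk⟩ v).degree < (A + l * m + J : ℕ) := by
        rw [hQ, ← mem_degreeLT]
        refine Submodule.sum_mem _ fun j _ => mem_degreeLT.2 ?_
        have hkm : k * m ≤ l * m := Nat.mul_le_mul_right _ hk.le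
        have h2 : (powMulDerivative f l k (v j).1 +
            C ε * powMulDerivative f (l + h) k (v j).2 : F[X]).degree < (A + k * m : ℕ) := by
          refine (degree_add_le _ _).trans_lt (max_lt ?_ ?_)
          · exact degree_powMulDerivative_lt hf _ _ (mem_degreeLT.1 (v j).1.2)
          · refine lt_of_le_of_lt ?_
              (degree_powMulDerivative_lt hf (l + h) k (mem_degreeLT.1 (v j).2.2))
            rw [← smul_eq_C_mul]
            exact degree_smul_le _ _
        rw [degree_mul, degree_X_pow]
        set q : F[X] := powMulDerivative f l k (v j).1 +
            C ε * powMulDerivative f (l + h) k (v j).2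
        by_cases hq : q = 0
        · rw [hq, degree_zero, WithBot.bot_add]
          exact WithBot.bot_lt_coe _
        rw [degree_eq_natDegree hq] at h2 ⊢
        have h3 := Nat.cast_lt.1 h2
        have := j.2
        rw [← Nat.cast_add]
        exact Nat.cast_lt.2 (by omega)
      ext b
      by_cases hb : b < A + l * m + J
      · exact congrFun (congrFun hv ⟨k, hk⟩) ⟨b, hb⟩
      · rw [coeff_zero]
        exact coeff_eq_zero_of_degree_lt (hdeg.trans_le (Nat.cast_le.2 (not_lt.1 hb)))
    rw [hQ] at h1
    simpa using h1

lemma card_mul_le_natDegree {P : (ZMod p)[X]} (hP : P ≠ 0) {l : ℕ} (hl : l ≤ p)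
    (S : Finset (ZMod p)) (hS : ∀ x ∈ S, ∀ k < l, (derivative^[k] P).eval x = 0) :
    #S * l ≤ P.natDegree := by
  classical
  have hmult : ∀ x ∈ S, l ≤ P.roots.count x := by
    intro x hx
    rw [count_roots]
    rcases Nat.eq_zero_or_pos l with rfl | hpos
    · exact Nat.zero_le _
    have : l - 1 < P.rootMultiplicity x := by
      apply lt_rootMultiplicity_of_isRoot_iterate_derivative_of_mem_nonZeroDivisors hP
      · exact fun k hk => hS x hx k (by omega)
      · rw [mem_nonZeroDivisors_iff_ne_zero, Ne, ZMod.natCast_eq_zero_iff,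
          (Fact.out : p.Prime).dvd_factorial]
        omega
    omega
  calc #S * l = ∑ x ∈ S, l := by simp
    _ ≤ ∑ x ∈ S, P.roots.count x := sum_le_sum hmult
    _ ≤ P.roots.card := by
      refine le_trans ?_ (Multiset.toFinset_sum_count_eq P.roots).le
      refine Finset.sum_le_sum_of_ne_zero fun x _ hx => ?_
      exact Multiset.mem_toFinset.2 (Multiset.count_ne_zero.1 hx)
    _ ≤ P.natDegree := card_roots' P

/-- Stepanov's upper bound, before optimising the parameters. -/
lemma card_mul_le {f : (ZMod p)[X]} {m A l J : ℕ} (hp : p ≠ 2) (hf : f.natDegree ≤ m)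
    (h0 : f.coeff 0 ≠ 0) {α : ZMod p} (hα : f.rootMultiplicity α = 1) (hA : 2 * A + m ≤ p)
    (hl : l ≤ p) (hcount : l * (A + l * m + J) < J * (A + A)) {ε : ZMod p}
    (S : Finset (ZMod p)) (hS : ∀ x ∈ S, f.eval x ^ (p / 2) = ε) (hS0 : ∀ x ∈ S, f.eval x ≠ 0) :
    #S * l ≤ (l + p / 2) * m + A + J * p := by
  have hf0 : f ≠ 0 := by rintro rfl; simp at h0
  obtain ⟨r, s, hr, hs, ⟨j, hj, hj0⟩, hrs⟩ :=
    exists_ne_zero_sum_powMulDerivative_eq_zero hf ε (p / 2) hcount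
  set P : (ZMod p)[X] := ∑ j ∈ range J,
    (f ^ l * r j * X ^ (p * j) + f ^ (l + p / 2) * s j * X ^ (p * j)) with hPdef
  have hP : P ≠ 0 := by
    intro h
    refine hj0 (eq_zero_of_sum_eq_zero hp hf h0 hα hA J r s hr hs ?_ j hj)
    refine (mul_eq_zero.1 (?_ : f ^ l * _ = 0)).resolve_left (pow_ne_zero l hf0)
    rw [← h, hPdef, mul_sum]
    refine sum_congr rfl fun j _ => ?_
    ring
  have hw : ∀ j, derivative (X ^ (p * j) : (ZMod p)[X]) = 0 := by
    intro j
    rw [derivative_X_pow]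
    simp
  refine (card_mul_le_natDegree hP hl S fun x hx k hk => ?_).trans ?_
  · have h1 := congrArg (eval x) (hrs k hk)
    rw [hPdef, iterate_derivative_sum]
    simp only [iterate_map_add]
    have h2 : ∀ j, eval x (derivative^[k] (f ^ l * r j * X ^ (p * j)) +
        derivative^[k] (f ^ (l + p / 2) * s j * X ^ (p * j))) =
        eval x f ^ (l - k) * eval x ((powMulDerivative f l k (r j) +
        C ε * powMulDerivative f (l + p / 2) k (s j)) * X ^ j) := by
      intro j
      rw [iterate_derivative_pow_mul f hk.le _ _ (hw j),
        iterate_derivative_pow_mul f (by omega) _ _ (hw j)]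
      have h3 : l + p / 2 - k = (l - k) + p / 2 := by omega
      simp only [eval_add, eval_mul, eval_pow, eval_X, eval_C, pow_mul, ZMod.pow_card, h3, pow_add,
        hS x hx]
      ring
    rw [eval_finsetSum, sum_congr rfl fun j _ => h2 j, ← mul_sum, ← eval_finsetSum, h1]
    simp
  · refine natDegree_sum_le_of_forall_le _ _ fun j hj => ?_
    have hjJ : p * j ≤ J * p := by
      rw [mul_comm]
      exact Nat.mul_le_mul_right _ (mem_range.1 hj).le
    have hbound : ∀ {q : (ZMod p)[X]} {n : ℕ}, q.degree < A → n ≤ l + p / 2 →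
        (f ^ n * q * X ^ (p * j)).natDegree ≤ (l + p / 2) * m + A + J * p := by
      intro q n hq hn
      have hq' : q.natDegree ≤ A := natDegree_le_of_degree_le hq.le
      have h4 : (f ^ n).natDegree ≤ (l + p / 2) * m :=
        natDegree_pow_le.trans (Nat.mul_le_mul hn hf)
      refine natDegree_mul_le.trans (Nat.add_le_add (natDegree_mul_le.trans
        (Nat.add_le_add h4 hq')) ?_)
      rwa [natDegree_X_pow]
    exact natDegree_add_le_of_degree_le (hbound (hr j) (by omega)) (hbound (hs j) le_rfl)

lemma two_mul_card_le {f : (ZMod p)[X]} {m : ℕ} (hpm : 16 * (2 * m + 3) ^ 2 ≤ p)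
    (hf : f.natDegree ≤ m) (h0 : f.coeff 0 ≠ 0) {α : ZMod p} (hα : f.rootMultiplicity α = 1)
    {ε : ZMod p} (S : Finset (ZMod p)) (hS : ∀ x ∈ S, f.eval x ^ (p / 2) = ε)
    (hS0 : ∀ x ∈ S, f.eval x ≠ 0) :
    2 * #S ≤ p + 28 * (m + 1) * p.sqrt := by
  set l := p.sqrt with hl
  have hll : l * l ≤ p := Nat.sqrt_le p
  have hll' : p < (l + 1) * (l + 1) := Nat.lt_succ_sqrt p
  have hKl : 4 * (2 * m + 3) ≤ l := by
    rw [hl, Nat.le_sqrt]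
    nlinarith
  have hp2 : p ≠ 2 := by
    rintro rfl
    nlinarith
  have hlp : l ≤ p := Nat.sqrt_le_self p
  have hmp : 2 * m + 2 ≤ p := by omega
  set A := (p - m) / 2 with hA
  have hA1 : 2 * A + m ≤ p := by omega
  have hA2 : p ≤ 4 * A := by omega
  set J := l / 2 + (2 * m + 3) with hJ
  have hJ1 : l + (4 * m + 5) ≤ 2 * J := by omega
  have hJ2 : 2 * J ≤ l + (4 * m + 6) := by omega
  have hcount : l * (A + l * m + J) < J * (A + A) := by
    have e1 : (l + (4 * m + 5)) * A ≤ 2 * J * A := Nat.mul_le_mul_right _ hJ1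
    have e2 : (4 * m + 5) * p ≤ (4 * m + 5) * (4 * A) := Nat.mul_le_mul_left _ hA2
    have e3 : l * (2 * J) ≤ l * (l + (4 * m + 6)) := Nat.mul_le_mul_left _ hJ2
    have e4 : l * (4 * (2 * m + 3)) ≤ l * l := Nat.mul_le_mul_left _ hKl
    have e5 : l * l * m ≤ p * m := Nat.mul_le_mul_right _ hll
    nlinarith
  have key := card_mul_le hp2 hf h0 hα hA1 hlp hcount S hS hS0
  have hlpos : 0 < l := by omega
  refine Nat.le_of_mul_le_mul_right (c := l) ?_ hlpos
  have e1 : 2 * J * p ≤ (l + (4 * m + 6)) * p := Nat.mul_le_mul_right _ hJ2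
  have e2 : l * m ≤ p * m := Nat.mul_le_mul_right _ hlp
  have e3 : 2 * (p / 2) * m ≤ p * m := Nat.mul_le_mul_right _ (by omega)
  have e4 : p ≤ 4 * (l * l) := by nlinarith
  have e5 : (m + 1) * p ≤ (m + 1) * (4 * (l * l)) := Nat.mul_le_mul_left _ e4
  nlinarith

/-- The Weil bound for the quadratic character of a polynomial over a large prime field, with a
non-optimal constant. -/
theorem abs_sum_quadraticChar_eval_le {f : (ZMod p)[X]} {m : ℕ}
    (hpm : 16 * (2 * m + 3) ^ 2 ≤ p) (hf : f.natDegree ≤ m) (h0 : f.coeff 0 ≠ 0) {α : ZMod p}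
    (hα : f.rootMultiplicity α = 1) :
    |∑ x, quadraticChar (ZMod p) (f.eval x)| ≤ 28 * (m + 1) * p.sqrt + m := by
  classical
  have hf0 : f ≠ 0 := by rintro rfl; simp at h0
  have hp2 : ringChar (ZMod p) ≠ 2 := by
    rw [ZMod.ringChar_zmod_n]
    rintro rfl
    nlinarith
  have hpow : ∀ (ε : ℤ) (x : ZMod p), quadraticChar (ZMod p) (f.eval x) = ε →
      f.eval x ^ (p / 2) = (ε : ZMod p) := by
    intro ε x hx
    rw [← hx, quadraticChar_eq_pow_of_char_ne_two' hp2, ZMod.card]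
  have hbound : ∀ ε : ℤ, ε ≠ 0 →
      2 * #{x | quadraticChar (ZMod p) (f.eval x) = ε} ≤ p + 28 * (m + 1) * p.sqrt := by
    intro ε hε
    refine two_mul_card_le hpm hf h0 hα _ (fun x hx => hpow ε x (mem_filter.1 hx).2) ?_
    intro x hx hx0
    rw [mem_filter, hx0, MulChar.map_zero] at hx
    exact hε hx.2.symm
  have hzero : #{x | quadraticChar (ZMod p) (f.eval x) = 0} ≤ m := by
    refine le_trans ?_ ((card_roots' f).trans hf)
    refine le_trans (card_le_card fun x hx => ?_) (Multiset.toFinset_card_le f.roots)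
    rw [Multiset.mem_toFinset, mem_roots hf0]
    exact quadraticChar_eq_zero_iff.1 (mem_filter.1 hx).2
  have htri : ∀ x, quadraticChar (ZMod p) (f.eval x) = 0 ∨
      quadraticChar (ZMod p) (f.eval x) = 1 ∨ quadraticChar (ZMod p) (f.eval x) = -1 := by
    intro x
    by_cases hx : f.eval x = 0
    · exact Or.inl (quadraticChar_eq_zero_iff.2 hx)
    · exact Or.inr (quadraticChar_dichotomy hx)
  have hcard : (p : ℤ) = #{x | quadraticChar (ZMod p) (f.eval x) = 0} +
      #{x | quadraticChar (ZMod p) (f.eval x) = 1} +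
      #{x | quadraticChar (ZMod p) (f.eval x) = -1} := by
    have : (p : ℤ) = ∑ x : ZMod p, 1 := by simp [ZMod.card]
    rw [this]
    simp only [card_filter, Nat.cast_sum, ← sum_add_distrib]
    refine sum_congr rfl fun x _ => ?_
    rcases htri x with h | h | h <;> simp [h]
  have hsum : ∑ x, quadraticChar (ZMod p) (f.eval x) =
      #{x | quadraticChar (ZMod p) (f.eval x) = 1} -
      (#{x | quadraticChar (ZMod p) (f.eval x) = -1} : ℤ) := by
    simp only [card_filter, Nat.cast_sum, ← sum_sub_distrib]
    refine sum_congr rfl fun x _ => ?_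
    rcases htri x with h | h | h <;> simp [h]
  have h1 := hbound 1 one_ne_zero
  have h2 := hbound (-1) (by norm_num)
  rw [hsum, abs_le]
  zify at h1 h2 hzero
  constructor <;> linarith

end Stepanov

/-- The units `x ≢ ±1` with `a (x + x⁻¹) = t`, where the congruence is tested through `π`. -/
def addInvFiber {R k : Type*} [CommRing R] [Field k] (π : R →+* k) (a t : R) : Set Rˣ :=
  {x | (π x ≠ 1 ∧ π x ≠ -1) ∧ a * ((x : R) + ((x⁻¹ : Rˣ) : R)) = t}

lemma mul_add_inv_eq_iff {R : Type*} [CommRing R] (a t : R) (x : Rˣ) :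
    a * ((x : R) + ((x⁻¹ : Rˣ) : R)) = t ↔ a * (x : R) ^ 2 - t * x + a = 0 := by
  rw [← x.isUnit.mul_left_inj]
  have hx : ((x⁻¹ : Rˣ) : R) * x = 1 := x.inv_mul
  constructor <;> intro h
  · linear_combination h - a * hx
  · linear_combination h + a * hx

lemma isUnit_of_map_ne_zero {R k : Type*} [CommRing R] [Field k] {π : R →+* k}
    (hsurj : Function.Surjective π) (hker : ∀ x, π x = 0 → IsNilpotent x) {u : R}
    (hu : π u ≠ 0) : IsUnit u := by
  obtain ⟨v, hv⟩ := hsurj (π u)⁻¹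
  have h1 : IsNilpotent (u * v - 1) := hker _ (by simp [hv, hu])
  have h2 := h1.isUnit_one_add
  rw [add_sub_cancel] at h2
  exact isUnit_of_mul_isUnit_left h2

open Polynomial in
lemma card_addInvFiber_eq_of_ker_nilpotent {R k : Type*} [CommRing R] [Field k] {π : R →+* k}
    (hsurj : Function.Surjective π) (hker : ∀ x, π x = 0 → IsNilpotent x) {a : R}
    (ha : π a ≠ 0) (t : R) :
    Nat.card (addInvFiber π a t) = Nat.card (addInvFiber (RingHom.id k) (π a) (π t)) := by
  refine Nat.card_congr (Equiv.ofBijective (fun x => ⟨Units.map π.toMonoidHom x.1, ?_⟩) ⟨?_, ?_⟩)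
  · obtain ⟨x, hx, h⟩ := x
    refine ⟨hx, ?_⟩
    simpa using congrArg π h
  · rintro ⟨x, hx, hxt⟩ ⟨y, hy, hyt⟩ hxy
    have hxy' : π x = π y := congrArg Units.val (congrArg Subtype.val hxy)
    rw [mul_add_inv_eq_iff] at hxt hyt
    have hau := isUnit_of_map_ne_zero hsurj hker ha
    have hu : IsUnit ((x : R) * y - 1) := by
      apply isUnit_of_map_ne_zero hsurj hker
      rw [map_sub, map_mul, map_one, hxy', sub_ne_zero, Ne, mul_self_eq_one_iff]
      exact not_or.2 hy
    have h : ((x : R) - y) * (a * ((x : R) * y - 1)) = 0 := by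
      linear_combination (y : R) * hxt - (x : R) * hyt
    exact Subtype.ext (Units.ext (sub_eq_zero.1 ((hau.mul hu).mul_left_eq_zero.1 h)))
  · rintro ⟨y, hy, hyt⟩
    obtain ⟨x₀, hx₀⟩ := hsurj (y : k)
    rw [mul_add_inv_eq_iff] at hyt
    set P : R[X] := C a * X ^ 2 - C t * X + C a with hP
    have hPe : ∀ z : R, aeval z P = a * z ^ 2 - t * z + a := by
      intro z
      simp [hP]
    have hP'e : aeval x₀ (derivative P) = 2 * a * x₀ - t := by
      simp [hP]
      ring
    have hnil : IsNilpotent (aeval x₀ P) := by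
      apply hker
      rw [hPe]
      simpa [hx₀] using hyt
    have hunit : IsUnit (aeval x₀ (derivative P)) := by
      apply isUnit_of_map_ne_zero hsurj hker
      rw [hP'e]
      simp only [map_sub, map_mul, map_ofNat, hx₀]
      intro h0
      have h1 : π a * ((y : k) * y - 1) = 0 := by linear_combination y * h0 - hyt
      have h2 := sub_eq_zero.1 ((mul_eq_zero.1 h1).resolve_left ha)
      exact not_or.2 hy (mul_self_eq_one_iff.1 h2)
    obtain ⟨x, ⟨hx, hxP⟩, -⟩ := existsUnique_nilpotent_sub_and_aeval_eq_zero hnil hunit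
    have hπ : π x = y := by
      have := (hx.map π).eq_zero
      rw [map_sub, hx₀, sub_eq_zero] at this
      exact this.symm
    obtain ⟨u, rfl⟩ : IsUnit x := isUnit_of_map_ne_zero hsurj hker (hπ ▸ y.ne_zero)
    rw [hPe] at hxP
    refine ⟨⟨u, ?_, (mul_add_inv_eq_iff _ _ _).2 hxP⟩, Subtype.ext (Units.ext hπ)⟩
    rw [hπ]
    exact hy

lemma card_addInvFiber_of_sq_eq {k : Type*} [Field k] {a t : k} (ha : a ≠ 0)
    (hD : t ^ 2 - 4 * a ^ 2 = 0) : Nat.card (addInvFiber (RingHom.id k) a t) = 0 := by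
  rw [Nat.card_eq_zero]
  refine Or.inl ⟨?_⟩
  rintro ⟨x, hx, hxt⟩
  rw [mul_add_inv_eq_iff] at hxt
  have h1 : (2 * a * x - t) ^ 2 = 0 := by linear_combination 4 * a * hxt + hD
  have h3 := pow_eq_zero_iff two_ne_zero |>.1 h1
  have h4 : a * ((x : k) * x - 1) = 0 := by linear_combination x * h3 - hxt
  have h5 := sub_eq_zero.1 ((mul_eq_zero.1 h4).resolve_left ha)
  exact not_or.2 hx (mul_self_eq_one_iff.1 h5)

lemma card_addInvFiber_of_sq_ne {k : Type*} [Field k] [Fintype k] [DecidableEq k]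
    (h2 : (2 : k) ≠ 0) {a t : k} (ha : a ≠ 0) (hD : t ^ 2 - 4 * a ^ 2 ≠ 0) :
    (Nat.card (addInvFiber (RingHom.id k) a t) : ℤ) = 1 + quadraticChar k (t ^ 2 - 4 * a ^ 2) := by
  have hchar : ringChar k ≠ 2 := by
    intro h
    apply h2
    have := ringChar.Nat.cast_ringChar (R := k)
    rwa [h, Nat.cast_ofNat] at this
  rw [add_comm, ← quadraticChar_card_sqrts hchar, Set.toFinset_card, ← Nat.card_eq_fintype_card]
  congr 1
  refine Nat.card_congr (Equiv.ofBijective (fun x => ⟨2 * a * (x.1 : k) - t, ?_⟩) ⟨?_, ?_⟩)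
  · obtain ⟨x, hx, hxt⟩ := x
    rw [mul_add_inv_eq_iff] at hxt
    change (2 * a * (x : k) - t) ^ 2 = _
    linear_combination 4 * a * hxt
  · rintro ⟨x, hx⟩ ⟨y, hy⟩ hxy
    have h := sub_left_injective (congrArg Subtype.val hxy)
    exact Subtype.ext (Units.ext (mul_left_cancel₀ (mul_ne_zero h2 ha) h))
  · rintro ⟨y, hy⟩
    change y ^ 2 = _ at hy
    have h2a := mul_ne_zero h2 ha
    set x := (y + t) / (2 * a) with hx
    have hy' : y = 2 * a * x - t := by
      rw [hx]
      field_simp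
      ring
    have hq : a * x ^ 2 - t * x + a = 0 := by
      have : (4 * a) * (a * x ^ 2 - t * x + a) = 0 := by
        rw [hy'] at hy
        linear_combination hy
      refine (mul_eq_zero.1 this).resolve_left (mul_ne_zero ?_ ha)
      have h4 : (4 : k) = 2 * 2 := by norm_num
      rw [h4]
      exact mul_ne_zero h2 h2
    have hx0 : x ≠ 0 := by
      intro h0
      rw [h0] at hq
      apply ha
      linear_combination hq
    refine ⟨⟨Units.mk0 x hx0, ⟨?_, ?_⟩, (mul_add_inv_eq_iff _ _ _).2 hq⟩, Subtype.ext hy'.symm⟩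
    · intro h1
      change x = 1 at h1
      rw [h1] at hq
      apply hD
      linear_combination (-2 * a - t) * hq
    · intro h1
      change x = -1 at h1
      rw [h1] at hq
      apply hD
      linear_combination (-2 * a + t) * hq

lemma sum_comp_ringHom_eq {R k : Type*} [Ring R] [Ring k] [Fintype R] [Fintype k]
    {π : R →+* k} (hsurj : Function.Surjective π) {c : ℕ}
    (hc : Fintype.card R = Fintype.card k * c) (g : k → ℤ) :
    ∑ t, g (π t) = c * ∑ t, g t := by
  classical
  have hfib : ∀ y, #{t | π t = y} = #{t | π t = 0} := fun y =>
    AddMonoidHom.card_fiber_eq_of_mem_range π.toAddMonoidHom (hsurj y) (hsurj 0)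
  have hc' : c = #{t | π t = 0} := by
    have h1 := card_eq_sum_card_fiberwise (s := (univ : Finset R)) (t := univ) (f := π) (by simp)
    rw [sum_congr rfl fun y _ => hfib y] at h1
    simp only [card_univ, sum_const, smul_eq_mul] at h1
    exact Nat.eq_of_mul_eq_mul_left Fintype.card_pos (hc.symm.trans h1)
  rw [← sum_fiberwise (s := univ) (g := π), mul_sum]
  refine sum_congr rfl fun y _ => ?_
  rw [sum_congr rfl fun t ht => by rw [(mem_filter.1 ht).2], sum_const, hfib y, ← hc', nsmul_eq_mul]

open Polynomial in
lemma rootMultiplicity_prod_sq_sub {k ι : Type*} [Field k] [DecidableEq ι] (h2 : (2 : k) ≠ 0)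
    {b : ι → k} (hb : ∀ i, b i ≠ 0) (hbb : ∀ i j, i ≠ j → b i ≠ b j ∧ b i ≠ -b j)
    {s : Finset ι} {i : ι} (hi : i ∈ s) :
    (∏ j ∈ s, (X ^ 2 - C (4 * b j ^ 2)) : k[X]).rootMultiplicity (2 * b i) = 1 := by
  set q : k[X] := (X + C (2 * b i)) * ∏ j ∈ s.erase i, (X ^ 2 - C (4 * b j ^ 2)) with hq
  have hfac : (∏ j ∈ s, (X ^ 2 - C (4 * b j ^ 2)) : k[X]) = (X - C (2 * b i)) * q := by
    rw [← mul_prod_erase s _ hi, hq, ← mul_assoc]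
    congr 1
    simp only [map_mul, map_pow, map_ofNat]
    ring
  have hqe : q.eval (2 * b i) ≠ 0 := by
    rw [hq, eval_mul, eval_prod]
    refine mul_ne_zero ?_ (prod_ne_zero_iff.2 fun j hj => ?_)
    · have : eval (2 * b i) (X + C (2 * b i)) = 2 * 2 * b i := by
        simp
        ring
      rw [this]
      exact mul_ne_zero (mul_ne_zero h2 h2) (hb i)
    · have : eval (2 * b i) (X ^ 2 - C (4 * b j ^ 2)) = 2 * 2 * (b i - b j) * (b i + b j) := by
        simp
        ring
      rw [this]
      obtain ⟨h, h'⟩ := hbb i j (ne_of_mem_erase hj).symm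
      refine mul_ne_zero (mul_ne_zero (mul_ne_zero h2 h2) (sub_ne_zero.2 h)) ?_
      rwa [Ne, ← eq_neg_iff_add_eq_zero]
  have hq0 : q ≠ 0 := by
    intro h
    simp [h] at hqe
  rw [hfac, rootMultiplicity_mul (mul_ne_zero (X_sub_C_ne_zero _) hq0),
    rootMultiplicity_X_sub_C_self, rootMultiplicity_eq_zero hqe]

open Polynomial in
lemma natDegree_prod_sq_sub_le {k ι : Type*} [Field k] [Fintype ι] (b : ι → k) (s : Finset ι) :
    (∏ j ∈ s, (X ^ 2 - C (4 * b j ^ 2)) : k[X]).natDegree ≤ 2 * Fintype.card ι := by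
  refine (natDegree_prod_le _ _).trans ?_
  refine (sum_le_card_nsmul s _ 2 fun j _ => ?_).trans ?_
  · rw [natDegree_X_pow_sub_C]
  · rw [smul_eq_mul, mul_comm]
    exact Nat.mul_le_mul_left _ (card_le_univ s)

open Polynomial in
lemma abs_sum_prod_card_addInvFiber_sub_le {ι : Type*} [Fintype ι] {p : ℕ} [Fact p.Prime]
    (hpm : 16 * (2 * (2 * Fintype.card ι) + 3) ^ 2 ≤ p)
    (h2 : (2 : ZMod p) ≠ 0) {b : ι → ZMod p} (hb : ∀ i, b i ≠ 0)
    (hbb : ∀ i j, i ≠ j → b i ≠ b j ∧ b i ≠ -b j) :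
    |∑ t, ∏ j, (Nat.card (addInvFiber (RingHom.id (ZMod p)) (b j) t) : ℤ) - p| ≤
      2 ^ Fintype.card ι * (28 * (2 * Fintype.card ι + 1) * p.sqrt + 2 * Fintype.card ι) +
        2 ^ Fintype.card ι * (2 * Fintype.card ι) := by
  classical
  set n := Fintype.card ι
  let χ := quadraticChar (ZMod p)
  have h4 : (4 : ZMod p) ≠ 0 := by
    have h4' : (4 : ZMod p) = 2 * 2 := by norm_num
    rw [h4']
    exact mul_ne_zero h2 h2
  have hcoeff : ∀ s : Finset ι,
      (∏ j ∈ s, (X ^ 2 - C (4 * b j ^ 2)) : (ZMod p)[X]).coeff 0 ≠ 0 := by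
    intro s
    rw [coeff_zero_eq_eval_zero, eval_prod]
    refine prod_ne_zero_iff.2 fun j _ => ?_
    simp [h4, hb j]
  have heval : ∀ (s : Finset ι) (t : ZMod p),
      (∏ j ∈ s, (X ^ 2 - C (4 * b j ^ 2)) : (ZMod p)[X]).eval t =
        ∏ j ∈ s, (t ^ 2 - 4 * b j ^ 2) := by
    intro s t
    simp [eval_prod]
  have hmain : |∑ t, ∏ j, (1 + χ (t ^ 2 - 4 * b j ^ 2)) - p| ≤
      2 ^ n * (28 * (2 * n + 1) * p.sqrt + 2 * n) := by
    have hexp : ∑ t, ∏ j, (1 + χ (t ^ 2 - 4 * b j ^ 2)) =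
        ∑ s : Finset ι, ∑ t, χ (∏ j ∈ s, (t ^ 2 - 4 * b j ^ 2)) := by
      rw [sum_comm]
      refine sum_congr rfl fun t _ => ?_
      rw [prod_one_add, powerset_univ]
      exact sum_congr rfl fun s _ => (map_prod χ _ _).symm
    rw [hexp, ← add_sum_erase _ _ (mem_univ ∅)]
    have hempty : ∑ t : ZMod p, χ (∏ j ∈ (∅ : Finset ι), (t ^ 2 - 4 * b j ^ 2)) = p := by
      simp [ZMod.card]
    rw [hempty, add_sub_cancel_left]
    refine (abs_sum_le_sum_abs _ _).trans ?_
    refine (sum_le_card_nsmul _ _ (28 * (2 * n + 1) * p.sqrt + 2 * n : ℤ) fun s hs => ?_).trans ?_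
    · obtain ⟨i, hi⟩ := nonempty_iff_ne_empty.2 (ne_of_mem_erase hs)
      have h := Stepanov.abs_sum_quadraticChar_eval_le hpm (natDegree_prod_sq_sub_le b s)
        (hcoeff s) (rootMultiplicity_prod_sq_sub h2 hb hbb hi)
      simp only [heval] at h
      exact_mod_cast h
    · rw [nsmul_eq_mul]
      refine mul_le_mul_of_nonneg_right ?_ (by positivity)
      have : #((univ : Finset (Finset ι)).erase ∅) ≤ 2 ^ n :=
        card_erase_le.trans (by rw [card_univ, Fintype.card_finset])
      exact_mod_cast this
  have hdiff : |∑ t, ∏ j, (Nat.card (addInvFiber (RingHom.id (ZMod p)) (b j) t) : ℤ) -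
      ∑ t, ∏ j, (1 + χ (t ^ 2 - 4 * b j ^ 2))| ≤ 2 ^ n * (2 * n) := by
    set f : (ZMod p)[X] := ∏ j, (X ^ 2 - C (4 * b j ^ 2)) with hf
    have hf0 : f ≠ 0 := fun h => hcoeff univ (by rw [← hf, h, coeff_zero])
    rw [← sum_sub_distrib]
    refine (abs_sum_le_sum_abs _ _).trans ?_
    have hterm : ∀ t, |∏ j, (Nat.card (addInvFiber (RingHom.id (ZMod p)) (b j) t) : ℤ) -
        ∏ j, (1 + χ (t ^ 2 - 4 * b j ^ 2))| ≤ if f.eval t = 0 then 2 ^ n else 0 := by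
      intro t
      rw [hf, heval]
      split_ifs with h0
      · obtain ⟨j, -, hj⟩ := prod_eq_zero_iff.1 h0
        rw [prod_eq_zero (mem_univ j)
          (by rw [card_addInvFiber_of_sq_eq (hb j) hj, Nat.cast_zero]), zero_sub, abs_neg,
          abs_prod]
        refine (prod_le_prod (fun _ _ => abs_nonneg _) (g := fun _ => 2) fun i _ => ?_).trans_eq
          (by rw [prod_const, card_univ])
        by_cases hi : t ^ 2 - 4 * b i ^ 2 = 0
        · simp [χ, hi]
        · rcases quadraticChar_dichotomy hi with h | h <;> simp [χ, h]
      · have hne := prod_ne_zero_iff.1 h0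
        rw [prod_congr rfl fun j hj => card_addInvFiber_of_sq_ne h2 (hb j) (hne j hj), sub_self,
          abs_zero]
    refine (sum_le_sum fun t _ => hterm t).trans ?_
    rw [← sum_filter, sum_const, nsmul_eq_mul, mul_comm]
    refine mul_le_mul_of_nonneg_left ?_ (by positivity)
    have : #{t | f.eval t = 0} ≤ 2 * n := by
      refine le_trans ?_ ((card_roots' f).trans (natDegree_prod_sq_sub_le b univ))
      refine le_trans (card_le_card fun x hx => ?_) (Multiset.toFinset_card_le f.roots)
      rw [Multiset.mem_toFinset, mem_roots hf0]
      exact (mem_filter.1 hx).2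
    exact_mod_cast this
  calc _ = |(∑ t, ∏ j, (1 + χ (t ^ 2 - 4 * b j ^ 2)) - p) +
        (∑ t, ∏ j, (Nat.card (addInvFiber (RingHom.id (ZMod p)) (b j) t) : ℤ) -
          ∑ t, ∏ j, (1 + χ (t ^ 2 - 4 * b j ^ 2)))| := by congr 1; ring
    _ ≤ _ := (abs_add_le _ _).trans (add_le_add hmain hdiff)

lemma ncard_Yset'_eq_sum {p l r : ℕ} [Fact p.Prime] [NeZero (p ^ l)] (hl : l ≠ 0) (hr : 0 < r)
    (a : Fin r → ℤ) :
    (Yset' p l r hr a).ncard = ∑ t : ZMod (p ^ l),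
      ∏ j, Nat.card (addInvFiber (ZMod.castHom (dvd_pow_self p hl) (ZMod p))
        (a j : ZMod (p ^ l)) t) := by
  set π := ZMod.castHom (dvd_pow_self p hl) (ZMod p)
  have hval : ∀ x : ZMod (p ^ l), ((x.val : ℕ) : ZMod p) = π x := by
    intro x
    rw [ZMod.castHom_apply, ZMod.natCast_val]
  have hext : ∀ {t t' : ZMod (p ^ l)} {y : ∀ j, addInvFiber π (a j : ZMod (p ^ l)) t}
      {y' : ∀ j, addInvFiber π (a j : ZMod (p ^ l)) t'}, t' = t → (∀ j, (y' j).1 = (y j).1) →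
      (⟨t', y'⟩ : Σ t, ∀ j, addInvFiber π (a j : ZMod (p ^ l)) t) = ⟨t, y⟩ := by
    rintro t _ y y' rfl h
    exact congrArg (Sigma.mk _) (funext fun j => Subtype.ext (h j))
  simp_rw [← Nat.card_pi]
  rw [← Nat.card_sigma, ← Nat.card_coe_set_eq]
  refine Nat.card_congr
    { toFun := fun x => ⟨(a ⟨0, hr⟩ : ZMod (p ^ l)) * ((x.1 ⟨0, hr⟩ : ZMod (p ^ l)) +
          (((x.1 ⟨0, hr⟩)⁻¹ : (ZMod (p ^ l))ˣ) : ZMod (p ^ l))), fun j => ⟨x.1 j, ?_, ?_⟩⟩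
      invFun := fun y => ⟨fun j => (y.2 j).1, fun j => ?_, fun j => ?_⟩
      left_inv := fun x => rfl
      right_inv := ?_ }
  · simpa only [hval] using x.2.2 j
  · exact (x.2.1 j).symm
  · exact (y.2 ⟨0, hr⟩).2.2.trans (y.2 j).2.2.symm
  · simpa only [hval] using (y.2 j).2.1
  · rintro ⟨t, y⟩
    exact hext (y ⟨0, hr⟩).2.2 fun _ => rfl

lemma eventually_intCast_zmod_ne_zero_s9 {c : ℤ} (hc : c ≠ 0) :
    ∀ᶠ p : ℕ in Filter.atTop, (c : ZMod p) ≠ 0 := by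
  filter_upwards [Filter.eventually_gt_atTop c.natAbs] with p hp h
  rw [ZMod.intCast_zmod_eq_zero_iff_dvd] at h
  exact hp.not_ge (Nat.le_of_dvd (Int.natAbs_pos.2 hc) (Int.natCast_dvd.1 h))

/-- For fixed distinct nonzero integers `a₁,…,a_r` (`a_i ≠ ±a_j` for `i ≠ j`) and fixed
`l ≥ 1`, one has `#Y'(p^l) = p^l + O(p^{l-1/2})` as `p → ∞` through the primes. -/
theorem card_Yset'_asymptotic
    (r : ℕ) (hr : 0 < r) (a : Fin r → ℤ) (ha : ∀ i, a i ≠ 0)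
    (hdist : ∀ i j, i ≠ j → a i ≠ a j ∧ a i ≠ -a j)
    (l : ℕ) (hl : 1 ≤ l) :
    ∃ C : ℝ, 0 < C ∧ ∃ N : ℕ, ∀ p : ℕ, p.Prime → N < p →
      |((Yset' p l r hr a).ncard : ℝ) - (p : ℝ) ^ l| ≤
        C * (p : ℝ) ^ ((l : ℝ) - 1 / 2) := by
  have h2 := eventually_intCast_zmod_ne_zero_s9 two_ne_zero
  have hb : ∀ᶠ p : ℕ in Filter.atTop, ∀ i, (a i : ZMod p) ≠ 0 :=
    Filter.eventually_all.2 fun i => eventually_intCast_zmod_ne_zero_s9 (ha i)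
  have hbb : ∀ᶠ p : ℕ in Filter.atTop, ∀ i j, i ≠ j →
      (a i : ZMod p) ≠ a j ∧ (a i : ZMod p) ≠ -a j := by
    refine Filter.eventually_all.2 fun i => Filter.eventually_all.2 fun j => ?_
    by_cases hij : i = j
    · exact Filter.Eventually.of_forall fun _ h => absurd hij h
    · filter_upwards [eventually_intCast_zmod_ne_zero_s9 (sub_ne_zero.2 (hdist i j hij).1),
        eventually_intCast_zmod_ne_zero_s9 (sub_ne_zero.2 (hdist i j hij).2)] with p h h' _
      rw [Int.cast_sub, sub_ne_zero] at h h'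
      exact ⟨h, by simpa using h'⟩
  obtain ⟨N, hN⟩ := Filter.eventually_atTop.1
    (h2.and (hb.and (hbb.and (Filter.eventually_ge_atTop (16 * (2 * (2 * r) + 3) ^ 2)))))
  refine ⟨2 ^ r * (28 * (2 * r + 1) + 4 * r), by positivity, N, fun p hp hNp => ?_⟩
  obtain ⟨h2, hb, hbb, hpm⟩ := hN p hNp.le
  have : Fact p.Prime := ⟨hp⟩
  have : NeZero (p ^ l) := ⟨pow_ne_zero l hp.ne_zero⟩
  have hl0 : l ≠ 0 := by omega
  set π := ZMod.castHom (dvd_pow_self p hl0) (ZMod p) with hπ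
  have hsurj : Function.Surjective π := ZMod.castHom_surjective _
  have hker : ∀ x, π x = 0 → IsNilpotent x := by
    intro x hx
    rw [hπ, ZMod.castHom_apply, ← ZMod.natCast_val, ZMod.natCast_eq_zero_iff] at hx
    refine ⟨l, ?_⟩
    rw [← ZMod.natCast_zmod_val x, ← Nat.cast_pow, ZMod.natCast_eq_zero_iff]
    exact pow_dvd_pow_of_dvd hx l
  set G : ℤ := ∑ t, ∏ j, (Nat.card (addInvFiber (RingHom.id (ZMod p)) (a j : ZMod p) t) : ℤ)
    with hG
  have hcard : ((Yset' p l r hr a).ncard : ℤ) = (p ^ (l - 1) : ℕ) * G := by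
    rw [ncard_Yset'_eq_sum hl0, hG, ← sum_comp_ringHom_eq hsurj (c := p ^ (l - 1))]
    · push_cast
      refine sum_congr rfl fun t _ => prod_congr rfl fun j _ => ?_
      rw [card_addInvFiber_eq_of_ker_nilpotent hsurj hker (by simpa using hb j), map_intCast]
    · rw [ZMod.card, ZMod.card, mul_pow_sub_one hl0]
  have hGb : |G - p| ≤ _ := abs_sum_prod_card_addInvFiber_sub_le
    (by simpa using hpm) (by simpa using h2) hb hbb
  rw [Fintype.card_fin] at hGb
  have hcardR : ((Yset' p l r hr a).ncard : ℝ) = (p : ℝ) ^ (l - 1) * G := by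
    exact_mod_cast hcard
  have hGR : |(G : ℝ) - p| ≤ 2 ^ r * (28 * (2 * r + 1) * p.sqrt + 2 * r) + 2 ^ r * (2 * r) := by
    exact_mod_cast hGb
  have hp1 : (1 : ℝ) ≤ p := by exact_mod_cast hp.one_le
  have hp0 : (0 : ℝ) < p := by positivity
  have hsqrt : ((p.sqrt : ℕ) : ℝ) ≤ √p := Real.nat_sqrt_le_real_sqrt
  have hsqrt1 : 1 ≤ √(p : ℝ) := Real.one_le_sqrt.2 hp1
  have hrpow : (p : ℝ) ^ ((l : ℝ) - 1 / 2) = (p : ℝ) ^ (l - 1) * √p := by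
    rw [Real.sqrt_eq_rpow, ← Real.rpow_natCast, ← Real.rpow_add hp0, Nat.cast_sub hl]
    congr 1
    push_cast
    ring
  have hpl : (p : ℝ) ^ l = (p : ℝ) ^ (l - 1) * p := (pow_sub_one_mul hl0 _).symm
  rw [hcardR, hpl, ← mul_sub, abs_mul, abs_of_nonneg (by positivity), hrpow, mul_left_comm]
  refine mul_le_mul_of_nonneg_left (hGR.trans ?_) (by positivity)
  rw [← mul_add, mul_assoc (2 ^ r)]
  refine mul_le_mul_of_nonneg_left ?_ (by positivity)
  have e1 : 28 * (2 * (r : ℝ) + 1) * p.sqrt ≤ 28 * (2 * r + 1) * √p :=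
    mul_le_mul_of_nonneg_left hsqrt (by positivity)
  have e2 : 4 * (r : ℝ) * 1 ≤ 4 * r * √p := mul_le_mul_of_nonneg_left hsqrt1 (by positivity)
  linarith
end
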